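/- arXiv:1605.01287 — 4 statements merged into one kernel-verified Lean document; each statement's English description precedes it below -/
import Mathlib

section
/- Let w=(w₁,w₂) with w₁ > w₂ > 0 and w₁+w₂ = 1. The set of matrices g ∈ SL₃(ℝ), viewed as a subset of the 9-dimensional space of 3×3 real matrices with its Euclidean metric, such that the trajectory {a_t g ℤ³ : t ≥ 0} is divergent — equivalently (by Mahler's compactness criterion): for every δ > 0 there exists T ≥ 0 such that for all t ≥ T the lattice a_t g ℤ³ contains a nonzero vector of Euclidean norm less than δ — has Hausdorff dimension at least 8 − 1/(1+w₁). -/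
open MeasureTheory

/-- The diagonal matrix `aₜ = diag(e^{w₁t}, e^{w₂t}, e^{-t})`. -/
noncomputable def aMat (w₁ w₂ t : ℝ) : Matrix (Fin 3) (Fin 3) ℝ :=
  Matrix.diagonal ![Real.exp (w₁ * t), Real.exp (w₂ * t), Real.exp (-t)]

open Filter Topology Set in
/-- Slicing: if positively many slices have positive `d`-dimensional Hausdorff measure, then the
whole set has positive Hausdorff measure in dimension `d` plus the dimension of the base. -/
theorem hausdorffMeasure_ne_zero_of_slices {ι Y : Type*} [Fintype ι] [MetricSpace Y]
    [MeasurableSpace Y] [BorelSpace Y] [MeasurableSpace ((ι → ℝ) × Y)] [BorelSpace ((ι → ℝ) × Y)]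
    {A : Set ((ι → ℝ) × Y)} {B : Set (ι → ℝ)}
    {d : ℝ} (hd : 0 < d) (hB : volume B ≠ 0)
    (h : ∀ z ∈ B, Measure.hausdorffMeasure d {q | (z, q) ∈ A} ≠ 0) :
    Measure.hausdorffMeasure (d + Fintype.card ι) A ≠ 0 := by
  intro h0
  have hcov : ∀ n : ℕ, ∃ t : ℕ → Set ((ι → ℝ) × Y), A ⊆ ⋃ i, t i ∧
      (∀ i, Metric.ediam (t i) ≤ ((n : ENNReal) + 1)⁻¹) ∧
      ∑' i, (⨆ _ : (t i).Nonempty, Metric.ediam (t i) ^ (d + Fintype.card ι)) <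
        (2⁻¹ : ENNReal) ^ n := by
    intro n
    rw [Measure.hausdorffMeasure_apply] at h0
    have h1 := (ENNReal.iSup_eq_zero.1 h0) (((n : ENNReal) + 1)⁻¹)
    have hr : (0 : ENNReal) < ((n : ENNReal) + 1)⁻¹ :=
      ENNReal.inv_pos.2 (by finiteness)
    have h2 := (ENNReal.iSup_eq_zero.1 h1) hr
    have h3 : (0 : ENNReal) < (2⁻¹ : ENNReal) ^ n := ENNReal.pow_pos (by simp) n
    rw [← h2] at h3
    obtain ⟨t, ht⟩ := iInf_lt_iff.1 h3
    obtain ⟨ht1, ht⟩ := iInf_lt_iff.1 ht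
    obtain ⟨ht2, ht⟩ := iInf_lt_iff.1 ht
    exact ⟨t, ht1, ht2, ht⟩
  choose t ht1 ht2 ht3 using hcov
  let S : ℕ → ℕ → Set (ι → ℝ) := fun n i => closure (Prod.fst '' t n i)
  let f : ℕ → (ι → ℝ) → ENNReal := fun n z =>
    ∑' i, (S n i).indicator (fun _ => Metric.ediam (t n i) ^ d) z
  have hfm : ∀ n i, Measurable ((S n i).indicator (fun _ => Metric.ediam (t n i) ^ d)) :=
    fun n i => measurable_const.indicator isClosed_closure.measurableSet
  have hf : ∀ n, Measurable (f n) := fun n => Measurable.tsum (hfm n)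
  have hf_le : ∀ n, ∫⁻ z, f n z ≤ (2⁻¹ : ENNReal) ^ n := by
    intro n
    rw [lintegral_tsum fun i => (hfm n i).aemeasurable]
    refine le_trans (ENNReal.tsum_le_tsum fun i => ?_) (ht3 n).le
    rw [lintegral_indicator_const isClosed_closure.measurableSet]
    rcases (t n i).eq_empty_or_nonempty with he | hne
    · simp [he]
    · have hv : volume (S n i) ≤ Metric.ediam (t n i) ^ (Fintype.card ι : ℝ) := by
        refine (Real.volume_pi_le_diam_pow _).trans ?_
        rw [ENNReal.rpow_natCast]
        gcongr
        simp only [S, Metric.ediam_closure]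
        simpa using LipschitzWith.prod_fst.ediam_image_le (t n i)
      calc _ ≤ Metric.ediam (t n i) ^ d * Metric.ediam (t n i) ^ (Fintype.card ι : ℝ) := by gcongr
        _ = Metric.ediam (t n i) ^ (d + Fintype.card ι) := by
          rw [ENNReal.rpow_add_of_nonneg _ _ hd.le (by positivity)]
        _ ≤ _ := le_iSup_of_le hne le_rfl
  have hsum : ∫⁻ z, ∑' n, f n z ≠ ⊤ := by
    rw [lintegral_tsum fun n => (hf n).aemeasurable]
    refine ne_top_of_le_ne_top ?_ (ENNReal.tsum_le_tsum hf_le)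
    rw [ENNReal.tsum_geometric]
    simp
  have hae : ∀ᵐ z, ∑' n, f n z < ⊤ :=
    ae_lt_top (Measurable.tsum hf) hsum
  apply hB
  refine measure_mono_null ?_ (ae_iff.1 hae)
  intro z hz hfin
  apply h z hz
  have htend := ENNReal.tendsto_atTop_zero_of_tsum_ne_top hfin.ne
  have hle : Measure.hausdorffMeasure d {q | (z, q) ∈ A} ≤
      liminf (fun n => ∑' i, Metric.ediam {q | (z, q) ∈ t n i} ^ d) atTop := by
    refine Measure.hausdorffMeasure_le_liminf_tsum d _ (fun n : ℕ => ((n : ENNReal) + 1)⁻¹) ?_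
      (fun n i => {q | (z, q) ∈ t n i}) ?_ ?_
    · have := ENNReal.tendsto_inv_nat_nhds_zero.comp (tendsto_add_atTop_nat 1)
      simpa [Function.comp_def] using this
    · refine Eventually.of_forall fun n i => ?_
      refine le_trans ?_ (ht2 n i)
      refine Metric.ediam_le fun p hp q hq => ?_
      refine le_trans ?_ (Metric.edist_le_ediam_of_mem hp hq)
      simp [Prod.edist_eq]
    · refine Eventually.of_forall fun n q hq => ?_
      have := ht1 n hq
      simpa using this
  refine le_antisymm (hle.trans ?_) zero_le
  rw [← htend.liminf_eq]
  refine liminf_le_liminf (Eventually.of_forall fun n => ?_)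
  refine ENNReal.tsum_le_tsum fun i => ?_
  rcases ({q | (z, q) ∈ t n i} : Set Y).eq_empty_or_nonempty with he | ⟨q, hq⟩
  · simp [he, hd]
  · have hzS : z ∈ S n i := subset_closure ⟨(z, q), hq, rfl⟩
    rw [indicator_of_mem hzS]
    refine ENNReal.rpow_le_rpow ?_ hd.le
    refine Metric.ediam_le fun p hp q hq => ?_
    refine le_trans ?_ (Metric.edist_le_ediam_of_mem hp hq)
    simp [Prod.edist_eq]

/-- The points `(x, y)` for which the lattice spanned by the columns of the unipotent matrix with
rows `(1, s, x)`, `(0, 1, y)`, `(0, 0, 1)` has a divergent trajectory. -/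
def divergentPoints (w₁ w₂ s : ℝ) : Set (ℝ × ℝ) :=
  {q | ∀ δ : ℝ, 0 < δ → ∃ T : ℝ, 0 ≤ T ∧ ∀ t : ℝ, T ≤ t → ∃ c : Fin 3 → ℤ, c ≠ 0 ∧
    |c 0 + s * c 1 + q.1 * c 2| * Real.exp (w₁ * t) < δ ∧
    |c 1 + q.2 * c 2| * Real.exp (w₂ * t) < δ ∧ |(c 2 : ℝ)| * Real.exp (-t) < δ}

theorem norm_toLp_fin_three_le (v : Fin 3 → ℝ) :
    ‖(WithLp.equiv 2 (Fin 3 → ℝ)).symm v‖ ≤ |v 0| + |v 1| + |v 2| := by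
  rw [EuclideanSpace.norm_eq, Real.sqrt_le_left (by positivity)]
  simp only [Fin.sum_univ_three, WithLp.equiv_symm_apply, Real.norm_eq_abs]
  nlinarith [abs_nonneg (v 0), abs_nonneg (v 1), abs_nonneg (v 2),
    mul_nonneg (abs_nonneg (v 0)) (abs_nonneg (v 1)),
    mul_nonneg (abs_nonneg (v 0)) (abs_nonneg (v 2)),
    mul_nonneg (abs_nonneg (v 1)) (abs_nonneg (v 2))]

/-- Multiplying a divergent unipotent lattice by a lower triangular matrix keeps it divergent. -/
theorem divergent_of_mem_divergentPoints {w₁ w₂ : ℝ} (hw₂ : 0 < w₂) (hw : w₂ < w₁)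
    {s : ℝ} {q : ℝ × ℝ} (hq : q ∈ divergentPoints w₁ w₂ s) (g : Matrix (Fin 3) (Fin 3) ℝ)
    (h01 : g 0 1 = g 0 0 * s) (h02 : g 0 2 = g 0 0 * q.1)
    (h12 : g 1 2 = (g 1 1 - g 1 0 * s) * q.2 + g 1 0 * q.1) :
    ∀ δ : ℝ, 0 < δ → ∃ T : ℝ, 0 ≤ T ∧ ∀ t : ℝ, T ≤ t → ∃ c : Fin 3 → ℤ, c ≠ 0 ∧
      ‖(WithLp.equiv 2 (Fin 3 → ℝ)).symm ((aMat w₁ w₂ t * g).mulVec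
        (fun i => (c i : ℝ)))‖ < δ := by
  intro δ hδ
  set r := g 1 1 - g 1 0 * s with hr
  set r' := g 2 1 - g 2 0 * s with hr'
  set μ := g 2 2 - g 2 0 * q.1 - r' * q.2 with hμ
  set K := |g 0 0| + |g 1 0| + |r| + |g 2 0| + |r'| + |μ| + 1 with hK
  have hKpos : 0 < K := by positivity
  obtain ⟨T, hT, h⟩ := hq (δ / K) (by positivity)
  refine ⟨T, hT, fun t ht => ?_⟩
  obtain ⟨c, hc, h1, h2, h3⟩ := h t ht
  refine ⟨c, hc, (norm_toLp_fin_three_le _).trans_lt ?_⟩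
  have ht0 : 0 ≤ t := hT.trans ht
  set L₁ := c 0 + s * c 1 + q.1 * c 2
  set L₂ := c 1 + q.2 * c 2
  have e0 : ((aMat w₁ w₂ t * g).mulVec (fun i => (c i : ℝ))) 0 =
      Real.exp (w₁ * t) * (g 0 0 * L₁) := by
    simp [aMat, Matrix.diagonal_mul, Matrix.mulVec, dotProduct, Fin.sum_univ_three, L₁, h01, h02]
    ring
  have e1 : ((aMat w₁ w₂ t * g).mulVec (fun i => (c i : ℝ))) 1 =
      Real.exp (w₂ * t) * (g 1 0 * L₁ + r * L₂) := by
    simp [aMat, Matrix.diagonal_mul, Matrix.mulVec, dotProduct, Fin.sum_univ_three, L₁, L₂, h12,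
      hr]
    ring
  have e2 : ((aMat w₁ w₂ t * g).mulVec (fun i => (c i : ℝ))) 2 =
      Real.exp (-t) * (g 2 0 * L₁ + r' * L₂ + μ * c 2) := by
    simp [aMat, Matrix.diagonal_mul, Matrix.mulVec, dotProduct, Fin.sum_univ_three, L₁, L₂, hr',
      hμ]
    ring
  have hE1 : Real.exp (w₂ * t) ≤ Real.exp (w₁ * t) := Real.exp_le_exp.2 (by gcongr)
  have hE2 : Real.exp (-t) ≤ Real.exp (w₂ * t) := Real.exp_le_exp.2 (by nlinarith)
  have b0 : |Real.exp (w₁ * t) * (g 0 0 * L₁)| ≤ |g 0 0| * (δ / K) := by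
    rw [abs_mul, abs_mul, abs_of_pos (Real.exp_pos _)]
    nlinarith [abs_nonneg (g 0 0)]
  have hA : ∀ E, 0 ≤ E → E ≤ Real.exp (w₁ * t) → |L₁| * E ≤ δ / K := fun E _ hE =>
    (mul_le_mul_of_nonneg_left hE (abs_nonneg _)).trans h1.le
  have hB : ∀ E, 0 ≤ E → E ≤ Real.exp (w₂ * t) → |L₂| * E ≤ δ / K := fun E _ hE =>
    (mul_le_mul_of_nonneg_left hE (abs_nonneg _)).trans h2.le
  have b1 : |Real.exp (w₂ * t) * (g 1 0 * L₁ + r * L₂)| ≤ (|g 1 0| + |r|) * (δ / K) := by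
    have := hA _ (Real.exp_pos (w₂ * t)).le hE1
    have := hB _ (Real.exp_pos (w₂ * t)).le le_rfl
    calc _ ≤ Real.exp (w₂ * t) * (|g 1 0| * |L₁| + |r| * |L₂|) := by
          rw [abs_mul, abs_of_pos (Real.exp_pos _), ← abs_mul, ← abs_mul]
          gcongr
          exact abs_add_le _ _
      _ = |g 1 0| * (|L₁| * Real.exp (w₂ * t)) + |r| * (|L₂| * Real.exp (w₂ * t)) := by ring
      _ ≤ |g 1 0| * (δ / K) + |r| * (δ / K) := by gcongr
      _ = _ := by ring
  have b2 : |Real.exp (-t) * (g 2 0 * L₁ + r' * L₂ + μ * c 2)| ≤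
      (|g 2 0| + |r'| + |μ|) * (δ / K) := by
    have := hA _ (Real.exp_pos (-t)).le (hE2.trans hE1)
    have := hB _ (Real.exp_pos (-t)).le hE2
    calc _ ≤ Real.exp (-t) * (|g 2 0| * |L₁| + |r'| * |L₂| + |μ| * |(c 2 : ℝ)|) := by
          rw [abs_mul, abs_of_pos (Real.exp_pos _), ← abs_mul, ← abs_mul, ← abs_mul]
          gcongr
          exact abs_add_three _ _ _
      _ = |g 2 0| * (|L₁| * Real.exp (-t)) + |r'| * (|L₂| * Real.exp (-t)) +
          |μ| * (|(c 2 : ℝ)| * Real.exp (-t)) := by ring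
      _ ≤ |g 2 0| * (δ / K) + |r'| * (δ / K) + |μ| * (δ / K) := by gcongr
      _ = _ := by ring
  rw [e0, e1, e2]
  have hpos : 0 < δ / K := by positivity
  calc _ ≤ |g 0 0| * (δ / K) + (|g 1 0| + |r|) * (δ / K) + (|g 2 0| + |r'| + |μ|) * (δ / K) := by
        gcongr
    _ = K * (δ / K) - δ / K := by rw [hK]; ring
    _ < K * (δ / K) := by linarith
    _ = δ := by field_simp

/-- The dimension bound for divergent matrices follows from a bound for every two-dimensional
family of unipotent lattices. -/
theorem add_six_le_dimH_of_lt_dimH_divergentPoints {w₁ w₂ : ℝ} (hw₂ : 0 < w₂) (hw : w₂ < w₁)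
    {d : NNReal} (hd : 0 < d) (h : ∀ s, (d : ENNReal) < dimH (divergentPoints w₁ w₂ s)) :
    (d : ENNReal) + 6 ≤ dimH {m : EuclideanSpace ℝ (Fin 3 × Fin 3) |
        (Matrix.of fun i j => m (i, j)).det = 1 ∧
        ∀ δ : ℝ, 0 < δ → ∃ T : ℝ, 0 ≤ T ∧ ∀ t : ℝ, T ≤ t →
          ∃ c : Fin 3 → ℤ, c ≠ 0 ∧
            ‖(WithLp.equiv 2 (Fin 3 → ℝ)).symm
              ((aMat w₁ w₂ t * Matrix.of fun i j => m (i, j)).mulVec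
                (fun i => (c i : ℝ)))‖ < δ} := by
  set M := {m : EuclideanSpace ℝ (Fin 3 × Fin 3) |
        (Matrix.of fun i j => m (i, j)).det = 1 ∧
        ∀ δ : ℝ, 0 < δ → ∃ T : ℝ, 0 ≤ T ∧ ∀ t : ℝ, T ≤ t →
          ∃ c : Fin 3 → ℤ, c ≠ 0 ∧
            ‖(WithLp.equiv 2 (Fin 3 → ℝ)).symm
              ((aMat w₁ w₂ t * Matrix.of fun i j => m (i, j)).mulVec
                (fun i => (c i : ℝ)))‖ < δ} with hM
  let Ψ : EuclideanSpace ℝ (Fin 3 × Fin 3) → (Fin 3 × Fin 2 → ℝ) × (ℝ × ℝ) :=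
    fun m => (fun p => m (p.1, p.2.castSucc), (m (0, 2), m (1, 2)))
  have hΨ : ContDiffOn ℝ 1 Ψ Set.univ := by
    have : ContDiff ℝ 1 Ψ := by fun_prop
    exact this.contDiffOn
  refine le_trans ?_ (hΨ.dimH_image_le convex_univ (Set.subset_univ M))
  let B : Set (Fin 3 × Fin 2 → ℝ) :=
    {z | z (0, 0) ≠ 0 ∧ z (0, 0) * z (1, 1) - z (0, 1) * z (1, 0) ≠ 0}
  have hB : volume B ≠ 0 := by
    refine IsOpen.measure_ne_zero _ ?_ ?_
    · exact (isOpen_ne_fun (by fun_prop) (by fun_prop)).inter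
        (isOpen_ne_fun (by fun_prop) (by fun_prop))
    · exact ⟨fun p => if p.1.val = p.2.val then 1 else 0, by simp [B]⟩
  have key := hausdorffMeasure_ne_zero_of_slices (A := Ψ '' M) (B := B) (d := d)
    (by exact_mod_cast hd) hB ?_
  · have h6 : ((d : ℝ) + Fintype.card (Fin 3 × Fin 2)) = ((d + 6 : NNReal) : ℝ) := by
      simp
    rw [h6] at key
    simpa using le_dimH_of_hausdorffMeasure_ne_zero key
  rintro z ⟨hz1, hz2⟩
  set Δ := z (0, 0) * z (1, 1) - z (0, 1) * z (1, 0) with hΔ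
  set s := z (0, 1) / z (0, 0) with hs
  set r := z (1, 1) - z (1, 0) * s with hr
  have hr0 : r ≠ 0 := by
    have : r = Δ / z (0, 0) := by rw [hr, hs, hΔ]; field_simp
    rw [this]
    exact div_ne_zero hz2 hz1
  let F : ℝ × ℝ → ℝ × ℝ := fun q => (q.1 / z (0, 0), (q.2 - z (1, 0) * (q.1 / z (0, 0))) / r)
  have hF : ContDiffOn ℝ 1 F Set.univ := by
    have : ContDiff ℝ 1 F := by fun_prop
    exact this.contDiffOn
  have hsub : divergentPoints w₁ w₂ s ⊆ F '' {q | (z, q) ∈ Ψ '' M} := by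
    rintro ⟨x, y⟩ hq
    let v : ℝ := r * y + z (1, 0) * x
    let a : ℝ := (1 - (z (0, 0) * x * (z (1, 0) * z (2, 1) - z (1, 1) * z (2, 0)) -
      v * (z (0, 0) * z (2, 1) - z (0, 1) * z (2, 0)))) / Δ
    let g : Matrix (Fin 3) (Fin 3) ℝ := !![z (0, 0), z (0, 1), z (0, 0) * x;
      z (1, 0), z (1, 1), v; z (2, 0), z (2, 1), a]
    refine ⟨(z (0, 0) * x, v), ⟨WithLp.toLp 2 fun p => g p.1 p.2, ⟨?_, ?_⟩, ?_⟩, ?_⟩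
    · change (Matrix.of fun i j => g i j).det = 1
      rw [Matrix.det_fin_three]
      simp only [Matrix.of_apply, g, Matrix.cons_val', Matrix.cons_val_zero, Matrix.cons_val_one,
        Matrix.cons_val]
      have : a * Δ = 1 - (z (0, 0) * x * (z (1, 0) * z (2, 1) - z (1, 1) * z (2, 0)) -
          v * (z (0, 0) * z (2, 1) - z (0, 1) * z (2, 0))) := by
        simp only [a]; field_simp
      rw [hΔ] at this
      linarith
    · refine divergent_of_mem_divergentPoints hw₂ hw hq (Matrix.of fun i j => g i j) ?_ ?_ ?_
      · simp [g, hs]; field_simp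
      · simp [g]
      · simp [g, v, hr]
    · simp only [Ψ, Prod.mk.injEq]
      refine ⟨?_, rfl, rfl⟩
      ext ⟨i, j⟩
      fin_cases i <;> fin_cases j <;> rfl
    · simp only [F, v, Prod.mk.injEq]
      constructor <;> field_simp
      ring
  have hdim : (d : ENNReal) < dimH {q | (z, q) ∈ Ψ '' M} :=
    (h s).trans_le ((dimH_mono hsub).trans (hF.dimH_image_le convex_univ (Set.subset_univ _)))
  rw [hausdorffMeasure_of_lt_dimH hdim]
  exact ENNReal.top_ne_zero

open Set in
/-- Mass distribution principle for the image of a probability space. -/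
theorem hausdorffMeasure_range_ne_zero {Ω E : Type*} [MeasurableSpace Ω] (P : Measure Ω)
    [IsProbabilityMeasure P] [MetricSpace E] [MeasurableSpace E] [BorelSpace E] (f : Ω → E)
    {C d r : ℝ} (hC : 0 < C) (hd : 0 < d) (hr : 0 < r)
    (h : ∀ ρ, 0 < ρ → ρ ≤ r → ∀ U : Set E, (∀ u ∈ U, ∀ v ∈ U, dist u v ≤ ρ) →
      P (f ⁻¹' U) ≤ ENNReal.ofReal (C * ρ ^ d)) :
    Measure.hausdorffMeasure d (range f) ≠ 0 := by
  intro h0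
  rw [Measure.hausdorffMeasure_apply] at h0
  have hr' : (0 : ENNReal) < ENNReal.ofReal r := by simpa using hr
  have h2 := (ENNReal.iSup_eq_zero.1 ((ENNReal.iSup_eq_zero.1 h0) (ENNReal.ofReal r))) hr'
  have h3 : (0 : ENNReal) < (ENNReal.ofReal C)⁻¹ := ENNReal.inv_pos.2 (by finiteness)
  rw [← h2] at h3
  obtain ⟨t, ht⟩ := iInf_lt_iff.1 h3
  obtain ⟨ht1, ht⟩ := iInf_lt_iff.1 ht
  obtain ⟨ht2, ht⟩ := iInf_lt_iff.1 ht
  have key : ∀ n, P (f ⁻¹' t n) ≤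
      ENNReal.ofReal C * ⨆ _ : (t n).Nonempty, Metric.ediam (t n) ^ d := by
    intro n
    rcases (t n).eq_empty_or_nonempty with he | hne
    · simp [he]
    simp only [hne, iSup_pos]
    have hfin : Metric.ediam (t n) ≠ ⊤ := ne_top_of_le_ne_top ENNReal.ofReal_ne_top (ht2 n)
    have hdist : ∀ ρ : ℝ, (Metric.ediam (t n)).toReal ≤ ρ → ∀ u ∈ t n, ∀ v ∈ t n,
        dist u v ≤ ρ := by
      intro ρ hρ u hu v hv
      refine le_trans ?_ hρ
      rw [dist_edist]
      exact ENNReal.toReal_mono hfin (Metric.edist_le_ediam_of_mem hu hv)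
    rcases (ENNReal.toReal_nonneg (a := Metric.ediam (t n))).eq_or_lt with hz | hpos
    · have hle : ∀ ρ, 0 < ρ → ρ ≤ r → P (f ⁻¹' t n) ≤ ENNReal.ofReal (C * ρ ^ d) :=
        fun ρ h1 h2 => h ρ h1 h2 _ (hdist ρ (by linarith))
      have hlim : Filter.Tendsto (fun ρ : ℝ => ENNReal.ofReal (C * ρ ^ d))
          (nhdsWithin 0 (Ioi 0)) (nhds 0) := by
        have : ContinuousAt (fun ρ : ℝ => ENNReal.ofReal (C * ρ ^ d)) 0 := by
          refine ENNReal.continuous_ofReal.continuousAt.comp ?_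
          exact continuousAt_const.mul (Real.continuousAt_rpow_const _ _ (Or.inr hd.le))
        have h' := this.tendsto.mono_left (nhdsWithin_le_nhds (s := Ioi 0))
        simpa [Real.zero_rpow hd.ne'] using h'
      refine le_trans (ge_of_tendsto hlim ?_) zero_le
      filter_upwards [Ioc_mem_nhdsGT hr] with ρ hρ using hle ρ hρ.1 hρ.2
    · have h4 := h _ hpos ?_ (t n) (hdist _ le_rfl)
      · rw [ENNReal.ofReal_mul hC.le, ← ENNReal.ofReal_rpow_of_pos hpos,
          ENNReal.ofReal_toReal hfin] at h4
        exact h4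
      · have := ENNReal.toReal_mono ENNReal.ofReal_ne_top (ht2 n)
        rwa [ENNReal.toReal_ofReal hr.le] at this
  have h1 : (1 : ENNReal) ≤ ENNReal.ofReal C *
      ∑' n, ⨆ _ : (t n).Nonempty, Metric.ediam (t n) ^ d := by
    calc (1 : ENNReal) = P univ := measure_univ.symm
      _ ≤ P (⋃ n, f ⁻¹' t n) := by
        refine measure_mono fun ω _ => ?_
        simpa using ht1 (mem_range_self ω)
      _ ≤ ∑' n, P (f ⁻¹' t n) := measure_iUnion_le _
      _ ≤ _ := by
        rw [← ENNReal.tsum_mul_left]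
        exact ENNReal.tsum_le_tsum key
  refine absurd h1 (not_le.2 ?_)
  rw [h2] at h3
  calc _ < ENNReal.ofReal C * (ENNReal.ofReal C)⁻¹ :=
        ENNReal.mul_lt_mul_right (by simpa using hC) ENNReal.ofReal_ne_top ht
    _ ≤ 1 := ENNReal.mul_inv_le_one _

/-- A sequence with summably small steps `≤ r k - r (k + 1)` stays within `r k` of a limit. -/
theorem exists_forall_abs_sub_le {x r : ℕ → ℝ} (hr : ∀ k, 0 ≤ r k)
    (h : ∀ k, |x (k + 1) - x k| ≤ r k - r (k + 1)) : ∃ q, ∀ k, |q - x k| ≤ r k := by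
  have hm : Monotone fun k => x k - r k := monotone_nat_of_le_succ fun k => by
    have := abs_le.1 (h k); linarith
  have ha : Antitone fun k => x k + r k := antitone_nat_of_succ_le fun k => by
    have := abs_le.1 (h k); linarith
  have := hm.ciSup_mem_iInter_Icc_of_antitone ha fun k => by have := hr k; linarith
  rw [Set.mem_iInter] at this
  refine ⟨⨆ k, (x k - r k), fun k => abs_le.2 ?_⟩
  have h1 := this k
  rw [Set.mem_Icc] at h1
  constructor <;> linarith [h1.1, h1.2]

/-- A positive sequence halving at each step brackets every small positive number. -/
theorem exists_succ_lt_le {r : ℕ → ℝ} (h : ∀ k, r (k + 1) ≤ r k / 2) {ρ : ℝ} (hρ : 0 < ρ)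
    (h0 : ρ ≤ r 0) : ∃ k, r (k + 1) < ρ ∧ ρ ≤ r k := by
  have hb : ∀ k, r k ≤ r 0 * (1 / 2) ^ k := by
    intro k
    induction k with
    | zero => simp
    | succ k ih => rw [pow_succ]; linarith [h k]
  have hex : ∃ k, r k < ρ := by
    obtain ⟨k, hk⟩ := exists_pow_lt_of_lt_one (div_pos hρ (hρ.trans_le h0))
      (by norm_num : (1 / 2 : ℝ) < 1)
    refine ⟨k, (hb k).trans_lt ?_⟩
    rw [lt_div_iff₀ (hρ.trans_le h0)] at hk
    linarith
  classical
  obtain ⟨k, hk⟩ : ∃ k, Nat.find hex = k + 1 := by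
    refine Nat.exists_eq_succ_of_ne_zero fun h1 => ?_
    have := Nat.find_spec hex
    rw [h1] at this
    linarith
  refine ⟨k, by have := Nat.find_spec hex; rwa [hk] at this, ?_⟩
  exact not_lt.1 (Nat.find_min hex (by omega))

section Cantor

variable {V : ℕ → Type*} {p m : ℕ → ℕ}

/-- The node of a tree reached from the root by following the path `ω`. -/
def treeNode (root : V 0) (child : ∀ k, V k → Fin (p k) × Fin (m k) → V (k + 1))
    (ω : ∀ k, Fin (p k) × Fin (m k)) : ∀ k, V k
  | 0 => root
  | k + 1 => child k (treeNode root child ω k) (ω k)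

theorem treeNode_congr (root : V 0) (child : ∀ k, V k → Fin (p k) × Fin (m k) → V (k + 1))
    {ω ω' : ∀ k, Fin (p k) × Fin (m k)} {k : ℕ} (h : ∀ j < k, ω j = ω' j) :
    treeNode root child ω k = treeNode root child ω' k := by
  induction k with
  | zero => rfl
  | succ k ih =>
    rw [treeNode, treeNode, ih fun j hj => h j (by omega), h k (by omega)]

open Set in
/-- The uniform measure on paths: the mass of a set of paths such that two of them agree up to
level `l` as soon as their first indices agree between levels `k` and `l`. -/
theorem infinitePi_uniform_le [∀ k, NeZero (p k)] [∀ k, NeZero (m k)] {k l : ℕ} (hkl : k ≤ l)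
    {A : Set (∀ k, Fin (p k) × Fin (m k))}
    (h : ∀ ω ∈ A, ∀ ω' ∈ A, (∀ j, k ≤ j → j < l → (ω j).1 = (ω' j).1) → ∀ j < l, ω j = ω' j) :
    Measure.infinitePi (fun k => (PMF.uniformOfFintype (Fin (p k) × Fin (m k))).toMeasure) A ≤
      ENNReal.ofReal ((∏ j ∈ Finset.range k, (p j : ℝ))⁻¹ * (∏ j ∈ Finset.range l, (m j : ℝ))⁻¹) := by
  set P := Measure.infinitePi (fun k => (PMF.uniformOfFintype (Fin (p k) × Fin (m k))).toMeasure)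
  have hp : ∀ j, (0 : ℝ) < p j := fun j => Nat.cast_pos.2 (NeZero.pos (p j))
  have hm : ∀ j, (0 : ℝ) < m j := fun j => Nat.cast_pos.2 (NeZero.pos (m j))
  have hcyl : ∀ a : ∀ k, Fin (p k) × Fin (m k), P {ω | ∀ j < l, ω j = a j} =
      ENNReal.ofReal (∏ j ∈ Finset.range l, ((p j : ℝ)⁻¹ * (m j : ℝ)⁻¹)) := by
    intro a
    have : {ω : ∀ k, Fin (p k) × Fin (m k) | ∀ j < l, ω j = a j} =
        Set.pi (Finset.range l) fun j => {a j} := by ext; simp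
    rw [this, Measure.infinitePi_pi _ (fun i _ => measurableSet_singleton _),
      ENNReal.ofReal_prod_of_nonneg fun j _ => by have := hp j; have := hm j; positivity]
    refine Finset.prod_congr rfl fun j _ => ?_
    rw [PMF.toMeasure_apply_singleton _ _ (measurableSet_singleton _)]
    simp only [PMF.uniformOfFintype_apply, Fintype.card_prod, Fintype.card_fin]
    rw [← mul_inv, ENNReal.ofReal_inv_of_pos (mul_pos (hp j) (hm j)),
      ENNReal.ofReal_mul (hp j).le]
    simp
  let I := Finset.Ico k l
  let F : (∀ j : I, Fin (p j)) → Set (∀ k, Fin (p k) × Fin (m k)) :=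
    fun g => {ω | ω ∈ A ∧ ∀ j : I, (ω j).1 = g j}
  have hF : ∀ g, P (F g) ≤ ENNReal.ofReal (∏ j ∈ Finset.range l, ((p j : ℝ)⁻¹ * (m j : ℝ)⁻¹)) := by
    intro g
    rcases (F g).eq_empty_or_nonempty with he | ⟨a, ha⟩
    · simp [he]
    rw [← hcyl a]
    refine measure_mono fun ω hω => ?_
    refine h ω hω.1 a ha.1 fun j h1 h2 => ?_
    have hj : j ∈ I := Finset.mem_Ico.2 ⟨h1, h2⟩
    rw [hω.2 ⟨j, hj⟩, ha.2 ⟨j, hj⟩]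
  have hcard : (Fintype.card (∀ j : I, Fin (p j)) : ℝ) = ∏ j ∈ Finset.Ico k l, (p j : ℝ) := by
    rw [Fintype.card_pi]
    simp only [Fintype.card_fin]
    rw [Finset.prod_coe_sort I (fun j => p j)]
    push_cast
    rfl
  calc P A ≤ P (⋃ g, F g) := measure_mono fun ω hω => mem_iUnion.2 ⟨fun j => (ω j).1, hω, fun _ => rfl⟩
    _ ≤ ∑ g, P (F g) := measure_iUnion_fintype_le _ _
    _ ≤ ∑ _g : ∀ j : I, Fin (p j), _ := Finset.sum_le_sum fun g _ => hF g
    _ = ENNReal.ofReal ((∏ j ∈ Finset.Ico k l, (p j : ℝ)) *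
          ∏ j ∈ Finset.range l, ((p j : ℝ)⁻¹ * (m j : ℝ)⁻¹)) := by
      rw [Finset.sum_const, nsmul_eq_mul, Finset.card_univ, ← hcard,
        ENNReal.ofReal_mul (by positivity), ENNReal.ofReal_natCast]
    _ ≤ _ := by
      refine ENNReal.ofReal_le_ofReal (le_of_eq ?_)
      rw [Finset.prod_mul_distrib, Finset.prod_inv_distrib, Finset.prod_inv_distrib,
        ← Finset.prod_range_mul_prod_Ico (fun j => (p j : ℝ)) hkl]
      have h1 : ∏ j ∈ Finset.range k, (p j : ℝ) ≠ 0 := (Finset.prod_pos fun j _ => hp j).ne'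
      have h2 : ∏ j ∈ Finset.Ico k l, (p j : ℝ) ≠ 0 := (Finset.prod_pos fun j _ => hp j).ne'
      have h3 : ∏ j ∈ Finset.range l, (m j : ℝ) ≠ 0 := (Finset.prod_pos fun j _ => hm j).ne'
      field_simp

open Set in
/-- Lower bound for the Hausdorff measure of a self-affine-like Cantor set in the plane, built from
nested boxes of half-sides `ξ k ≤ Υ k`. Each node of level `k` has `p k` families of `m k` children;
children are separated either horizontally or vertically, and vertically within each family. -/
theorem hausdorffMeasure_ne_zero_of_tree (root : V 0)
    (child : ∀ k, V k → Fin (p k) × Fin (m k) → V (k + 1))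
    (hp : ∀ k, 0 < p k) (hm : ∀ k, 0 < m k)
    (X Y : ∀ k, V k → ℝ) {ξ Υ : ℕ → ℝ} (hξ : ∀ k, 0 < ξ k)
    (hξΥ : ∀ k, ξ k ≤ Υ k) (hξs : ∀ k, ξ (k + 1) ≤ ξ k / 2) (hΥs : ∀ k, Υ (k + 1) ≤ Υ k / 8)
    (hX : ∀ k v i, |X (k + 1) (child k v i) - X k v| ≤ ξ k / 2)
    (hY : ∀ k v i, |Y (k + 1) (child k v i) - Y k v| ≤ 3 / 4 * Υ k)
    (hsep : ∀ k v i j, i ≠ j →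
      4 * ξ (k + 1) < |X (k + 1) (child k v i) - X (k + 1) (child k v j)| ∨
      4 * Υ (k + 1) < |Y (k + 1) (child k v i) - Y (k + 1) (child k v j)|)
    (hsep' : ∀ k v i j, i ≠ j → i.1 = j.1 →
      4 * Υ (k + 1) < |Y (k + 1) (child k v i) - Y (k + 1) (child k v j)|)
    {C σ₁ σ₂ : ℝ} (hC : 0 < C) (hσ₁ : 0 < σ₁) (hσ₂ : 0 < σ₂)
    (hpC : ∀ k, (∏ j ∈ Finset.range k, (p j : ℝ))⁻¹ ≤ C * ξ (k + 1) ^ σ₁)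
    (hmC : ∀ k, (∏ j ∈ Finset.range k, (m j : ℝ))⁻¹ ≤ C * Υ (k + 1) ^ σ₂)
    {S : Set (ℝ × ℝ)}
    (hS : ∀ (v : ∀ k, V k) (q : ℝ × ℝ),
      (∀ k, |q.1 - X k (v k)| ≤ ξ k ∧ |q.2 - Y k (v k)| ≤ Υ k) → q ∈ S) :
    Measure.hausdorffMeasure (σ₁ + σ₂) S ≠ 0 := by
  have : ∀ k, NeZero (p k) := fun k => ⟨(hp k).ne'⟩
  have : ∀ k, NeZero (m k) := fun k => ⟨(hm k).ne'⟩
  have hΥ : ∀ k, 0 < Υ k := fun k => (hξ k).trans_le (hξΥ k)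
  have hξa : Antitone ξ := antitone_nat_of_succ_le fun k => by linarith [hξs k, hξ k]
  have hΥa : Antitone Υ := antitone_nat_of_succ_le fun k => by linarith [hΥs k, hΥ k]
  have hlim : ∀ ω : ∀ k, Fin (p k) × Fin (m k), ∃ q : ℝ × ℝ, ∀ k,
      |q.1 - X k (treeNode root child ω k)| ≤ ξ k ∧
      |q.2 - Y k (treeNode root child ω k)| ≤ Υ k := by
    intro ω
    obtain ⟨x, hx⟩ := exists_forall_abs_sub_le (x := fun k => X k (treeNode root child ω k))
      (fun k => (hξ k).le) fun k => (hX k _ _).trans (by linarith [hξs k])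
    obtain ⟨y, hy⟩ := exists_forall_abs_sub_le (x := fun k => Y k (treeNode root child ω k))
      (fun k => (hΥ k).le) fun k => (hY k _ _).trans (by linarith [hΥs k, hΥ k])
    exact ⟨(x, y), fun k => ⟨hx k, hy k⟩⟩
  choose f hf using hlim
  have hsub : range f ⊆ S := by
    rintro _ ⟨ω, rfl⟩
    exact hS _ _ (hf ω)
  have key := hausdorffMeasure_range_ne_zero (Measure.infinitePi
    (fun k => (PMF.uniformOfFintype (Fin (p k) × Fin (m k))).toMeasure)) f
    (C := C * C) (d := σ₁ + σ₂) (r := ξ 0) (by positivity) (by positivity) (hξ 0) ?_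
  · exact fun h0 => key (measure_mono_null hsub h0)
  intro ρ hρ hρr U hU
  obtain ⟨k, hk1, hk2⟩ := exists_succ_lt_le hξs hρ hρr
  obtain ⟨l, hl1, hl2⟩ := exists_succ_lt_le (fun k => (hΥs k).trans (by linarith [hΥ k])) hρ
    (hρr.trans (hξΥ 0))
  have hkl : k ≤ l := by
    by_contra! hlt
    have := hΥa (show l + 1 ≤ k by omega)
    linarith [hξΥ k]
  refine (infinitePi_uniform_le hkl ?_).trans (ENNReal.ofReal_le_ofReal ?_)
  · intro ω hω ω' hω' hag j
    induction j using Nat.strong_induction_on with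
    | _ j ih =>
    intro hjl
    have hnode : treeNode root child ω j = treeNode root child ω' j :=
      treeNode_congr root child fun i hi => ih i hi (hi.trans hjl)
    by_contra hne
    have hd := hU _ hω _ hω'
    rw [Prod.dist_eq, max_le_iff, Real.dist_eq, Real.dist_eq] at hd
    have h1 := hf ω (j + 1)
    have h2 := hf ω' (j + 1)
    simp only [treeNode] at h1 h2
    rw [← hnode] at h2
    have hΥj : Υ l ≤ Υ (j + 1) := hΥa (by omega)
    have hYno : ¬ 4 * Υ (j + 1) < |Y (j + 1) (child j (treeNode root child ω j) (ω j)) -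
        Y (j + 1) (child j (treeNode root child ω j) (ω' j))| := by
      rw [not_lt]
      have a1 := abs_le.1 h1.2
      have a2 := abs_le.1 h2.2
      have a3 := abs_le.1 hd.2
      refine abs_le.2 ⟨?_, ?_⟩ <;> linarith [hΥ (j + 1)]
    by_cases hjk : j < k
    · rcases hsep j (treeNode root child ω j) _ _ hne with h | h
      · have hξj : ξ k ≤ ξ (j + 1) := hξa (by omega)
        refine absurd h (not_lt.2 ?_)
        have a1 := abs_le.1 h1.1
        have a2 := abs_le.1 h2.1
        have a3 := abs_le.1 hd.1
        refine abs_le.2 ⟨?_, ?_⟩ <;> linarith [hξ (j + 1)]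
      · exact hYno h
    · exact hYno (hsep' j _ _ _ hne (hag j (not_lt.1 hjk) hjl))
  · rw [Real.rpow_add hρ]
    have h1 : ξ (k + 1) ^ σ₁ ≤ ρ ^ σ₁ := Real.rpow_le_rpow (hξ _).le hk1.le hσ₁.le
    have h2 : Υ (l + 1) ^ σ₂ ≤ ρ ^ σ₂ := Real.rpow_le_rpow (hΥ _).le hl1.le hσ₂.le
    have h3 : 0 ≤ (∏ j ∈ Finset.range l, (m j : ℝ))⁻¹ :=
      inv_nonneg.2 (Finset.prod_nonneg fun j _ => Nat.cast_nonneg _)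
    calc _ ≤ (C * ξ (k + 1) ^ σ₁) * (C * Υ (l + 1) ^ σ₂) :=
          mul_le_mul (hpC k) (hmC l) h3 (by have := hξ (k + 1); positivity)
      _ ≤ (C * ρ ^ σ₁) * (C * ρ ^ σ₂) := by
        have := hξ (k + 1); have := hΥ (l + 1); gcongr
      _ = _ := by ring

end Cantor

/-- If `α` is not too close to rationals with denominator at most `K`, then among any `T`
consecutive multiples of `α` some is within `2 / K` of any given residue. -/
theorem exists_abs_mul_add_le {α τ : ℝ} {K T : ℕ} (hK : 0 < K) (hKT : K ≤ T)
    (h : ∀ q : ℕ, 1 ≤ q → q ≤ K → ∀ p : ℤ, 1 / (T : ℝ) ≤ |q * α - p|) (i₀ : ℤ) :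
    ∃ (t : ℕ) (l : ℤ), t < T ∧ |(i₀ + t) * α + τ + l| ≤ 2 / K := by
  have hT : 0 < T := hK.trans_le hKT
  have hT' : (0 : ℝ) < T := by exact_mod_cast hT
  have hK' : (0 : ℝ) < K := by exact_mod_cast hK
  obtain ⟨r, hr, hrT⟩ := Real.exists_rat_abs_sub_le_and_den_le α hT
  have hden : (0 : ℝ) < r.den := by exact_mod_cast r.pos
  have hrα : (r : ℝ) = r.num / r.den := by exact_mod_cast (Rat.num_div_den r).symm
  have hKr : K < r.den := by
    by_contra! hle
    have h1 := h r.den r.pos hle r.num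
    have h2 : |(r.den : ℝ) * α - r.num| = r.den * |α - r| := by
      rw [← abs_of_pos hden, ← abs_mul, abs_of_pos hden, mul_sub, hrα]
      congr 2
      field_simp
    rw [h2] at h1
    have h3 : (r.den : ℝ) * |α - r| ≤ 1 / (T + 1) := by
      calc _ ≤ (r.den : ℝ) * (1 / ((T + 1) * r.den)) := by gcongr
        _ = _ := by field_simp
    have h4 : (1 : ℝ) / (T + 1) < 1 / T := one_div_lt_one_div_of_lt hT' (by linarith)
    linarith
  set g := round ((r.den : ℝ) * (i₀ * α + τ)) with hg
  have hcop : IsCoprime (r.num) (r.den : ℤ) := by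
    rw [Int.isCoprime_iff_gcd_eq_one]; exact r.reduced
  obtain ⟨x, y, hxy⟩ := hcop
  set t := (-g * x) % (r.den : ℤ) with ht
  have hden' : (0 : ℤ) < r.den := by exact_mod_cast r.pos
  have ht0 : 0 ≤ t := Int.emod_nonneg _ hden'.ne'
  have htd : t < r.den := Int.emod_lt_of_pos _ hden'
  obtain ⟨l, hl⟩ : ∃ l : ℤ, t * r.num + g = -l * r.den := by
    have h1 : t = -g * x - r.den * ((-g * x) / r.den) := by
      have := Int.emod_add_mul_ediv (-g * x) r.den
      rw [ht]; linarith
    refine ⟨-(g * y - (-g * x) / r.den * r.num), ?_⟩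
    rw [h1]
    linear_combination (-g) * hxy
  refine ⟨t.toNat, l, ?_, ?_⟩
  · have : (r.den : ℤ) ≤ T := by exact_mod_cast hrT
    omega
  · have htn : ((t.toNat : ℕ) : ℝ) = (t : ℝ) := by
      have := Int.toNat_of_nonneg ht0
      exact_mod_cast this
    rw [htn]
    have hl' : (t : ℝ) * r.num + g = -l * r.den := by exact_mod_cast hl
    have e : (i₀ + t) * α + τ + l =
        t * (α - r) + ((r.den : ℝ) * (i₀ * α + τ) - g) / r.den := by
      rw [hrα]
      field_simp
      linear_combination hl'
    rw [e]
    have htr : (t : ℝ) ≤ r.den := by exact_mod_cast htd.le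
    have ht0' : (0 : ℝ) ≤ t := by exact_mod_cast ht0
    have b1 : |(t : ℝ) * (α - r)| ≤ 1 / K := by
      rw [abs_mul, abs_of_nonneg ht0']
      calc (t : ℝ) * |α - r| ≤ r.den * (1 / ((T + 1) * r.den)) := by gcongr
        _ = 1 / (T + 1) := by field_simp
        _ ≤ 1 / K := one_div_le_one_div_of_le hK' (by
          have : (K : ℝ) ≤ T := by exact_mod_cast hKT
          linarith)
    have b2 : |((r.den : ℝ) * (i₀ * α + τ) - g) / r.den| ≤ 1 / K := by
      rw [abs_div, abs_of_pos hden]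
      have := abs_sub_round ((r.den : ℝ) * (i₀ * α + τ))
      have hKr' : (K : ℝ) ≤ r.den := by exact_mod_cast hKr.le
      calc _ ≤ 1 / (r.den : ℝ) := by gcongr; linarith
        _ ≤ 1 / K := one_div_le_one_div_of_le hK' hKr'
    calc _ ≤ _ := abs_add_le _ _
      _ ≤ 1 / (K : ℝ) + 1 / K := add_le_add b1 b2
      _ = 2 / K := by ring

theorem card_le_of_forall_abs_sub_le {S : Finset ℤ} {x L : ℝ} (hL : 0 ≤ L)
    (h : ∀ z ∈ S, |(z : ℝ) - x| ≤ L) : (S.card : ℝ) ≤ 2 * L + 1 := by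
  have hsub : S ⊆ Finset.Icc ⌈x - L⌉ ⌊x + L⌋ := by
    intro z hz
    have := abs_le.1 (h z hz)
    rw [Finset.mem_Icc, Int.ceil_le, Int.le_floor]
    constructor <;> linarith
  have h1 := Finset.card_le_card hsub
  rw [Int.card_Icc] at h1
  have h2 : ((⌊x + L⌋ + 1 - ⌈x - L⌉).toNat : ℝ) ≤ 2 * L + 1 := by
    have a1 := Int.floor_le (x + L)
    have a2 := Int.le_ceil (x - L)
    rcases le_total 0 (⌊x + L⌋ + 1 - ⌈x - L⌉) with hc | hc
    · have : ((⌊x + L⌋ + 1 - ⌈x - L⌉).toNat : ℝ) = ⌊x + L⌋ + 1 - ⌈x - L⌉ := by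
        have := Int.toNat_of_nonneg hc
        exact_mod_cast this
      rw [this]
      linarith
    · rw [Int.toNat_of_nonpos hc]
      simp
      linarith
  exact le_trans (by exact_mod_cast h1) h2

theorem card_filter_range_le {n : ℕ} {σ β θ : ℝ} (hσ : σ ≠ 0) (hθ : 0 ≤ θ) :
    (((Finset.range n).filter fun m : ℕ => |β + m * σ| < θ).card : ℝ) ≤ 2 * (θ / |σ|) + 1 := by
  have hσ' : 0 < |σ| := abs_pos.2 hσ
  rw [← Finset.card_map (Nat.castEmbedding (R := ℤ))]
  refine card_le_of_forall_abs_sub_le (x := -β / σ) (by positivity) ?_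
  intro z hz
  simp only [Finset.mem_map, Finset.mem_filter] at hz
  obtain ⟨m, ⟨-, hm⟩, rfl⟩ := hz
  have : (((Nat.castEmbedding (R := ℤ)) m : ℤ) : ℝ) - -β / σ = (β + m * σ) / σ := by
    simp; field_simp; ring
  rw [this, abs_div]
  gcongr

open Finset in
/-- Most terms of an arithmetic progression of reals are badly approximable by rationals with small
denominators. -/
theorem half_le_card_filter_forall_le_abs {n K T : ℕ} {α₀ σ A : ℝ} (hK : 0 < K)
    (hT : 32 * K ≤ T) (hn : 24 * K ≤ n) (hA : 24576 ≤ A) (hAn : 98304 * (K : ℝ) ^ 2 * A ≤ n)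
    (h1 : A / 8192 ≤ |σ| * n) (h2 : |σ| * n ≤ 6144 * A) :
    ∃ G : Finset ℕ, n ≤ 2 * G.card ∧ ∀ m ∈ G, m < n ∧
      ∀ q : ℕ, 1 ≤ q → q ≤ K → ∀ p : ℤ, 1 / (T : ℝ) ≤ |q * (α₀ + m * σ) - p| := by
  classical
  have hK' : (1 : ℝ) ≤ K := by exact_mod_cast hK
  have hT' : 32 * (K : ℝ) ≤ T := by exact_mod_cast hT
  have hT0 : (0 : ℝ) < T := by linarith
  have hn' : 24 * (K : ℝ) ≤ n := by exact_mod_cast hn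
  have hn0 : (0 : ℝ) < n := by linarith
  have hσ : 0 < |σ| := by
    by_contra! h0
    have : |σ| * n ≤ 0 := mul_nonpos_of_nonpos_of_nonneg h0 hn0.le
    linarith
  set θ : ℝ := 1 / T with hθ
  have hθ0 : 0 < θ := by positivity
  have hθ1 : θ ≤ 1 := by rw [hθ, div_le_one hT0]; linarith
  let G : Finset ℕ := (range n).filter fun m =>
      ∀ q : ℕ, 1 ≤ q → q ≤ K → ∀ p : ℤ, θ ≤ |q * (α₀ + m * σ) - p|
  let I : ℕ → Finset ℤ := fun q => Icc ⌈q * α₀ - (q * (n * |σ|) + θ)⌉ ⌊q * α₀ + (q * (n * |σ|) + θ)⌋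
  let bad : Finset ℕ := (Icc 1 K).biUnion fun q => (I q).biUnion fun p =>
    (range n).filter fun m : ℕ => |(q * α₀ - p) + m * (q * σ)| < θ
  have hcov : range n ⊆ G ∪ bad := by
    intro m hm
    by_cases hg : ∀ q : ℕ, 1 ≤ q → q ≤ K → ∀ p : ℤ, θ ≤ |q * (α₀ + m * σ) - p|
    · exact mem_union_left _ (mem_filter.2 ⟨hm, hg⟩)
    · push Not at hg
      obtain ⟨q, hq1, hqK, p, hp⟩ := hg
      have hp' : |(q * α₀ - p) + m * (q * σ)| < θ := by
        rwa [show (q * α₀ - p) + m * (q * σ) = q * (α₀ + m * σ) - p by ring]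
      refine mem_union_right _ (mem_biUnion.2 ⟨q, mem_Icc.2 ⟨hq1, hqK⟩, mem_biUnion.2
        ⟨p, ?_, mem_filter.2 ⟨hm, hp'⟩⟩⟩)
      have hmn : (m : ℝ) ≤ n := by exact_mod_cast (mem_range.1 hm).le
      have h3 : |m * (q * σ)| ≤ q * (n * |σ|) := by
        rw [abs_mul, abs_mul, Nat.abs_cast, Nat.abs_cast]
        calc (m : ℝ) * (q * |σ|) ≤ n * (q * |σ|) := by gcongr
          _ = _ := by ring
      have a1 := abs_lt.1 hp'
      have a2 := abs_le.1 h3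
      rw [mem_Icc, Int.ceil_le, Int.le_floor]
      constructor <;> linarith
  have hbad : (bad.card : ℝ) ≤ n / 2 := by
    have c1 : ∀ q ∈ Icc 1 K, (((I q).biUnion fun p =>
        (range n).filter fun m : ℕ => |(q * α₀ - p) + m * (q * σ)| < θ).card : ℝ) ≤
        4 * n * θ + 2 * K * (|σ| * n) + 6 * θ / |σ| + 3 := by
      intro q hq
      obtain ⟨hq1, hqK⟩ := mem_Icc.1 hq
      have hq1' : (1 : ℝ) ≤ q := by exact_mod_cast hq1
      have hqK' : (q : ℝ) ≤ K := by exact_mod_cast hqK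
      have hI : ((I q).card : ℝ) ≤ 2 * (q * (n * |σ|) + θ) + 1 := by
        refine card_le_of_forall_abs_sub_le (x := q * α₀) (by positivity) fun z hz => ?_
        rw [mem_Icc, Int.ceil_le, Int.le_floor] at hz
        rw [abs_le]
        constructor <;> linarith [hz.1, hz.2]
      have hc : ∀ p ∈ I q, (((range n).filter fun m : ℕ =>
          |(q * α₀ - p) + m * (q * σ)| < θ).card : ℝ) ≤ 2 * (θ / (q * |σ|)) + 1 := by
        intro p _
        have := card_filter_range_le (n := n) (σ := q * σ) (β := q * α₀ - p) (θ := θ)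
          (mul_ne_zero (by positivity) (abs_pos.1 hσ)) hθ0.le
        rwa [abs_mul, Nat.abs_cast] at this
      have hsum : (((I q).biUnion fun p =>
          (range n).filter fun m : ℕ => |(q * α₀ - p) + m * (q * σ)| < θ).card : ℝ) ≤
          ∑ p ∈ I q, (2 * (θ / (q * |σ|)) + 1) := by
        refine le_trans ?_ (sum_le_sum hc)
        exact_mod_cast card_biUnion_le
      refine hsum.trans ?_
      rw [sum_const, nsmul_eq_mul]
      calc ((I q).card : ℝ) * (2 * (θ / (q * |σ|)) + 1)
          ≤ (2 * (q * (n * |σ|)) + 3) * (2 * (θ / (q * |σ|)) + 1) := by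
            gcongr; linarith
        _ = 4 * n * θ + 2 * q * (|σ| * n) + 6 * θ / (q * |σ|) + 3 := by field_simp; ring
        _ ≤ 4 * n * θ + 2 * K * (|σ| * n) + 6 * θ / (1 * |σ|) + 3 := by gcongr
        _ = _ := by rw [one_mul]
    have c2 : (bad.card : ℝ) ≤ ∑ q ∈ Icc 1 K,
        (4 * n * θ + 2 * K * (|σ| * n) + 6 * θ / |σ| + 3) := by
      refine le_trans ?_ (sum_le_sum c1)
      exact_mod_cast card_biUnion_le
    rw [sum_const, nsmul_eq_mul, Nat.card_Icc, Nat.add_sub_cancel] at c2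
    have hKθ : K * θ ≤ 1 / 32 := by
      rw [hθ, mul_one_div, div_le_iff₀ hT0]; linarith
    have d1 : K * (4 * n * θ) ≤ n / 8 := by nlinarith
    have d2 : K * (2 * K * (|σ| * n)) ≤ n / 8 := by
      have : 2 * (K : ℝ) ^ 2 * (|σ| * n) ≤ 2 * (K : ℝ) ^ 2 * (6144 * A) := by gcongr
      nlinarith
    have d3 : K * (6 * θ / |σ|) ≤ n / 8 := by
      have : K * (6 * θ / |σ|) = 6 * (K * θ) / |σ| := by ring
      rw [this, div_le_iff₀ hσ]
      nlinarith
    nlinarith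
  have hle : n ≤ G.card + bad.card := by
    calc n = (range n).card := (card_range n).symm
      _ ≤ (G ∪ bad).card := card_le_card hcov
      _ ≤ _ := card_union_le _ _
  refine ⟨G, ?_, fun m hm => ?_⟩
  · have : (n : ℝ) ≤ 2 * G.card := by
      have : (n : ℝ) ≤ G.card + bad.card := by exact_mod_cast hle
      linarith
    exact_mod_cast this
  · obtain ⟨h1, h2⟩ := mem_filter.1 hm
    exact ⟨mem_range.1 h1, h2⟩

section Step

/-- The slope-`s` determinant of an integer vector relative to `b`. -/
def slopeDet (s : ℝ) (b v : Fin 3 → ℤ) : ℝ := (v 0 + s * v 1) * b 2 - (b 0 + s * b 1) * v 2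

/-- The vertical determinant of an integer vector relative to `b`. -/
def vertDet (b v : Fin 3 → ℤ) : ℝ := v 1 * b 2 - b 1 * v 2

/-- The determinant of three integer vectors. -/
def tripleDet (a b e : Fin 3 → ℤ) : ℤ :=
  a 0 * (b 1 * e 2 - b 2 * e 1) - a 1 * (b 0 * e 2 - b 2 * e 0) + a 2 * (b 0 * e 1 - b 1 * e 0)

/-- The abscissa of the point of the plane whose linear forms vanish on `b`. -/
noncomputable def ptX (s : ℝ) (b : Fin 3 → ℤ) : ℝ := -(b 0 + s * b 1) / b 2

/-- The ordinate of the point of the plane whose linear forms vanish on `b`. -/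
noncomputable def ptY (b : Fin 3 → ℤ) : ℝ := -(b 1 : ℝ) / b 2

/-- The pair `(a, b)` is primitive and has the sizes prescribed by `Q`, `R` and `ν`. -/
structure IsNode (s Q R ν : ℝ) (a b : Fin 3 → ℤ) : Prop where
  exists_unimodular : ∃ e, |tripleDet a b e| = 1
  le_abs_two : Q / 4 ≤ |(b 2 : ℝ)|
  abs_two_le : |(b 2 : ℝ)| ≤ 32 * Q
  le_slope : R ≤ |slopeDet s b a|
  slope_le : |slopeDet s b a| ≤ 2 * R
  le_vert : ν / 16 ≤ |vertDet b a|
  vert_le : |vertDet b a| ≤ 192 * ν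

/-- The inequalities between the parameters of two consecutive levels of the construction. -/
structure StepParams (Q R ν Υ H Q' R' ν' Υ' ξ ξ' : ℝ) (K T n : ℕ) : Prop where
  Q_pos : 0 < Q
  R_pos : 0 < R
  ν_pos : 0 < ν
  Υ_pos : 0 < Υ
  H_pos : 0 < H
  Q'_pos : 0 < Q'
  R'_pos : 0 < R'
  K_pos : 0 < K
  n_pos : 0 < n
  eq_H : Q' * R * Υ = H
  eq_ν : ν' * R = H * Q
  T_le : 2 * R * (T + 1) ≤ R'
  R'_lt : 4 * R' < H * R
  ν_mul_le : 3072 * ν * R' ≤ H * Q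
  Q_le : 256 * Q ≤ Q' * K
  n_mul_le : 3072 * n * Q ≤ K * Q'
  Υ'_mul_lt : Υ' * K * Q' < 32 * Q * Υ
  K_le_T : 32 * K ≤ T
  K_le_n : 24 * K ≤ n
  sq_K_mul_le : 98304 * (K : ℝ) ^ 2 * ν ≤ n * (Q ^ 2 * Υ)
  le_ν : 24576 * (Q ^ 2 * Υ) ≤ ν
  eq_ξ : ξ * (Q * Q') = 64 * R'
  area_lt : (2 * ξ * Υ' + 3 * ξ' * Υ) * (32768 * Q * Q' ^ 2) < 1

variable {s Q R ν Υ H Q' R' ν' Υ' ξ ξ' : ℝ} {K T n : ℕ} {a b e : Fin 3 → ℤ}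

theorem slopeDet_mul_vertDet_sub (s : ℝ) (a b e : Fin 3 → ℤ) :
    slopeDet s b a * vertDet b e - slopeDet s b e * vertDet b a = -(b 2 * tripleDet a b e) := by
  simp only [slopeDet, vertDet, tripleDet]; push_cast; ring

theorem IsNode.exists_normalized (h : IsNode s Q R ν a b) (hR : 0 < R) :
    ∃ e, |tripleDet a b e| = 1 ∧ 0 ≤ -slopeDet s b e / slopeDet s b a ∧
      -slopeDet s b e / slopeDet s b a ≤ 1 / 2 := by
  obtain ⟨e, he⟩ := h.exists_unimodular
  have hD : slopeDet s b a ≠ 0 := abs_pos.1 (hR.trans_le h.le_slope)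
  set x := slopeDet s b e / slopeDet s b a with hx
  have hr := abs_sub_round x
  have h1 : ∀ t : ℤ, slopeDet s b (e + t • a) / slopeDet s b a = x + t := by
    intro t
    rw [hx]; field_simp
    simp [slopeDet]; ring
  have h2 : ∀ t : ℤ, tripleDet a b (e + t • a) = tripleDet a b e := by
    intro t
    simp [tripleDet]; ring
  have h1' : ∀ t : ℤ, slopeDet s b (-(e + t • a)) = -slopeDet s b (e + t • a) := by
    intro t; simp [slopeDet]; ring
  have h2' : ∀ t : ℤ, tripleDet a b (-(e + t • a)) = -tripleDet a b (e + t • a) := by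
    intro t; simp [tripleDet]; ring
  have h3 := h1 (-round x)
  push_cast at h3
  have a1 := abs_le.1 hr
  rcases le_total (x - round x) 0 with hs | hs
  · refine ⟨e + (-round x) • a, by rw [h2, he], ?_, ?_⟩ <;> rw [neg_div, h3] <;> linarith
  · refine ⟨-(e + (-round x) • a), by rw [h2', abs_neg, h2, he], ?_, ?_⟩ <;>
    rw [h1', neg_neg, h3] <;> linarith

theorem slopeDet_comb (s : ℝ) (a b e : Fin 3 → ℤ) (i j l : ℤ) :
    slopeDet s b (i • a + j • e + l • b) = i * slopeDet s b a + j * slopeDet s b e := by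
  simp [slopeDet]; ring

theorem vertDet_comb (a b e : Fin 3 → ℤ) (i j l : ℤ) :
    vertDet b (i • a + j • e + l • b) = i * vertDet b a + j * vertDet b e := by
  simp [vertDet]; ring

theorem tripleDet_comb (a b e : Fin 3 → ℤ) (i j l x y : ℤ) :
    tripleDet b (i • a + j • e + l • b) ((-y) • a + x • e) =
      -(x * i + y * j) * tripleDet a b e := by
  simp [tripleDet]; ring

theorem slopeDet_swap (s : ℝ) (a b : Fin 3 → ℤ) : slopeDet s a b = -slopeDet s b a := by
  simp [slopeDet]

theorem vertDet_swap (a b : Fin 3 → ℤ) : vertDet a b = -vertDet b a := by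
  simp [vertDet]

set_option maxHeartbeats 400000 in
theorem IsNode.exists_child (P : StepParams Q R ν Υ H Q' R' ν' Υ' ξ ξ' K T n)
    (h : IsNode s Q R ν a b) (he : |tripleDet a b e| = 1)
    (hρ0 : 0 ≤ -slopeDet s b e / slopeDet s b a) (hρ1 : -slopeDet s b e / slopeDet s b a ≤ 1 / 2)
    {j : ℕ} (hj : j.Prime) (hHj : H < j) (hjH : j ≤ 4 * H) {u : ℝ} (hu1 : Υ / 4 ≤ u)
    (hu2 : u ≤ Υ / 2)
    (hgood : ∀ q : ℕ, 1 ≤ q → q ≤ K → ∀ p : ℤ,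
      1 / (T : ℝ) ≤ |q * (a 2 / b 2 + vertDet b a / (b 2 ^ 2 * u)) - p|) :
    ∃ i l : ℤ, 0 < i ∧ i < j ∧ IsNode s Q' R' ν' b (i • a + (j : ℤ) • e + l • b) ∧
      |ptY (i • a + (j : ℤ) • e + l • b) - (ptY b + u)| * (K * Q') ≤ 128 * Q * Υ := by
  obtain ⟨hQ, hR, hν, hΥ, hH, hQ', hR', hK, hn, eqH, eqν, hT, hR'H, hB2, hB3, -, -, hKT, -⟩ := P
  have hjpos : (0 : ℝ) < j := by exact_mod_cast hj.pos
  have hK' : (0 : ℝ) < K := by exact_mod_cast hK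
  set D := slopeDet s b a with hD
  set N := vertDet b a with hN
  have hD0 : 0 < |D| := hR.trans_le h.le_slope
  have hDne : D ≠ 0 := abs_pos.1 hD0
  have hb0 : 0 < |(b 2 : ℝ)| := lt_of_lt_of_le (by positivity) h.le_abs_two
  have hbne : (b 2 : ℝ) ≠ 0 := abs_pos.1 hb0
  have hu : 0 < u := by linarith
  set ρ := -slopeDet s b e / D with hρ
  set T₀ := R' / |D| with hT₀
  have hT₀D : T₀ * |D| = R' := by rw [hT₀]; field_simp
  have hT₀pos : 0 < T₀ := by positivity
  have hTT₀ : (T : ℝ) + 1 ≤ T₀ := by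
    rw [hT₀, le_div_iff₀ hD0]
    calc ((T : ℝ) + 1) * |D| ≤ (T + 1) * (2 * R) := by gcongr; exact h.slope_le
      _ ≤ R' := by linarith
  obtain ⟨t, l, htT, htl⟩ := exists_abs_mul_add_le (τ := j * ((e 1 + (ptY b + u) * e 2) / (b 2 * u)))
    hK (by omega) hgood ⌈ρ * j + T₀⌉
  set i : ℤ := ⌈ρ * j + T₀⌉ + t with hi
  have hρj : 0 ≤ ρ * j := by positivity
  have hi1 : T₀ ≤ i - ρ * j := by
    have := Int.le_ceil (ρ * j + T₀)
    rw [hi]; push_cast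
    have : (0 : ℝ) ≤ t := by positivity
    linarith
  have hi2 : i - ρ * j ≤ 2 * T₀ := by
    have := Int.ceil_lt_add_one (ρ * j + T₀)
    rw [hi]; push_cast
    have : (t : ℝ) + 1 ≤ T := by exact_mod_cast htT
    linarith
  have hipos : 0 < i := by
    have : (0 : ℝ) < i := by linarith
    exact_mod_cast this
  have hij : i < j := by
    have h1 : 2 * T₀ < H / 2 := by
      have : T₀ ≤ R' / R := by rw [hT₀]; gcongr; exact h.le_slope
      have h2 : R' / R < H / 4 := by rw [div_lt_iff₀ hR]; linarith
      linarith
    have h2 : ρ * j ≤ 1 / 2 * j := by gcongr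
    have : (i : ℝ) < j := by linarith
    exact_mod_cast this
  set c : Fin 3 → ℤ := i • a + (j : ℤ) • e + l • b with hc
  have hDc : slopeDet s b c = D * (i - ρ * j) := by
    rw [hc, slopeDet_comb, hρ]; push_cast; field_simp; ring
  have hx0 : 0 < i - ρ * j := by linarith
  have hDc1 : R' ≤ |slopeDet s b c| := by
    rw [hDc, abs_mul, abs_of_pos hx0, ← hT₀D, mul_comm T₀]; gcongr
  have hDc2 : |slopeDet s b c| ≤ 2 * R' := by
    rw [hDc, abs_mul, abs_of_pos hx0, ← hT₀D]
    have := mul_le_mul_of_nonneg_left hi2 hD0.le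
    linarith only [this]
  have hNe : D * vertDet b e = -ρ * D * N - b 2 * tripleDet a b e := by
    have := slopeDet_mul_vertDet_sub s a b e
    have h2 : ρ * D = -slopeDet s b e := by rw [hρ]; field_simp
    rw [← hD, ← hN] at this
    linear_combination this + N * h2
  have hNc : vertDet b c * D = N * (D * (i - ρ * j)) - j * (b 2 * tripleDet a b e) := by
    rw [hc, vertDet_comb, ← hN]; push_cast
    linear_combination (j : ℝ) * hNe
  have hdet : |(tripleDet a b e : ℝ)| = 1 := by exact_mod_cast he
  have hmain : |(j : ℝ) * (b 2 * tripleDet a b e)| = j * |(b 2 : ℝ)| := by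
    rw [abs_mul, abs_mul, hdet, Nat.abs_cast, mul_one]
  have hHQ : H * (Q / 4) ≤ j * |(b 2 : ℝ)| := by
    have := h.le_abs_two; gcongr
  have hsmall : |N * (D * (i - ρ * j))| ≤ j * |(b 2 : ℝ)| / 2 := by
    rw [← hDc, abs_mul]
    calc |N| * |slopeDet s b c| ≤ (192 * ν) * (2 * R') := by
          gcongr; exact h.vert_le
      _ ≤ H * (Q / 4) / 2 := by linarith
      _ ≤ _ := by linarith
  have hNc1 : j * |(b 2 : ℝ)| / 2 ≤ |vertDet b c| * |D| := by
    rw [← abs_mul, hNc]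
    have := abs_sub_abs_le_abs_sub (j * (b 2 * tripleDet a b e) : ℝ) (N * (D * (i - ρ * j)))
    rw [abs_sub_comm, hmain] at this
    linarith
  have hNc2 : |vertDet b c| * |D| ≤ 3 / 2 * (j * |(b 2 : ℝ)|) := by
    rw [← abs_mul, hNc]
    have := abs_sub (N * (D * (i - ρ * j))) (j * (b 2 * tripleDet a b e) : ℝ)
    rw [hmain] at this
    linarith
  have hν'R : ν' = H * Q / R := by rw [← eqν]; field_simp
  have hν1 : ν' / 16 ≤ |vertDet b c| := by
    have h1 : H * (Q / 4) / 2 ≤ |vertDet b c| * (2 * R) := by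
      calc _ ≤ j * |(b 2 : ℝ)| / 2 := by linarith
        _ ≤ _ := hNc1
        _ ≤ _ := by have := h.slope_le; gcongr
    rw [hν'R, div_div, div_le_iff₀ (by positivity)]
    linarith
  have hν2 : |vertDet b c| ≤ 192 * ν' := by
    have h1 : |vertDet b c| * R ≤ 3 / 2 * (4 * H * (32 * Q)) := by
      calc _ ≤ |vertDet b c| * |D| := by have := h.le_slope; gcongr
        _ ≤ _ := hNc2
        _ ≤ _ := by have := h.abs_two_le; gcongr
    rw [hν'R, ← mul_div_assoc, le_div_iff₀ hR]
    linarith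
  set w := (i * (a 2 / b 2 + N / (b 2 ^ 2 * u)) +
    j * ((e 1 + (ptY b + u) * e 2) / (b 2 * u)) + l : ℝ) with hw
  have htl' : |w| ≤ 2 / K := by
    rw [hw, hi]; push_cast; exact htl
  have hL : (c 1 + (ptY b + u) * c 2 : ℝ) = b 2 * u * w := by
    rw [hw, hN]
    simp only [hc, vertDet, ptY, Pi.add_apply, Pi.smul_apply, smul_eq_mul]
    push_cast
    field_simp
    ring
  have hc2 : (c 2 : ℝ) = b 2 * w - vertDet b c / (b 2 * u) := by
    have h1 : c 2 * (b 2 * u) = b 2 * (c 1 + (ptY b + u) * c 2) - vertDet b c := by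
      simp only [vertDet, ptY]; field_simp; ring
    rw [hL] at h1
    field_simp
    linarith
  have hbw : |b 2 * w| ≤ Q' / 4 := by
    rw [abs_mul]
    calc _ ≤ 32 * Q * (2 / K) := by gcongr; exact h.abs_two_le
      _ ≤ Q' / 4 := by
        rw [← mul_div_assoc, div_le_iff₀ hK']; linarith
  have hq : |vertDet b c / (b 2 * u)| = |vertDet b c| / (|(b 2 : ℝ)| * u) := by
    rw [abs_div, abs_mul, abs_of_pos hu]
  have hq1 : Q' / 2 ≤ |vertDet b c / (b 2 * u)| := by
    rw [hq, le_div_iff₀ (by positivity)]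
    have h1 : Q' * R * u ≤ H / 2 := by
      calc Q' * R * u ≤ Q' * R * (Υ / 2) := by gcongr
        _ = _ := by linarith
    have h2 : (Q' / 2 * (|(b 2 : ℝ)| * u)) * (2 * R) ≤ |vertDet b c| * (2 * R) := by
      calc _ = |(b 2 : ℝ)| * (Q' * R * u) := by ring
        _ ≤ |(b 2 : ℝ)| * (H / 2) := by gcongr
        _ ≤ j * |(b 2 : ℝ)| / 2 := by
          have := mul_le_mul_of_nonneg_right hHj.le hb0.le
          linarith only [this]
        _ ≤ _ := hNc1
        _ ≤ _ := by have := h.slope_le; gcongr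
    exact le_of_mul_le_mul_right h2 (by positivity)
  have hq2 : |vertDet b c / (b 2 * u)| ≤ 24 * Q' := by
    rw [hq, div_le_iff₀ (by positivity)]
    have h1 : H / 4 ≤ Q' * R * u := by
      calc H / 4 = Q' * R * (Υ / 4) := by linarith
        _ ≤ _ := by gcongr
    have h2 : |vertDet b c| * R ≤ (24 * Q' * (|(b 2 : ℝ)| * u)) * R := by
      calc _ ≤ |vertDet b c| * |D| := by have := h.le_slope; gcongr
        _ ≤ _ := hNc2
        _ ≤ 3 / 2 * (4 * H * |(b 2 : ℝ)|) := by gcongr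
        _ ≤ 24 * |(b 2 : ℝ)| * (Q' * R * u) := by
          have := mul_le_mul_of_nonneg_left h1 hb0.le
          linarith only [this]
        _ = _ := by ring
    exact le_of_mul_le_mul_right h2 hR
  have hc21 : Q' / 4 ≤ |(c 2 : ℝ)| := by
    rw [hc2]
    have := abs_sub_abs_le_abs_sub (vertDet b c / (b 2 * u)) (b 2 * w : ℝ)
    rw [abs_sub_comm] at this
    linarith
  have hc22 : |(c 2 : ℝ)| ≤ 32 * Q' := by
    rw [hc2]
    have := abs_sub (b 2 * w : ℝ) (vertDet b c / (b 2 * u))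
    linarith
  have hcpos : 0 < |(c 2 : ℝ)| := lt_of_lt_of_le (by positivity) hc21
  refine ⟨i, l, hipos, hij, ⟨?_, hc21, hc22, ?_, ?_, ?_, ?_⟩, ?_⟩
  · have hcop : IsCoprime i (j : ℤ) := by
      refine ((Nat.prime_iff_prime_int.1 hj).coprime_iff_not_dvd.2 fun hdvd => ?_).symm
      have := Int.le_of_dvd hipos hdvd
      omega
    obtain ⟨x, y, hxy⟩ := hcop
    refine ⟨(-y) • a + x • e, ?_⟩
    rw [tripleDet_comb, hxy, neg_mul, one_mul, abs_neg, he]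
  · rwa [slopeDet_swap, abs_neg]
  · rwa [slopeDet_swap, abs_neg]
  · rwa [vertDet_swap, abs_neg]
  · rwa [vertDet_swap, abs_neg]
  · have h1 : ptY c - (ptY b + u) = -(b 2 * u * w) / c 2 := by
      have : (c 2 : ℝ) ≠ 0 := abs_pos.1 hcpos
      rw [← hL]; simp only [ptY]; field_simp; ring
    rw [h1, abs_div, abs_neg, abs_mul, abs_mul, abs_of_pos hu]
    rw [div_mul_eq_mul_div, div_le_iff₀ hcpos]
    calc |(b 2 : ℝ)| * u * |w| * (K * Q') ≤ (32 * Q) * (Υ / 2) * (2 / K) * (K * Q') := by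
          gcongr; exact h.abs_two_le
      _ = 128 * Q * Υ * (Q' / 4) := by field_simp; ring
      _ ≤ _ := by gcongr

theorem ptX_sub_ptX {c : Fin 3 → ℤ} (hb : (b 2 : ℝ) ≠ 0) (hc : (c 2 : ℝ) ≠ 0) :
    ptX s c - ptX s b = -slopeDet s b c / (b 2 * c 2) := by
  simp only [ptX, slopeDet]; field_simp; ring

theorem ptY_sub_ptY {c : Fin 3 → ℤ} (hb : (b 2 : ℝ) ≠ 0) (hc : (c 2 : ℝ) ≠ 0) :
    ptY c - ptY b = -vertDet b c / (b 2 * c 2) := by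
  simp only [ptY, vertDet]; field_simp; ring

theorem abs_ptX_sub_le (P : StepParams Q R ν Υ H Q' R' ν' Υ' ξ ξ' K T n)
    (h : IsNode s Q R ν a b) {c : Fin 3 → ℤ} (h' : IsNode s Q' R' ν' b c) :
    |ptX s c - ptX s b| ≤ ξ / 2 := by
  have hQ := P.Q_pos
  have hQ' := P.Q'_pos
  have hR' := P.R'_pos
  have hb : 0 < |(b 2 : ℝ)| := lt_of_lt_of_le (by positivity) h.le_abs_two
  have hc : 0 < |(c 2 : ℝ)| := lt_of_lt_of_le (by positivity) h'.le_abs_two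
  rw [ptX_sub_ptX (abs_pos.1 hb) (abs_pos.1 hc), abs_div, abs_neg, abs_mul]
  have h1 := h'.slope_le
  rw [slopeDet_swap, abs_neg] at h1
  have hξ : ξ = 64 * R' / (Q * Q') := by rw [← P.eq_ξ]; field_simp
  calc _ ≤ 2 * R' / ((Q / 4) * (Q' / 4)) := by
        have := h.le_abs_two; have := h'.le_abs_two; gcongr
    _ = ξ / 2 := by rw [hξ]; field_simp; ring

/-- Two children with different primes are separated, by an area argument. -/
theorem separated_of_ne (P : StepParams Q R ν Υ H Q' R' ν' Υ' ξ ξ' K T n)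
    (h : IsNode s Q R ν a b) (he : |tripleDet a b e| = 1) {j j' : ℕ} (hj : j.Prime)
    (hj' : j'.Prime) (hne : j ≠ j') {i i' l l' : ℤ} (hi : 0 < i) (hij : i < j)
    {c c' : Fin 3 → ℤ} (hc : c = i • a + (j : ℤ) • e + l • b)
    (hc' : c' = i' • a + (j' : ℤ) • e + l' • b)
    (hn : IsNode s Q' R' ν' b c) (hn' : IsNode s Q' R' ν' b c')
    (hY : |ptY c - ptY b| ≤ 3 / 4 * Υ) :
    4 * ξ' < |ptX s c - ptX s c'| ∨ 4 * Υ' < |ptY c - ptY c'| := by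
  by_contra! hcon
  obtain ⟨hX1, hY1⟩ := hcon
  have hQ := P.Q_pos
  have hQ' := P.Q'_pos
  have hR' := P.R'_pos
  have hb : 0 < |(b 2 : ℝ)| := lt_of_lt_of_le (by positivity) h.le_abs_two
  have hcp : 0 < |(c 2 : ℝ)| := lt_of_lt_of_le (by positivity) hn.le_abs_two
  have hcp' : 0 < |(c' 2 : ℝ)| := lt_of_lt_of_le (by positivity) hn'.le_abs_two
  have hb0 := abs_pos.1 hb
  have hc0 := abs_pos.1 hcp
  have hc0' := abs_pos.1 hcp'
  have hk : i * j' - i' * j ≠ 0 := by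
    intro h0
    have h1 : (j : ℤ) ∣ i * j' := ⟨i', by linarith⟩
    rcases (Nat.prime_iff_prime_int.1 hj).dvd_mul.1 h1 with h2 | h2
    · have := Int.le_of_dvd hi h2; omega
    · exact hne ((Nat.prime_dvd_prime_iff_eq hj hj').1 (Int.natCast_dvd_natCast.1 h2))
  have hk' : (1 : ℝ) ≤ |(i * j' - i' * j : ℝ)| := by
    have := Int.one_le_abs hk; exact_mod_cast this
  have hdet : |(tripleDet a b e : ℝ)| = 1 := by exact_mod_cast he
  have harea : (ptX s c - ptX s b) * (ptY c' - ptY b) - (ptX s c' - ptX s b) * (ptY c - ptY b) =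
      -((i * j' - i' * j) * tripleDet a b e) / (b 2 * c 2 * c' 2) := by
    rw [ptX_sub_ptX hb0 hc0, ptX_sub_ptX hb0 hc0', ptY_sub_ptY hb0 hc0, ptY_sub_ptY hb0 hc0']
    have h1 : slopeDet s b c * vertDet b c' - slopeDet s b c' * vertDet b c =
        -((i * j' - i' * j) * (b 2 * tripleDet a b e)) := by
      rw [hc, hc', slopeDet_comb, slopeDet_comb, vertDet_comb, vertDet_comb]
      push_cast
      linear_combination (i * j' - i' * j : ℝ) * slopeDet_mul_vertDet_sub s a b e
    field_simp
    linear_combination h1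
  have hlow : 1 ≤ |(ptX s c - ptX s b) * (ptY c' - ptY b) -
      (ptX s c' - ptX s b) * (ptY c - ptY b)| * (32768 * Q * Q' ^ 2) := by
    rw [harea, abs_div, abs_neg, abs_mul, hdet, mul_one, abs_mul, abs_mul, div_mul_eq_mul_div,
      le_div_iff₀ (by positivity), one_mul]
    calc |(b 2 : ℝ)| * |(c 2 : ℝ)| * |(c' 2 : ℝ)| ≤ (32 * Q) * (32 * Q') * (32 * Q') := by
          have := h.abs_two_le; have := hn.abs_two_le; have := hn'.abs_two_le; gcongr
      _ = 1 * (32768 * Q * Q' ^ 2) := by ring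
      _ ≤ _ := by gcongr
  have hup : |(ptX s c - ptX s b) * (ptY c' - ptY b) - (ptX s c' - ptX s b) * (ptY c - ptY b)| ≤
      2 * ξ * Υ' + 3 * ξ' * Υ := by
    have e1 : (ptX s c - ptX s b) * (ptY c' - ptY b) - (ptX s c' - ptX s b) * (ptY c - ptY b) =
        (ptX s c - ptX s c') * (ptY c - ptY b) - (ptX s c - ptX s b) * (ptY c - ptY c') := by ring
    rw [e1]
    have hξ := abs_ptX_sub_le P h hn
    have h1 := abs_sub ((ptX s c - ptX s c') * (ptY c - ptY b))
      ((ptX s c - ptX s b) * (ptY c - ptY c'))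
    rw [abs_mul, abs_mul] at h1
    have h2 : |ptX s c - ptX s c'| * |ptY c - ptY b| ≤ 4 * ξ' * (3 / 4 * Υ) := by
      gcongr
      exact (abs_nonneg _).trans hX1
    have h3 : |ptX s c - ptX s b| * |ptY c - ptY c'| ≤ ξ / 2 * (4 * Υ') := by
      gcongr
      exact (abs_nonneg _).trans hξ
    linarith
  have := mul_le_mul_of_nonneg_right hup (show 0 ≤ 32768 * Q * Q' ^ 2 by positivity)
  linarith [P.area_lt]

theorem IsNode.exists_good_ordinates (P : StepParams Q R ν Υ H Q' R' ν' Υ' ξ ξ' K T n)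
    (h : IsNode s Q R ν a b) : ∃ G : Finset ℕ, n ≤ 2 * G.card ∧ ∀ t ∈ G, t < n ∧
      ∀ q : ℕ, 1 ≤ q → q ≤ K → ∀ p : ℤ,
        1 / (T : ℝ) ≤ |q * (a 2 / b 2 + vertDet b a / (b 2 ^ 2 * (Υ * n / (2 * (n + t))))) - p| := by
  have hQ := P.Q_pos
  have hΥ := P.Υ_pos
  have hν := P.ν_pos
  have hn : (0 : ℝ) < n := by exact_mod_cast P.n_pos
  have hb : 0 < |(b 2 : ℝ)| := lt_of_lt_of_le (by positivity) h.le_abs_two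
  have hb0 := abs_pos.1 hb
  set N := vertDet b a with hN
  set σ : ℝ := 2 * N / (b 2 ^ 2 * Υ * n) with hσ
  set A : ℝ := ν / (Q ^ 2 * Υ) with hA
  have hσn : |σ| * n = 2 * |N| / (|(b 2 : ℝ)| ^ 2 * Υ) := by
    rw [hσ, abs_div, abs_mul, abs_mul, abs_mul, abs_pow, abs_of_pos hΥ, abs_of_pos hn,
      abs_of_pos (by norm_num : (0 : ℝ) < 2)]
    field_simp
  obtain ⟨G, hG1, hG2⟩ := half_le_card_filter_forall_le_abs (n := n) (K := K) (T := T)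
    (α₀ := a 2 / b 2 + 2 * N / (b 2 ^ 2 * Υ)) (σ := σ) (A := A) P.K_pos P.K_le_T P.K_le_n
    (by rw [hA, le_div_iff₀ (by positivity)]; exact P.le_ν)
    (by rw [hA, ← mul_div_assoc, div_le_iff₀ (by positivity)]; exact P.sq_K_mul_le)
    (by
      rw [hσn, hA]
      calc ν / (Q ^ 2 * Υ) / 8192 = 2 * (ν / 16) / ((32 * Q) ^ 2 * Υ) := by field_simp; norm_num
        _ ≤ _ := by
          have := h.le_vert; have := h.abs_two_le; gcongr)
    (by
      rw [hσn, hA]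
      calc _ ≤ 2 * (192 * ν) / ((Q / 4) ^ 2 * Υ) := by
            have := h.vert_le; have := h.le_abs_two; gcongr
        _ = _ := by field_simp; norm_num)
  refine ⟨G, hG1, fun t ht => ⟨(hG2 t ht).1, fun q hq1 hq2 p => ?_⟩⟩
  have := (hG2 t ht).2 q hq1 hq2 p
  have e1 : (a 2 / b 2 + vertDet b a / (b 2 ^ 2 * (Υ * n / (2 * (n + t)))) : ℝ) =
      a 2 / b 2 + 2 * N / (b 2 ^ 2 * Υ) + t * σ := by
    have : (n : ℝ) + t ≠ 0 := by positivity
    rw [hσ, ← hN]; field_simp; ring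
  rwa [e1]

/-- A node has many separated children. -/
theorem IsNode.exists_children (P : StepParams Q R ν Υ H Q' R' ν' Υ' ξ ξ' K T n)
    (h : IsNode s Q R ν a b) {p m : ℕ} (pr : Fin p → ℕ) (hpr : Function.Injective pr)
    (hpr' : ∀ i, (pr i).Prime ∧ H < pr i ∧ pr i ≤ 4 * H) (hm : 2 * m ≤ n) :
    ∃ c : Fin p × Fin m → Fin 3 → ℤ, (∀ x, IsNode s Q' R' ν' b (c x)) ∧
      (∀ x, |ptX s (c x) - ptX s b| ≤ ξ / 2) ∧ (∀ x, |ptY (c x) - ptY b| ≤ 3 / 4 * Υ) ∧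
      (∀ x y, x ≠ y → 4 * ξ' < |ptX s (c x) - ptX s (c y)| ∨
        4 * Υ' < |ptY (c x) - ptY (c y)|) ∧
      ∀ x y, x ≠ y → x.1 = y.1 → 4 * Υ' < |ptY (c x) - ptY (c y)| := by
  have hQ := P.Q_pos
  have hQ' := P.Q'_pos
  have hΥ := P.Υ_pos
  have hn : (0 : ℝ) < n := by exact_mod_cast P.n_pos
  have hK : (0 : ℝ) < K := by exact_mod_cast P.K_pos
  obtain ⟨e, he, hρ0, hρ1⟩ := h.exists_normalized P.R_pos
  obtain ⟨G, hG1, hG2⟩ := h.exists_good_ordinates P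
  obtain ⟨f⟩ : Nonempty (Fin m ↪ G) :=
    Function.Embedding.nonempty_of_card_le (by simp; omega)
  let u : ℕ → ℝ := fun t => Υ * n / (2 * (n + t))
  have hu1 : ∀ t < n, Υ / 4 ≤ u t := by
    intro t ht
    have : (t : ℝ) ≤ n := by exact_mod_cast ht.le
    simp only [u]
    rw [le_div_iff₀ (by positivity)]
    nlinarith
  have hu2 : ∀ t, u t ≤ Υ / 2 := by
    intro t
    have : (0 : ℝ) ≤ t := by positivity
    simp only [u]
    rw [div_le_iff₀ (by positivity)]
    nlinarith
  have hu3 : ∀ t < n, ∀ t' < n, t ≠ t' → Υ / (8 * n) ≤ |u t - u t'| := by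
    intro t ht t' ht' hne
    have h1 : (t : ℝ) ≤ n := by exact_mod_cast ht.le
    have h2 : (t' : ℝ) ≤ n := by exact_mod_cast ht'.le
    have h3 : (1 : ℝ) ≤ |(t' : ℝ) - t| := by
      have h4 : (t' : ℤ) - t ≠ 0 := by omega
      have := Int.one_le_abs h4
      exact_mod_cast this
    have h5 : u t - u t' = Υ * n * (t' - t) / (2 * (n + t) * (n + t')) := by
      simp only [u]; field_simp; ring
    rw [h5, abs_div, abs_mul, abs_of_pos (mul_pos hΥ hn),
      abs_of_pos (show 0 < 2 * ((n : ℝ) + t) * (n + t') by positivity)]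
    calc Υ / (8 * n) = Υ * n * 1 / (2 * (n + n) * (n + n)) := by field_simp; ring
      _ ≤ _ := by gcongr
  have hex : ∀ x : Fin p × Fin m, ∃ i l : ℤ, 0 < i ∧ i < pr x.1 ∧
      IsNode s Q' R' ν' b (i • a + (pr x.1 : ℤ) • e + l • b) ∧
      |ptY (i • a + (pr x.1 : ℤ) • e + l • b) - (ptY b + u (f x.2))| * (K * Q') ≤
        128 * Q * Υ := fun x =>
    h.exists_child P he hρ0 hρ1 (hpr' x.1).1 (hpr' x.1).2.1 (hpr' x.1).2.2
      (hu1 _ (hG2 _ (f x.2).2).1) (hu2 _) (hG2 _ (f x.2).2).2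
  choose i l hi hij hnode hdist using hex
  set χ : ℝ := 128 * Q * Υ / (K * Q') with hχ
  have hχ1 : χ ≤ Υ / (24 * n) := by
    rw [hχ, div_le_div_iff₀ (by positivity) (by positivity)]
    have := mul_le_mul_of_nonneg_left P.n_mul_le hΥ.le
    linarith
  have hχ2 : 4 * Υ' < χ := by
    rw [hχ, lt_div_iff₀ (by positivity)]
    linarith [P.Υ'_mul_lt]
  have hn1 : (1 : ℝ) ≤ n := by exact_mod_cast P.n_pos
  have hχ3 : χ ≤ Υ / 24 := hχ1.trans (by gcongr; linarith)
  have hdist' : ∀ x, |ptY (i x • a + (pr x.1 : ℤ) • e + l x • b) - (ptY b + u (f x.2))| ≤ χ :=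
    fun x => by rw [hχ, le_div_iff₀ (by positivity)]; exact hdist x
  have hY : ∀ x, |ptY (i x • a + (pr x.1 : ℤ) • e + l x • b) - ptY b| ≤ 3 / 4 * Υ := by
    intro x
    have a1 := abs_le.1 (hdist' x)
    have a2 := hu1 _ (hG2 _ (f x.2).2).1
    have a3 := hu2 (f x.2)
    rw [abs_le]
    constructor <;> linarith
  have hsame : ∀ x y : Fin p × Fin m, x ≠ y → x.1 = y.1 → 4 * Υ' <
      |ptY (i x • a + (pr x.1 : ℤ) • e + l x • b) -
        ptY (i y • a + (pr y.1 : ℤ) • e + l y • b)| := by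
    intro x y hxy h1
    have hne : (f x.2 : ℕ) ≠ f y.2 := by
      intro h2
      exact hxy (Prod.ext h1 (f.injective (Subtype.ext h2)))
    have a0 := hu3 _ (hG2 _ (f x.2).2).1 _ (hG2 _ (f y.2).2).1 hne
    have a1 := abs_le.1 (hdist' x)
    have a2 := abs_le.1 (hdist' y)
    have a3 : Υ / (8 * n) = 3 * (Υ / (24 * n)) := by field_simp; norm_num
    rw [a3] at a0
    rcases le_abs.1 a0 with a4 | a4
    · refine lt_of_lt_of_le ?_ (le_abs_self _); linarith
    · refine lt_of_lt_of_le ?_ (neg_le_abs _); linarith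
  refine ⟨fun x => i x • a + (pr x.1 : ℤ) • e + l x • b, hnode,
    fun x => abs_ptX_sub_le P h (hnode x), hY, fun x y hxy => ?_, hsame⟩
  by_cases h1 : x.1 = y.1
  · exact Or.inr (hsame x y hxy h1)
  · exact separated_of_ne P h he (hpr' x.1).1 (hpr' y.1).1 (fun h2 => h1 (hpr h2)) (hi x) (hij x)
      rfl rfl (hnode x) (hnode y) (hY x)

end Step

theorem eventually_mul_exp_le (c : ℝ) {a b : ℝ} (h : a < b) :
    ∀ᶠ z : ℝ in Filter.atTop, c * Real.exp (a * z) ≤ Real.exp (b * z) := by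
  have h1 : Filter.Tendsto (fun z : ℝ ↦ Real.exp ((b - a) * z)) Filter.atTop Filter.atTop :=
    Real.tendsto_exp_atTop.comp (Filter.tendsto_id.const_mul_atTop (sub_pos.2 h))
  filter_upwards [h1.eventually_ge_atTop c] with z hz
  calc c * Real.exp (a * z) ≤ Real.exp ((b - a) * z) * Real.exp (a * z) := by gcongr
    _ = Real.exp (b * z) := by rw [← Real.exp_add]; ring_nf

theorem eventually_theta_sub_theta_ge :
    ∀ᶠ H : ℝ in Filter.atTop, H / 2 ≤ Chebyshev.theta (4 * H) - Chebyshev.theta H := by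
  have h4 : Filter.Tendsto (fun H : ℝ ↦ 4 * H) Filter.atTop Filter.atTop :=
    Filter.tendsto_id.const_mul_atTop (by norm_num)
  have h1 := ((isLittleO_log_rpow_atTop (r := 1 / 4) (by norm_num)).comp_tendsto h4).def
    (c := 1) one_pos
  have h2 : Filter.Tendsto (fun H : ℝ ↦ H ^ (1 / 4 : ℝ)) Filter.atTop Filter.atTop :=
    tendsto_rpow_atTop (by norm_num)
  filter_upwards [h1, (h2.comp h4).eventually_ge_atTop 100, Filter.eventually_ge_atTop 1]
    with H hl hH hH1
  have hl2 := Real.log_two_gt_d9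
  have hθ := Chebyshev.theta_ge' (x := 4 * H) (by linarith)
  have hθ' := Chebyshev.theta_le_log4_mul_x (x := H) (by linarith)
  have e4 : Real.log 4 = 2 * Real.log 2 := by
    rw [show (4 : ℝ) = 2 ^ 2 by norm_num, Real.log_pow]; norm_num
  simp only [Function.comp] at hl hH
  set u := (4 * H) ^ (1 / 4 : ℝ) with hu
  have hu4 : u ^ 4 = 4 * H := by
    rw [hu, ← Real.rpow_natCast, ← Real.rpow_mul (by linarith)]; norm_num
  have hu0 : 0 < u := by linarith
  have hs : √(4 * H) = u ^ 2 := by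
    rw [← hu4, show u ^ 4 = (u ^ 2) ^ 2 by ring, Real.sqrt_sq (by positivity)]
  have hlog : Real.log (4 * H) ≤ u := by
    rw [Real.norm_eq_abs, Real.norm_of_nonneg hu0.le, one_mul] at hl
    exact (le_abs_self _).trans hl
  have hlog2 : Real.log (4 * H + 2) ≤ 2 * u := by
    calc Real.log (4 * H + 2) ≤ Real.log ((4 * H) ^ 2) :=
          Real.log_le_log (by linarith) (by nlinarith)
      _ = 2 * Real.log (4 * H) := by rw [Real.log_pow]; norm_num
      _ ≤ _ := by linarith
  have hm : √(4 * H) * Real.log (4 * H) ≤ u ^ 3 := by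
    rw [hs, pow_succ u 2]; gcongr
  have hu3 : u ^ 3 * 100 ≤ u ^ 4 := by
    rw [pow_succ u 3]; gcongr
  have hu1 : u * 1000 ≤ u ^ 3 := by
    have : (1000 : ℝ) ≤ u ^ 2 := by nlinarith
    nlinarith
  rw [e4] at hθ'
  have h5 : H * 0.69 ≤ H * Real.log 2 := by gcongr; linarith
  nlinarith

theorem eventually_exists_primes {a b : ℝ} (ha : 0 < a) (h : a < b) :
    ∀ᶠ z : ℝ in Filter.atTop, ∃ pr : Fin ⌈Real.exp (a * z)⌉₊ → ℕ, Function.Injective pr ∧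
      ∀ i, (pr i).Prime ∧ Real.exp (b * z) < pr i ∧ (pr i : ℝ) ≤ 4 * Real.exp (b * z) := by
  have hb : 0 < b := ha.trans h
  have hH : Filter.Tendsto (fun z : ℝ ↦ Real.exp (b * z)) Filter.atTop Filter.atTop :=
    Real.tendsto_exp_atTop.comp (Filter.tendsto_id.const_mul_atTop hb)
  have h2 := eventually_mul_exp_le (8 * (b / ((b - a) / 2)  + 2)) (a := a + (b - a) / 2) (b := b)
    (by linarith)
  filter_upwards [hH.eventually eventually_theta_sub_theta_ge, h2, Filter.eventually_ge_atTop 0]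
    with z hz hz2 hz0
  set H := Real.exp (b * z) with hHdef
  have hHpos : 0 < H := Real.exp_pos _
  have hH1 : 1 ≤ H := Real.one_le_exp (by positivity)
  set s := (Finset.Ioc ⌊H⌋₊ ⌊4 * H⌋₊).filter Nat.Prime with hs
  have hmem : ∀ p ∈ s, p.Prime ∧ H < p ∧ (p : ℝ) ≤ 4 * H := by
    intro p hp
    simp only [hs, Finset.mem_filter, Finset.mem_Ioc] at hp
    exact ⟨hp.2, (Nat.floor_lt hHpos.le).1 hp.1.1, (Nat.le_floor_iff (by positivity)).1 hp.1.2⟩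
  have hsum : Chebyshev.theta (4 * H) - Chebyshev.theta H = ∑ p ∈ s, Real.log p := by
    rw [Chebyshev.theta, Chebyshev.theta, sub_eq_iff_eq_add, hs, ← Finset.sum_union]
    · congr 1
      ext p
      have : ⌊H⌋₊ ≤ ⌊4 * H⌋₊ := Nat.floor_mono (by linarith)
      simp only [Finset.mem_filter, Finset.mem_Ioc, Finset.mem_union]
      grind
    · rw [Finset.disjoint_left]
      intro p; simp only [Finset.mem_filter, Finset.mem_Ioc]; grind
  have hcard : ∑ p ∈ s, Real.log p ≤ s.card * (b * z + 2) := by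
    rw [← nsmul_eq_mul]
    refine Finset.sum_le_card_nsmul _ _ _ fun p hp ↦ ?_
    have := hmem p hp
    calc Real.log p ≤ Real.log (4 * H) := Real.log_le_log (by linarith) this.2.2
      _ = Real.log 4 + b * z := by
        rw [Real.log_mul (by norm_num) hHpos.ne', hHdef, Real.log_exp]
      _ ≤ _ := by
        have : Real.log 4 = 2 * Real.log 2 := by
          rw [show (4 : ℝ) = 2 ^ 2 by norm_num, Real.log_pow]; norm_num
        linarith [Real.log_two_lt_d9]
  have hle : ⌈Real.exp (a * z)⌉₊ ≤ s.card := by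
    have hE : 1 ≤ Real.exp (a * z) := Real.one_le_exp (by positivity)
    have h3 : (⌈Real.exp (a * z)⌉₊ : ℝ) ≤ 2 * Real.exp (a * z) := by
      linarith [Nat.ceil_lt_add_one (Real.exp_pos (a * z)).le]
    have hd : 0 < (b - a) / 2 := by linarith
    have h4 : b * z + 2 ≤ (b / ((b - a) / 2) + 2) * Real.exp ((b - a) / 2 * z) := by
      have h5 : (b - a) / 2 * z ≤ Real.exp ((b - a) / 2 * z) := by
        linarith [Real.add_one_le_exp ((b - a) / 2 * z)]
      have h6 : 1 ≤ Real.exp ((b - a) / 2 * z) := Real.one_le_exp (by positivity)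
      have h7 : b * z = b / ((b - a) / 2) * ((b - a) / 2 * z) := by
        rw [← mul_assoc, div_mul_cancel₀ _ hd.ne']
      rw [h7, add_mul]
      gcongr
      linarith
    rw [add_mul, Real.exp_add] at hz2
    have h8 : 0 < b * z + 2 := by positivity
    have h9 : (⌈Real.exp (a * z)⌉₊ : ℝ) * (b * z + 2) ≤ s.card * (b * z + 2) := by
      calc _ ≤ 2 * Real.exp (a * z) *
            ((b / ((b - a) / 2) + 2) * Real.exp ((b - a) / 2 * z)) := by gcongr
        _ ≤ H / 2 := by linarith
        _ ≤ _ := by linarith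
    exact_mod_cast le_of_mul_le_mul_right h9 h8
  refine ⟨fun i ↦ s.orderEmbOfFin rfl (Fin.castLE hle i), ?_, fun i ↦ hmem _ (by simp)⟩
  exact (s.orderEmbOfFin rfl).injective.comp (Fin.castLE_injective hle)

section Scales

/-- The size of the slope determinant at the scale `exp z`. -/
noncomputable def scaleR (w η z : ℝ) : ℝ := Real.exp ((w - η ^ 2) * z)

/-- The size of the vertical determinant at the scale `exp z`. -/
noncomputable def scaleν (w η z : ℝ) : ℝ := Real.exp ((1 - w - η ^ 2) * z)

/-- The height of the box around a node at the scale `exp z`. -/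
noncomputable def scaleΥ (w η z : ℝ) : ℝ := Real.exp (-((w + η ^ 2) * (1 + η) + 1) * z)

/-- The width of the box around a node at the scale `exp z`. -/
noncomputable def scaleξ (w η z : ℝ) : ℝ :=
  64 * Real.exp (-((1 - w + η ^ 2) * (1 + η) + 1) * z)

theorem exp_mul_mul_exp_mul (x y z : ℝ) :
    Real.exp (x * z) * Real.exp (y * z) = Real.exp ((x + y) * z) := by
  rw [← Real.exp_add]; ring_nf

theorem half_le_floor {x : ℝ} (hx : 1 ≤ x) : x / 2 ≤ ⌊x⌋₊ := by
  have h1 : (1 : ℝ) ≤ ⌊x⌋₊ := by exact_mod_cast (Nat.one_le_floor_iff x).2 hx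
  linarith [Nat.lt_floor_add_one x]

set_option maxHeartbeats 1000000 in
theorem eventually_stepParams {w η : ℝ} (hη : 0 < η) (hw : 4 * η < w) (hw' : 4 * η < 1 - 2 * w) :
    ∀ᶠ z : ℝ in Filter.atTop, StepParams (Real.exp z) (scaleR w η z) (scaleν w η z)
      (scaleΥ w η z) (Real.exp (η * (1 - w - 2 * η - η ^ 2) * z)) (Real.exp ((1 + η) * z))
      (scaleR w η ((1 + η) * z)) (scaleν w η ((1 + η) * z)) (scaleΥ w η ((1 + η) * z))
      (scaleξ w η z) (scaleξ w η ((1 + η) * z))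
      ⌊Real.exp (η * (w - η ^ 2 - η) * z)⌋₊ (32 * ⌊Real.exp (η * (w - η ^ 2 - η) * z)⌋₊)
      ⌊Real.exp (η * (w + 1 - 2 * η - η ^ 2) * z)⌋₊ := by
  have hη1 : η < 1 / 8 := by linarith
  have hη2 : η ^ 2 < η / 8 := by nlinarith
  have hη3 : 0 < η ^ 2 := by positivity
  set κ := η * (w - η ^ 2 - η) with hκ
  set μ := η * (w + 1 - 2 * η - η ^ 2) with hμ
  have hκ0 : 0 < κ := mul_pos hη (by linarith)
  have hμ0 : 0 < μ := mul_pos hη (by linarith)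
  have e1 := eventually_mul_exp_le 66 (a := (w - η ^ 2) + κ) (b := (w - η ^ 2) * (1 + η))
    (by rw [hκ]; nlinarith)
  have e2 := eventually_mul_exp_le 5 (a := (w - η ^ 2) * (1 + η))
    (b := η * (1 - w - 2 * η - η ^ 2) + (w - η ^ 2)) (by nlinarith)
  have e3 := eventually_mul_exp_le 3072 (a := (1 - w - η ^ 2) + (w - η ^ 2) * (1 + η))
    (b := η * (1 - w - 2 * η - η ^ 2) + 1) (by nlinarith)
  have e4 := eventually_mul_exp_le 512 (a := 1) (b := (1 + η) + κ) (by linarith)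
  have e5 := eventually_mul_exp_le 6144 (a := μ + 1) (b := κ + (1 + η))
    (by rw [hκ, hμ]; nlinarith)
  have e6 := eventually_mul_exp_le 1
    (a := -((w + η ^ 2) * (1 + η) + 1) * (1 + η) + κ + (1 + η))
    (b := 1 + -((w + η ^ 2) * (1 + η) + 1)) (by rw [hκ]; nlinarith [mul_pos hη hη3])
  have e7 := eventually_mul_exp_le 48 (a := κ) (b := μ) (by rw [hκ, hμ]; nlinarith)
  have e8 := eventually_mul_exp_le (2 * 98304) (a := κ + κ + (1 - w - η ^ 2))
    (b := μ + (1 + 1 + -((w + η ^ 2) * (1 + η) + 1))) (by rw [hκ, hμ]; nlinarith)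
  have e9 := eventually_mul_exp_le 24576 (a := 1 + 1 + -((w + η ^ 2) * (1 + η) + 1))
    (b := 1 - w - η ^ 2) (by nlinarith)
  have e10 := eventually_mul_exp_le (4 * (2 * 64 * 32768))
    (a := -((1 - w + η ^ 2) * (1 + η) + 1) + -((w + η ^ 2) * (1 + η) + 1) * (1 + η) + 1
      + (1 + η) + (1 + η)) (b := 0) (by nlinarith [mul_pos hη hη3])
  have e11 := eventually_mul_exp_le (4 * (3 * 64 * 32768))
    (a := -((1 - w + η ^ 2) * (1 + η) + 1) * (1 + η) + -((w + η ^ 2) * (1 + η) + 1) + 1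
      + (1 + η) + (1 + η)) (b := 0) (by nlinarith [mul_pos hη hη3])
  filter_upwards [e1, e2, e3, e4, e5, e6, e7, e8, e9, e10, e11, Filter.eventually_ge_atTop 0]
    with z e1 e2 e3 e4 e5 e6 e7 e8 e9 e10 e11 hz
  have hKle : (⌊Real.exp (κ * z)⌋₊ : ℝ) ≤ Real.exp (κ * z) := Nat.floor_le (Real.exp_pos _).le
  have hKge := half_le_floor (Real.one_le_exp (mul_nonneg hκ0.le hz))
  have hnle : (⌊Real.exp (μ * z)⌋₊ : ℝ) ≤ Real.exp (μ * z) := Nat.floor_le (Real.exp_pos _).le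
  have hnge := half_le_floor (Real.one_le_exp (mul_nonneg hμ0.le hz))
  have hK1 := Real.one_le_exp (mul_nonneg hκ0.le hz)
  have hQ : Real.exp z = Real.exp (1 * z) := by rw [one_mul]
  set K : ℕ := ⌊Real.exp (κ * z)⌋₊ with hK
  set n : ℕ := ⌊Real.exp (μ * z)⌋₊ with hn
  simp only [← exp_mul_mul_exp_mul, zero_mul, Real.exp_zero] at e1 e2 e3 e4 e5 e6 e7 e8 e9 e10 e11
  simp only [exp_mul_mul_exp_mul 1 η] at e4 e5 e6 e10 e11
  simp only [scaleR, scaleν, scaleΥ, scaleξ, hQ, ← mul_assoc]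
  have hEpos : ∀ x : ℝ, 0 < Real.exp x := Real.exp_pos
  exact
  { Q_pos := hEpos _
    R_pos := hEpos _
    ν_pos := hEpos _
    Υ_pos := hEpos _
    H_pos := hEpos _
    Q'_pos := hEpos _
    R'_pos := hEpos _
    K_pos := by rw [hK]; exact Nat.floor_pos.2 hK1
    n_pos := by rw [hn]; exact Nat.floor_pos.2 (Real.one_le_exp (mul_nonneg hμ0.le hz))
    eq_H := by simp only [exp_mul_mul_exp_mul]; ring_nf
    eq_ν := by simp only [exp_mul_mul_exp_mul]; ring_nf
    T_le := by
      push_cast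
      refine le_trans ?_ e1
      have := hEpos ((w - η ^ 2) * z)
      nlinarith
    R'_lt := by
      have := hEpos ((w - η ^ 2) * (1 + η) * z)
      linarith
    ν_mul_le := by linarith
    Q_le := by
      nlinarith [hEpos ((1 + η) * z)]
    n_mul_le := by
      nlinarith [hEpos ((1 + η) * z), hEpos (1 * z)]
    Υ'_mul_lt := by
      have h1 := hEpos (-((w + η ^ 2) * (1 + η) + 1) * (1 + η) * z)
      have h2 := hEpos ((1 + η) * z)
      have h3 := mul_pos (hEpos (1 * z)) (hEpos (-((w + η ^ 2) * (1 + η) + 1) * z))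
      have h4 : Real.exp (-((w + η ^ 2) * (1 + η) + 1) * (1 + η) * z) * K * Real.exp ((1 + η) * z)
          ≤ Real.exp (-((w + η ^ 2) * (1 + η) + 1) * (1 + η) * z) * Real.exp (κ * z)
            * Real.exp ((1 + η) * z) := by gcongr
      linarith
    K_le_T := le_rfl
    K_le_n := by
      have : (24 * K : ℝ) ≤ n := by linarith
      exact_mod_cast this
    sq_K_mul_le := by
      have h2 := mul_pos (mul_pos (hEpos (1 * z)) (hEpos (1 * z)))
        (hEpos (-((w + η ^ 2) * (1 + η) + 1) * z))
      calc 98304 * (K : ℝ) ^ 2 * Real.exp ((1 - w - η ^ 2) * z)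
          ≤ 98304 * Real.exp (κ * z) ^ 2 * Real.exp ((1 - w - η ^ 2) * z) := by gcongr
        _ ≤ Real.exp (μ * z) / 2 * (Real.exp (1 * z) ^ 2 *
            Real.exp (-((w + η ^ 2) * (1 + η) + 1) * z)) := by linarith
        _ ≤ _ := by gcongr
    le_ν := by linarith
    eq_ξ := by
      rw [mul_assoc]
      simp only [exp_mul_mul_exp_mul]; ring_nf
    area_lt := by
      clear e1 e2 e3 e4 e5 e6 e7 e8 e9
      linarith }

end Scales

section Construction

theorem exists_isNode (s : ℝ) {Q R ν : ℝ} (hQ : 1 ≤ Q) (hR : 2 ≤ R) (hν : 2 ≤ ν) :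
    ∃ a b, IsNode s Q R ν a b := by
  obtain ⟨n, hn, hn1, hn2⟩ := Nat.exists_prime_lt_and_le_two_mul ⌈ν⌉₊
    (Nat.ceil_pos.2 (by linarith)).ne'
  have hνn : ν ≤ n := (Nat.le_ceil ν).trans (by exact_mod_cast hn1.le)
  have hnν : (n : ℝ) ≤ 4 * ν := by
    have h1 : (n : ℝ) ≤ 2 * ⌈ν⌉₊ := by exact_mod_cast hn2
    linarith [Nat.ceil_lt_add_one (show 0 ≤ ν by linarith)]
  obtain ⟨m, hm, hm1, hm2⟩ : ∃ m : ℤ, ¬ (n : ℤ) ∣ m ∧ R ≤ m + s * n ∧ m + s * n ≤ 2 * R := by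
    have h1 := Int.le_ceil (R - s * n)
    have h2 := Int.ceil_lt_add_one (R - s * n)
    by_cases hd : (n : ℤ) ∣ ⌈R - s * n⌉
    · refine ⟨⌈R - s * n⌉ + 1, fun h ↦ ?_, by push_cast; linarith, by push_cast; linarith⟩
      have := (Int.dvd_add_right hd).1 h
      exact hn.one_lt.ne' (by exact_mod_cast Int.eq_one_of_dvd_one (by positivity) this)
    · exact ⟨_, hd, by linarith, by linarith⟩
  have hcop : IsCoprime (n : ℤ) m :=
    (Nat.prime_iff_prime_int.1 hn).coprime_iff_not_dvd.2 hm
  obtain ⟨u, v, huv⟩ := hcop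
  have hQc := Int.le_ceil Q
  have hQc' := Int.ceil_lt_add_one Q
  have hslope : slopeDet s ![m, n, ⌈Q⌉] ![0, 0, 1] = -(m + s * n) := by simp [slopeDet]
  have hvert : vertDet ![m, n, ⌈Q⌉] ![0, 0, 1] = -n := by simp [vertDet]
  refine ⟨![0, 0, 1], ![m, n, ⌈Q⌉], ⟨![-u, v, 0], ?_⟩, ?_, ?_, ?_, ?_, ?_, ?_⟩
  · have : tripleDet ![0, 0, 1] ![m, n, ⌈Q⌉] ![-u, v, 0] = 1 := by
      simp [tripleDet]; linarith
    simp [this]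
  · refine le_trans ?_ (le_abs_self _)
    simp; linarith
  · simp only [Matrix.cons_val]
    rw [abs_of_nonneg (by linarith)]; linarith
  · rw [hslope, abs_neg]; exact hm1.trans (le_abs_self _)
  · rw [hslope, abs_neg, abs_of_nonneg (by linarith)]; exact hm2
  · rw [hvert, abs_neg, abs_of_nonneg (by linarith)]; linarith
  · rw [hvert, abs_neg, abs_of_nonneg (by linarith)]; linarith

theorem abs_add_mul_eq_abs_mul_abs_sub_ptX {b : Fin 3 → ℤ} (hb : (b 2 : ℝ) ≠ 0) (s x : ℝ) :
    |b 0 + s * b 1 + x * b 2| = |(b 2 : ℝ)| * |x - ptX s b| := by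
  rw [← abs_mul, ptX]; congr 1; field_simp; ring

theorem abs_add_mul_eq_abs_mul_abs_sub_ptY {b : Fin 3 → ℤ} (hb : (b 2 : ℝ) ≠ 0) (y : ℝ) :
    |b 1 + y * b 2| = |(b 2 : ℝ)| * |y - ptY b| := by
  rw [← abs_mul, ptY]; congr 1; field_simp; ring

theorem inv_prod_le_mul_rpow {a A X η : ℝ} (hA : 0 < A) (ha : 0 < a) (hη : 0 < η) (N : ℕ → ℕ)
    (hN : ∀ j, Real.exp (η * a * (X * (1 + η) ^ j)) ≤ N j) (k : ℕ) {y : ℝ}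
    (hy : Real.exp (-A * (X * (1 + η) ^ (k + 1))) ≤ y) :
    (∏ j ∈ Finset.range k, (N j : ℝ))⁻¹ ≤ Real.exp (a * X) * y ^ (a / (A * (1 + η))) := by
  have h1 : Real.exp (a * X * ((1 + η) ^ k - 1)) ≤ ∏ j ∈ Finset.range k, (N j : ℝ) := by
    have h2 : a * X * ((1 + η) ^ k - 1) = ∑ j ∈ Finset.range k, η * a * (X * (1 + η) ^ j) := by
      rw [← geom_sum_mul (1 + η) k, Finset.sum_mul, Finset.mul_sum]
      exact Finset.sum_congr rfl fun j _ ↦ by ring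
    rw [h2, Real.exp_sum]
    exact Finset.prod_le_prod (fun _ _ ↦ (Real.exp_pos _).le) fun j _ ↦ hN j
  have h3 : Real.exp (-(a * X * (1 + η) ^ k)) ≤ y ^ (a / (A * (1 + η))) := by
    calc Real.exp (-(a * X * (1 + η) ^ k))
        = Real.exp (-A * (X * (1 + η) ^ (k + 1))) ^ (a / (A * (1 + η))) := by
          rw [← Real.exp_mul, pow_succ]; congr 1; field_simp
      _ ≤ _ := Real.rpow_le_rpow (Real.exp_pos _).le hy (by positivity)
  calc (∏ j ∈ Finset.range k, (N j : ℝ))⁻¹ ≤ (Real.exp (a * X * ((1 + η) ^ k - 1)))⁻¹ :=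
        inv_anti₀ (Real.exp_pos _) h1
    _ = Real.exp (a * X) * Real.exp (-(a * X * (1 + η) ^ k)) := by
        rw [← Real.exp_neg, ← Real.exp_add]; ring_nf
    _ ≤ _ := by gcongr

theorem eventually_two_mul_ceil_exp_le_floor {a b : ℝ} (ha : 0 < a) (h : a < b) :
    ∀ᶠ z : ℝ in Filter.atTop, 2 * ⌈Real.exp (a * z)⌉₊ ≤ ⌊Real.exp (b * z)⌋₊ := by
  filter_upwards [eventually_mul_exp_le 4 h, Filter.eventually_ge_atTop 0] with z hz hz0
  refine Nat.le_floor ?_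
  push_cast
  have hE : 1 ≤ Real.exp (a * z) := Real.one_le_exp (by positivity)
  linarith [Nat.ceil_lt_add_one (Real.exp_pos (a * z)).le]

end Construction

section Assembly

theorem scaleξ_pos (w η z : ℝ) : 0 < scaleξ w η z := by unfold scaleξ; positivity

theorem scaleΥ_pos (w η z : ℝ) : 0 < scaleΥ w η z := Real.exp_pos _

theorem eventually_scaleξ_le {w η : ℝ} (hη : 0 < η) (hw : 0 < w) (hw' : w < 1 / 2) :
    ∀ᶠ z : ℝ in Filter.atTop, scaleξ w η z ≤ scaleΥ w η z ∧
      scaleξ w η ((1 + η) * z) ≤ scaleξ w η z / 2 ∧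
      scaleΥ w η ((1 + η) * z) ≤ scaleΥ w η z / 8 := by
  have hη2 : 0 < η ^ 2 := by positivity
  have hA : 0 < (1 - w + η ^ 2) * (1 + η) + 1 := by
    have : 0 < 1 - w := by linarith
    positivity
  have hB : 0 < (w + η ^ 2) * (1 + η) + 1 := by positivity
  have e1 := eventually_mul_exp_le 64 (a := -((1 - w + η ^ 2) * (1 + η) + 1))
    (b := -((w + η ^ 2) * (1 + η) + 1)) (by nlinarith)
  have e2 := eventually_mul_exp_le 2 (a := -((1 - w + η ^ 2) * (1 + η) + 1) * (1 + η))
    (b := -((1 - w + η ^ 2) * (1 + η) + 1)) (by nlinarith)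
  have e3 := eventually_mul_exp_le 8 (a := -((w + η ^ 2) * (1 + η) + 1) * (1 + η))
    (b := -((w + η ^ 2) * (1 + η) + 1)) (by nlinarith)
  filter_upwards [e1, e2, e3] with z h1 h2 h3
  refine ⟨h1, ?_, ?_⟩
  · rw [scaleξ, scaleξ, ← mul_assoc]; linarith
  · rw [scaleΥ, scaleΥ, ← mul_assoc]; linarith

theorem eventually_three_le {w η δ : ℝ} (hη : 0 < η) (hw : 0 < w) (hw' : w < 1 / 2)
    (hδ : 0 < δ) :
    ∀ᶠ z : ℝ in Filter.atTop,
      32 * Real.exp z * Real.exp (-((1 + η ^ 2 / 2) * z)) < δ ∧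
      32 * Real.exp z * scaleξ w η z *
        Real.exp ((1 - w) * ((1 + η ^ 2 / 2) * ((1 + η) * z))) < δ ∧
      32 * Real.exp z * scaleΥ w η z *
        Real.exp (w * ((1 + η ^ 2 / 2) * ((1 + η) * z))) < δ := by
  have hη2 : 0 < η ^ 2 := by positivity
  have h1η : 0 < 1 + η := by linarith
  have e1 := eventually_mul_exp_le (64 * 64 / δ) (a := 1 + -(1 + η ^ 2 / 2)) (b := 0)
    (by linarith)
  have e2 := eventually_mul_exp_le (64 * 64 / δ)
    (a := 1 + -((1 - w + η ^ 2) * (1 + η) + 1) + (1 - w) * ((1 + η ^ 2 / 2) * (1 + η)))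
    (b := 0) (by
      have : 0 < (1 + η) * (η ^ 2 * (1 + w)) := by positivity
      linarith)
  have e3 := eventually_mul_exp_le (64 * 64 / δ)
    (a := 1 + -((w + η ^ 2) * (1 + η) + 1) + w * ((1 + η ^ 2 / 2) * (1 + η)))
    (b := 0) (by
      have : 0 < (1 + η) * (η ^ 2 * (2 - w)) := by
        have : 0 < 2 - w := by linarith
        positivity
      linarith)
  have key : ∀ x : ℝ, 64 * 64 / δ * x ≤ 1 → 64 * 64 * x ≤ δ := by
    intro x hx
    rw [div_mul_eq_mul_div, div_le_one hδ] at hx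
    exact hx
  filter_upwards [e1, e2, e3] with z h1 h2 h3
  simp only [zero_mul, Real.exp_zero] at h1 h2 h3
  replace h1 := key _ h1
  replace h2 := key _ h2
  replace h3 := key _ h3
  have p1 := Real.exp_pos ((1 + -(1 + η ^ 2 / 2)) * z)
  have p2 := Real.exp_pos ((1 + -((1 - w + η ^ 2) * (1 + η) + 1)
    + (1 - w) * ((1 + η ^ 2 / 2) * (1 + η))) * z)
  have p3 := Real.exp_pos ((1 + -((w + η ^ 2) * (1 + η) + 1)
    + w * ((1 + η ^ 2 / 2) * (1 + η))) * z)
  refine ⟨?_, ?_, ?_⟩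
  · calc _ = 32 * Real.exp ((1 + -(1 + η ^ 2 / 2)) * z) := by
          rw [mul_assoc, ← Real.exp_add]; ring_nf
      _ < δ := by linarith
  · calc _ = 32 * 64 * Real.exp ((1 + -((1 - w + η ^ 2) * (1 + η) + 1)
          + (1 - w) * ((1 + η ^ 2 / 2) * (1 + η))) * z) := by
          simp only [← exp_mul_mul_exp_mul _ ((1 - w) * ((1 + η ^ 2 / 2) * (1 + η))),
            ← exp_mul_mul_exp_mul 1, scaleξ]
          ring_nf
      _ < δ := by linarith
  · calc _ = 32 * Real.exp ((1 + -((w + η ^ 2) * (1 + η) + 1)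
          + w * ((1 + η ^ 2 / 2) * (1 + η))) * z) := by
          simp only [← exp_mul_mul_exp_mul _ (w * ((1 + η ^ 2 / 2) * (1 + η))),
            ← exp_mul_mul_exp_mul 1, scaleΥ]
          ring_nf
      _ < δ := by linarith

/-- Points that stay close to the points attached to a sequence of nodes are divergent. -/
theorem mem_divergentPoints_of_isNode {w η s X : ℝ} (hη : 0 < η) (hw : 0 < w)
    (hw' : w < 1 / 2) (hX : 0 < X) (v : ℕ → (Fin 3 → ℤ) × (Fin 3 → ℤ))
    (hv : ∀ k, IsNode s (Real.exp (X * (1 + η) ^ k)) (scaleR w η (X * (1 + η) ^ k))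
      (scaleν w η (X * (1 + η) ^ k)) (v k).1 (v k).2) {q : ℝ × ℝ}
    (hq : ∀ k, |q.1 - ptX s (v k).2| ≤ scaleξ w η (X * (1 + η) ^ k) ∧
      |q.2 - ptY (v k).2| ≤ scaleΥ w η (X * (1 + η) ^ k)) :
    q ∈ divergentPoints (1 - w) w s := by
  intro δ hδ
  have hη2 : 0 < 1 + η ^ 2 / 2 := by positivity
  have h1η : 1 < 1 + η := by linarith
  obtain ⟨Z, hZ⟩ := Filter.eventually_atTop.1 (eventually_three_le hη hw hw' hδ)
  obtain ⟨k₀, hk₀⟩ := pow_unbounded_of_one_lt (Z / X) h1η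
  have hZk : ∀ k, k₀ ≤ k → Z ≤ X * (1 + η) ^ k := by
    intro k hk
    have := pow_le_pow_right₀ h1η.le hk
    rw [div_lt_iff₀' hX] at hk₀
    nlinarith
  have hXη : 0 < (1 + η ^ 2 / 2) * X := by positivity
  refine ⟨(1 + η ^ 2 / 2) * X * (1 + η) ^ k₀, by positivity, fun t ht ↦ ?_⟩
  have ht1 : (1 + η) ^ k₀ ≤ t / ((1 + η ^ 2 / 2) * X) := by
    rw [le_div_iff₀ hXη]; linarith
  obtain ⟨k, hk1, hk2⟩ := exists_nat_pow_near ((one_le_pow₀ h1η.le).trans ht1) h1η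
  have hkk : k₀ ≤ k := by
    have := (pow_lt_pow_iff_right₀ h1η).1 (ht1.trans_lt hk2)
    omega
  rw [le_div_iff₀ hXη] at hk1
  rw [div_lt_iff₀ hXη] at hk2
  obtain ⟨h1, h2, h3⟩ := hZ _ (hZk k hkk)
  have hz1 : (1 + η ^ 2 / 2) * (X * (1 + η) ^ k) ≤ t := by linarith
  have hz2 : t ≤ (1 + η ^ 2 / 2) * ((1 + η) * (X * (1 + η) ^ k)) := by
    rw [pow_succ] at hk2; linarith
  obtain ⟨hq1, hq2⟩ := hq k
  have hn := hv k
  set z := X * (1 + η) ^ k with hz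
  set b := (v k).2
  have hb : (b 2 : ℝ) ≠ 0 := by
    have := hn.le_abs_two
    have := Real.exp_pos z
    exact abs_pos.1 (by linarith)
  refine ⟨b, fun h ↦ hb (by simp [h]), lt_of_le_of_lt ?_ h2, lt_of_le_of_lt ?_ h3,
    lt_of_le_of_lt ?_ h1⟩
  · rw [abs_add_mul_eq_abs_mul_abs_sub_ptX hb]
    have := hn.abs_two_le
    have h1w : 0 < 1 - w := by linarith
    have : 0 < scaleξ w η z := scaleξ_pos w η z
    gcongr
  · rw [abs_add_mul_eq_abs_mul_abs_sub_ptY hb]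
    have := hn.abs_two_le
    have : 0 < scaleΥ w η z := scaleΥ_pos w η z
    gcongr
  · have := hn.abs_two_le
    gcongr

theorem hausdorffMeasure_divergentPoints_ne_zero {w η : ℝ} (hη : 0 < η) (hw : 4 * η < w)
    (hw' : 4 * η < 1 - 2 * w) (s : ℝ) :
    μH[(1 - w - 3 * η) / (((1 - w + η ^ 2) * (1 + η) + 1) * (1 + η)) +
      (1 + w - 4 * η) / (((w + η ^ 2) * (1 + η) + 1) * (1 + η))]
      (divergentPoints (1 - w) w s) ≠ 0 := by
  have hw0 : 0 < w := by linarith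
  have hw2 : w < 1 / 2 := by linarith
  have hη2 : η ^ 2 < η / 8 := by nlinarith
  have hp : 0 < 1 - w - 3 * η := by linarith
  have hm : 0 < 1 + w - 4 * η := by linarith
  have hA : 0 < (1 - w + η ^ 2) * (1 + η) + 1 := by
    have : 0 < 1 - w := by linarith
    positivity
  have hB : 0 < (w + η ^ 2) * (1 + η) + 1 := by positivity
  have tend : ∀ c : ℝ, 0 < c → ∀ᶠ z : ℝ in Filter.atTop, 2 ≤ Real.exp (c * z) := fun c hc ↦
    (Real.tendsto_exp_atTop.comp (Filter.tendsto_id.const_mul_atTop hc)).eventually_ge_atTop 2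
  have hev := (((((eventually_stepParams hη hw hw').and (eventually_scaleξ_le hη hw0 hw2)).and
    (eventually_exists_primes (a := η * (1 - w - 3 * η)) (b := η * (1 - w - 2 * η - η ^ 2))
      (by positivity) (by nlinarith))).and
    (eventually_two_mul_ceil_exp_le_floor (a := η * (1 + w - 4 * η))
      (b := η * (w + 1 - 2 * η - η ^ 2)) (by positivity) (by nlinarith))).and
    (tend (w - η ^ 2) (by linarith))).and (tend (1 - w - η ^ 2) (by linarith))
  obtain ⟨X, hX'⟩ := Filter.eventually_atTop.1 (hev.and (Filter.eventually_gt_atTop 0))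
  have hX0 : 0 < X := (hX' X le_rfl).2
  have hX := fun z hz ↦ (hX' z hz).1
  have hXk : ∀ k : ℕ, X ≤ X * (1 + η) ^ k := fun k ↦
    le_mul_of_one_le_right hX0.le (one_le_pow₀ (by linarith))
  have hsucc : ∀ k : ℕ, X * (1 + η) ^ (k + 1) = (1 + η) * (X * (1 + η) ^ k) := fun k ↦ by ring
  let V : ℕ → Type := fun k ↦ {ab : (Fin 3 → ℤ) × (Fin 3 → ℤ) //
    IsNode s (Real.exp (X * (1 + η) ^ k)) (scaleR w η (X * (1 + η) ^ k))
      (scaleν w η (X * (1 + η) ^ k)) ab.1 ab.2}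
  let P : ℕ → ℕ := fun k ↦ ⌈Real.exp (η * (1 - w - 3 * η) * (X * (1 + η) ^ k))⌉₊
  let M : ℕ → ℕ := fun k ↦ ⌈Real.exp (η * (1 + w - 4 * η) * (X * (1 + η) ^ k))⌉₊
  let ξ : ℕ → ℝ := fun k ↦ scaleξ w η (X * (1 + η) ^ k)
  let Υ : ℕ → ℝ := fun k ↦ scaleΥ w η (X * (1 + η) ^ k)
  have hstep : ∀ k (v : V k), ∃ c : Fin (P k) × Fin (M k) → V (k + 1),
      (∀ i, |ptX s (c i).1.2 - ptX s v.1.2| ≤ ξ k / 2) ∧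
      (∀ i, |ptY (c i).1.2 - ptY v.1.2| ≤ 3 / 4 * Υ k) ∧
      (∀ i j, i ≠ j → 4 * ξ (k + 1) < |ptX s (c i).1.2 - ptX s (c j).1.2| ∨
        4 * Υ (k + 1) < |ptY (c i).1.2 - ptY (c j).1.2|) ∧
      ∀ i j, i ≠ j → i.1 = j.1 → 4 * Υ (k + 1) < |ptY (c i).1.2 - ptY (c j).1.2| := by
    intro k v
    obtain ⟨⟨⟨⟨⟨hP, -⟩, pr, hpr, hpr'⟩, hM⟩, -⟩, -⟩ := hX _ (hXk k)
    simp only [ξ, Υ, V, hsucc]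
    obtain ⟨c, hc, h1, h2, h3, h4⟩ := IsNode.exists_children hP v.2 pr hpr hpr' hM
    exact ⟨fun i ↦ ⟨(v.1.2, c i), by simpa only [hsucc] using hc i⟩, h1, h2, h3, h4⟩
  choose child hcX hcY hcs hcs' using hstep
  have hroot : Nonempty (V 0) := by
    obtain ⟨⟨-, hR⟩, hν⟩ := hX _ (hXk 0)
    obtain ⟨a, b, h⟩ := exists_isNode s (Real.one_le_exp (hX0.le.trans (hXk 0))) hR hν
    exact ⟨⟨(a, b), h⟩⟩
  obtain ⟨root⟩ := hroot
  refine hausdorffMeasure_ne_zero_of_tree (V := V) (p := P) (m := M) root child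
    (fun k ↦ Nat.ceil_pos.2 (Real.exp_pos _)) (fun k ↦ Nat.ceil_pos.2 (Real.exp_pos _))
    (fun k v ↦ ptX s v.1.2) (fun k v ↦ ptY v.1.2) (ξ := ξ) (Υ := Υ)
    (fun _ ↦ scaleξ_pos _ _ _)
    (fun k ↦ (hX _ (hXk k)).1.1.1.1.2.1)
    (fun k ↦ by simp only [ξ, hsucc]; exact (hX _ (hXk k)).1.1.1.1.2.2.1)
    (fun k ↦ by simp only [Υ, hsucc]; exact (hX _ (hXk k)).1.1.1.1.2.2.2)
    hcX hcY hcs hcs' (C := Real.exp (2 * X)) (Real.exp_pos _) (by positivity) (by positivity)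
    (fun k ↦ ?_) (fun k ↦ ?_) fun v q hq ↦
      mem_divergentPoints_of_isNode hη hw0 hw2 hX0 (fun k ↦ (v k).1) (fun k ↦ (v k).2) hq
  · refine (inv_prod_le_mul_rpow hA hp hη P (fun j ↦ Nat.le_ceil _) k (y := ξ (k + 1)) ?_).trans ?_
    · simp only [ξ, scaleξ]
      linarith [Real.exp_pos (-((1 - w + η ^ 2) * (1 + η) + 1) * (X * (1 + η) ^ (k + 1)))]
    · have : 0 < ξ (k + 1) := scaleξ_pos _ _ _
      gcongr
      linarith
  · refine (inv_prod_le_mul_rpow hB hm hη M (fun j ↦ Nat.le_ceil _) k (y := Υ (k + 1)) le_rfl).trans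
      ?_
    have : 0 < Υ (k + 1) := scaleΥ_pos _ _ _
    gcongr
    linarith

theorem lt_dimH_divergentPoints {w : ℝ} (hw : 0 < w) (hw' : w < 1 / 2) {d : NNReal}
    (hd : (d : ℝ) < 2 - 1 / (2 - w)) (s : ℝ) :
    (d : ENNReal) < dimH (divergentPoints (1 - w) w s) := by
  let f : ℝ → ℝ := fun η ↦ (1 - w - 3 * η) / (((1 - w + η ^ 2) * (1 + η) + 1) * (1 + η)) +
    (1 + w - 4 * η) / (((w + η ^ 2) * (1 + η) + 1) * (1 + η))
  have hf : ContinuousAt f 0 := by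
    refine ContinuousAt.add (ContinuousAt.div (by fun_prop) (by fun_prop) ?_)
      (ContinuousAt.div (by fun_prop) (by fun_prop) ?_)
    · norm_num; linarith
    · norm_num; linarith
  have hf0 : f 0 = 2 - 1 / (2 - w) := by
    have h1 : 2 - w ≠ 0 := by linarith
    have h2 : 1 - w + 1 ≠ 0 := by linarith
    have h3 : w + 1 ≠ 0 := by linarith
    simp only [f]
    norm_num
    field_simp
    ring
  have h1 : ∀ᶠ η in nhdsWithin (0 : ℝ) (Set.Ioi 0), (d : ℝ) < f η :=
    (hf.eventually (lt_mem_nhds (hf0 ▸ hd))).filter_mono nhdsWithin_le_nhds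
  have h2 : ∀ᶠ η in nhdsWithin (0 : ℝ) (Set.Ioi 0), η < min (w / 4) ((1 - 2 * w) / 4) :=
    (gt_mem_nhds (lt_min (by linarith) (by linarith))).filter_mono nhdsWithin_le_nhds
  obtain ⟨η, ⟨hη1, hη2⟩, hη⟩ := ((h1.and h2).and self_mem_nhdsWithin).exists
  rw [lt_min_iff] at hη2
  obtain ⟨σ, hσ⟩ : ∃ σ : NNReal, (σ : ℝ) = f η :=
    ⟨(f η).toNNReal, Real.coe_toNNReal _ (d.2.trans hη1.le)⟩
  have h3 : μH[f η] (divergentPoints (1 - w) w s) ≠ 0 :=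
    hausdorffMeasure_divergentPoints_ne_zero hη (by linarith [hη2.1]) (by linarith [hη2.2]) s
  rw [← hσ] at h3 hη1
  exact (ENNReal.coe_lt_coe.2 (NNReal.coe_lt_coe.1 hη1)).trans_le
    (le_dimH_of_hausdorffMeasure_ne_zero h3)

end Assembly

/-- For a weight `w = (w₁,w₂)` with `w₁ > w₂ > 0` and `w₁ + w₂ = 1`, the set of
matrices `g ∈ SL₃(ℝ)`, viewed inside the 9-dimensional Euclidean space of 3×3 real
matrices, whose trajectory `{aₜ g ℤ³ : t ≥ 0}` is divergent (in the Mahler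
compactness criterion form) has Hausdorff dimension at least `8 - 1/(1+w₁)`. -/
theorem dimH_divergent_matrices (w₁ w₂ : ℝ) (hw₂ : 0 < w₂) (hw : w₂ < w₁)
    (hsum : w₁ + w₂ = 1) :
    ENNReal.ofReal (8 - 1 / (1 + w₁)) ≤
      dimH {m : EuclideanSpace ℝ (Fin 3 × Fin 3) |
        (Matrix.of fun i j => m (i, j)).det = 1 ∧
        ∀ δ : ℝ, 0 < δ → ∃ T : ℝ, 0 ≤ T ∧ ∀ t : ℝ, T ≤ t →
          ∃ c : Fin 3 → ℤ, c ≠ 0 ∧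
            ‖(WithLp.equiv 2 (Fin 3 → ℝ)).symm
              ((aMat w₁ w₂ t * Matrix.of fun i j => m (i, j)).mulVec
                (fun i => (c i : ℝ)))‖ < δ} := by
  obtain rfl : w₁ = 1 - w₂ := by linarith
  have h1 : 1 / (2 - w₂) < 1 := by rw [div_lt_one (by linarith)]; linarith
  have h2 : 1 + (1 - w₂) = 2 - w₂ := by ring
  rw [h2]
  refine le_of_forall_lt fun c hc ↦ ?_
  lift c to NNReal using hc.ne_top
  rw [ENNReal.lt_ofReal_iff_toReal_lt ENNReal.coe_ne_top, ENNReal.coe_toReal] at hc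
  obtain ⟨d, hd1, hd2⟩ := exists_between
    (show max ((c : ℝ) - 6) 0 < 2 - 1 / (2 - w₂) from max_lt (by linarith) (by linarith))
  rw [max_lt_iff] at hd1
  lift d to NNReal using hd1.2.le
  have h3 : c < d + 6 := by
    rw [← NNReal.coe_lt_coe]; push_cast; linarith [hd1.1]
  calc (c : ENNReal) < d + 6 := by exact_mod_cast h3
    _ ≤ _ := add_six_le_dimH_of_lt_dimH_divergentPoints hw₂ hw (by exact_mod_cast hd1.2)
      (lt_dimH_divergentPoints hw₂ (by linarith) hd2)
end

section
/- Let (𝒯,β) be a regular self-affine structure on ℝ² with sequences (W_n), (L_n), (ρ_n), (C_n) satisfying conditions (1)–(3) of the lower-bound theorem for self-affine structures. Assume there exist k, n₀ ∈ ℕ such that for all n ≥ n₀: e^{n/k} ≤ C_n ≤ e^{kn}; ρ_n ≥ e^{−nk}; ρ_n C_n L_n / L_{n−1} ≥ n^{−k}; and L_{kn}/L_{kn−1} ≤ W_n/W_{n−1}; and that L_{k n₀ − 1} < W_{n₀ − 1}. If the limit lim_{n→∞} log(L_n C_n / L_{n−1}) / (−log(W_n/W_{n−1})) exists and equals r > 0,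 then the Hausdorff dimension of ℱ(𝒯,β) is at least 1 + r. -/
open MeasureTheory Filter

/-- A rooted tree, described by its set of vertices, a root, a parent map and a
height function.  Every vertex of height `n+1` has a parent of height `n`, and the
root is the unique vertex of height `0`; hence every vertex is joined to the root by
a unique path. -/
structure FractalTree where
  V : Type
  root : V
  parent : V → V
  height : V → ℕ
  parent_root : parent root = root
  height_root : height root = 0
  eq_root_of_height_eq_zero : ∀ v, height v = 0 → v = root
  height_eq : ∀ v, v ≠ root → height v = height (parent v) + 1

/-- The set of sons of a vertex. -/
def FractalTree.sons (T : FractalTree) (τ : T.V) : Set T.V :=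
  {v | v ≠ T.root ∧ T.parent v = τ}

/-- A boundary point of the tree: a sequence of vertices each of which is a son of
the previous one. -/
def FractalTree.IsBoundary (T : FractalTree) (τ : ℕ → T.V) : Prop :=
  ∀ n, τ (n + 1) ∈ T.sons (τ n)

/-- `S` is a closed axis-parallel rectangle in `ℝ²` of width `w` and height `l`. -/
def IsRectangle (S : Set (EuclideanSpace ℝ (Fin 2))) (w l : ℝ) : Prop :=
  ∃ a b : ℝ, S = {x | x 0 ∈ Set.Icc a (a + w) ∧ x 1 ∈ Set.Icc b (b + l)}

/-- The fractal set associated to a fractal structure `(T, β)`. -/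
def Fractal (T : FractalTree) (β : T.V → Set (EuclideanSpace ℝ (Fin 2))) :
    Set (EuclideanSpace ℝ (Fin 2)) :=
  {y | ∃ τ : ℕ → T.V, T.IsBoundary τ ∧ ∀ n, y ∈ β (τ n)}

/-- Regularity of a fractal structure: every vertex has a son, the sets are nested
along the tree, and the diameters tend to zero along every boundary point. -/
def IsRegularStructure (T : FractalTree) (β : T.V → Set (EuclideanSpace ℝ (Fin 2))) : Prop :=
  (∀ τ : T.V, (T.sons τ).Nonempty) ∧
  (∀ v : T.V, v ≠ T.root → β v ⊆ β (T.parent v)) ∧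
  (∀ τ : ℕ → T.V, T.IsBoundary τ →
    Tendsto (fun n => Metric.diam (β (τ n))) atTop (nhds 0))

open ProbabilityTheory in
theorem uniformOn_Iio_isProbabilityMeasure {N : ℕ} (hN : 0 < N) :
    IsProbabilityMeasure (uniformOn (Set.Iio N)) :=
  isProbabilityMeasure_uniformOn (Set.finite_Iio N) ⟨0, hN⟩

open ProbabilityTheory in
theorem uniformOn_Iio_singleton_le (N i : ℕ) :
    uniformOn (Set.Iio N) {i} ≤ (N : ENNReal)⁻¹ := by
  rw [uniformOn, cond_apply measurableSet_Iio,
    Measure.count_apply_finite _ (Set.finite_Iio N)]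
  have h1 : (Measure.count (Set.Iio N ∩ {i}) : ENNReal) ≤ 1 :=
    (measure_mono Set.inter_subset_right).trans (Measure.count_singleton i).le
  have h2 : (Set.finite_Iio N).toFinset.card = N := by
    have : (Set.finite_Iio N).toFinset = Finset.Iio N := by ext; simp
    rw [this, Nat.card_Iio]
  rw [h2]
  calc _ ≤ (N : ENNReal)⁻¹ * 1 := by gcongr
    _ = _ := mul_one _

/-- The list of the first `n` terms of `ω`, most recent first. -/
def firstTerms (ω : ℕ → ℕ) : ℕ → List ℕ
  | 0 => []
  | n + 1 => ω n :: firstTerms ω n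

theorem firstTerms_eq_iff (ω ω' : ℕ → ℕ) (n : ℕ) :
    firstTerms ω n = firstTerms ω' n ↔ ∀ j < n, ω j = ω' j := by
  induction n with
  | zero => simp [firstTerms]
  | succ n ih =>
    simp only [firstTerms, List.cons.injEq, ih]
    constructor
    · rintro ⟨h, h'⟩ j hj
      rcases Nat.lt_succ_iff_lt_or_eq.1 hj with h1 | rfl
      exacts [h' j h1, h]
    · exact fun h => ⟨h n (by lia), fun j hj => h j (by lia)⟩

theorem measurableSet_firstTerms_eq (n : ℕ) (l : List ℕ) :
    MeasurableSet {ω : ℕ → ℕ | firstTerms ω n = l} := by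
  induction n generalizing l with
  | zero => simp [firstTerms]
  | succ n ih =>
    cases l with
    | nil => simp [firstTerms]
    | cons a l =>
      simp only [firstTerms, List.cons.injEq]
      exact (measurable_pi_apply n (measurableSet_singleton a)).inter (ih l)

theorem measurable_comp_firstTerms {X : Type*} [MeasurableSpace X] (f : List ℕ → X) (n : ℕ) :
    Measurable fun ω : ℕ → ℕ => f (firstTerms ω n) := by
  intro S _
  have : (fun ω : ℕ → ℕ => f (firstTerms ω n)) ⁻¹' S =
      ⋃ l ∈ f ⁻¹' S, {ω | firstTerms ω n = l} := by
    ext ω; simp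
  rw [this]
  exact MeasurableSet.biUnion (Set.to_countable _) fun l _ => measurableSet_firstTerms_eq n l

open ProbabilityTheory in
/-- The law of a sequence of independent uniform choices, the `j`-th one among `N j` values. -/
noncomputable def choiceMeasure (N : ℕ → ℕ) : Measure (ℕ → ℕ) :=
  Measure.infinitePi fun j => uniformOn (Set.Iio (N j))

theorem choiceMeasure_firstTerms_le {N : ℕ → ℕ} (hN : ∀ j, 0 < N j) (m : ℕ) (l : List ℕ) :
    choiceMeasure N {ω | firstTerms ω m = l} ≤ ∏ j ∈ Finset.range m, (N j : ENNReal)⁻¹ := by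
  have _ := fun j => uniformOn_Iio_isProbabilityMeasure (hN j)
  by_cases h : ∃ ω₀, firstTerms ω₀ m = l
  · obtain ⟨ω₀, rfl⟩ := h
    have : {ω | firstTerms ω m = firstTerms ω₀ m} ⊆
        Set.pi (Finset.range m) fun j => ({ω₀ j} : Set ℕ) := by
      intro ω hω j hj
      exact (firstTerms_eq_iff _ _ _).1 hω j (by simpa using hj)
    refine (measure_mono this).trans ?_
    rw [choiceMeasure, Measure.infinitePi_pi _ fun j _ => measurableSet_singleton _]
    exact Finset.prod_le_prod' fun j _ => uniformOn_Iio_singleton_le _ _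
  · have : {ω | firstTerms ω m = l} = ∅ := by
      ext ω; simpa using fun h' => h ⟨ω, h'⟩
    rw [this]; simp

theorem choiceMeasure_ae_lt {N : ℕ → ℕ} (hN : ∀ j, 0 < N j) :
    ∀ᵐ ω ∂choiceMeasure N, ∀ j, ω j < N j := by
  have _ := fun j => uniformOn_Iio_isProbabilityMeasure (hN j)
  refine ae_all_iff.2 fun j => ?_
  have h := measurePreserving_eval_infinitePi
    (fun j => ProbabilityTheory.uniformOn (Set.Iio (N j))) j
  refine h.quasiMeasurePreserving.ae (p := fun i => i < N j) ?_
  rw [ae_iff, ProbabilityTheory.uniformOn_eq_zero_iff (Set.finite_Iio _)]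
  ext i; simp

/-- The vertex reached from `v₀` by following the choices in a list. -/
def branch {V : Type*} (e : V → ℕ → V) (v₀ : V) : List ℕ → V
  | [] => v₀
  | i :: l => e (branch e v₀ l) i

/-- If at each step `j` at most a proportion `κ j` of the choices leads to a vertex in `G`,
then a random branch stays in `G` for `m` steps with probability at most `∏ κ j`. -/
theorem choiceMeasure_branch_mem_le {V : Type*} (e : V → ℕ → V) (v₀ : V) {N : ℕ → ℕ}
    (hN : ∀ j, 0 < N j) (G : Set V) (κ : ℕ → ℝ) (hκ : ∀ j, 0 ≤ κ j) (m : ℕ)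
    (h : ∀ j < m, ∀ ω, ∀ F : Finset ℕ, (∀ i ∈ F, i < N j) →
      (∀ i ∈ F, e (branch e v₀ (firstTerms ω j)) i ∈ G) → (F.card : ℝ) ≤ κ j * N j) :
    choiceMeasure N {ω | ∀ j, branch e v₀ (firstTerms ω j) ∈ G} ≤
      ENNReal.ofReal (∏ j ∈ Finset.range m, κ j) := by
  classical
  obtain ⟨A, hA, hcard⟩ : ∃ A : Finset (List ℕ),
      (∀ ω : ℕ → ℕ, (∀ j, ω j < N j) → (∀ j, branch e v₀ (firstTerms ω j) ∈ G) →
        firstTerms ω m ∈ A) ∧ (A.card : ℝ) ≤ ∏ j ∈ Finset.range m, κ j * N j := by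
    induction m with
    | zero => exact ⟨{[]}, by simp [firstTerms], by simp⟩
    | succ m ih =>
      obtain ⟨A, hA, hcard⟩ := ih fun j hj => h j (by lia)
      set A' := A.filter fun l => ∃ ω, firstTerms ω m = l with hA'
      set F : List ℕ → Finset ℕ := fun l =>
        (Finset.range (N m)).filter fun i => e (branch e v₀ l) i ∈ G with hF
      refine ⟨A'.biUnion fun l => (F l).image fun i => i :: l, ?_, ?_⟩
      · intro ω h1 h2
        have := h2 (m + 1)
        simp only [firstTerms, branch] at this
        simp only [Finset.mem_biUnion, Finset.mem_image, firstTerms]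
        exact ⟨firstTerms ω m, by simp [hA', hA ω h1 h2], ω m, by simp [hF, h1, this], rfl⟩
      · have h1 : (A'.biUnion fun l => (F l).image fun i => i :: l).card ≤
            ∑ l ∈ A', (F l).card :=
          Finset.card_biUnion_le.trans (Finset.sum_le_sum fun _ _ => Finset.card_image_le)
        calc ((A'.biUnion fun l => (F l).image fun i => i :: l).card : ℝ)
            ≤ ∑ l ∈ A', ((F l).card : ℝ) := by exact_mod_cast h1
          _ ≤ ∑ l ∈ A', κ m * N m := by
            refine Finset.sum_le_sum fun l hl => ?_
            obtain ⟨ω, rfl⟩ := (Finset.mem_filter.1 hl).2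
            exact h m (by lia) ω _ (by simp +contextual [hF]) (by simp [hF])
          _ = A'.card * (κ m * N m) := by simp
          _ ≤ A.card * (κ m * N m) := by
            have := hκ m
            gcongr
            exact Finset.filter_subset _ _
          _ ≤ _ := by
            rw [Finset.prod_range_succ]
            have := hκ m
            gcongr
  have hsub : {ω | ∀ j, branch e v₀ (firstTerms ω j) ∈ G} ≤ᵐ[choiceMeasure N]
      (⋃ l ∈ A, {ω | firstTerms ω m = l} : Set (ℕ → ℕ)) := by
    filter_upwards [choiceMeasure_ae_lt hN] with ω h1 h2
    exact Set.mem_biUnion (hA ω h1 h2) rfl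
  calc choiceMeasure N {ω | ∀ j, branch e v₀ (firstTerms ω j) ∈ G}
      ≤ choiceMeasure N (⋃ l ∈ A, {ω | firstTerms ω m = l}) := measure_mono_ae hsub
    _ ≤ ∑ l ∈ A, choiceMeasure N {ω | firstTerms ω m = l} := measure_biUnion_finset_le _ _
    _ ≤ ∑ l ∈ A, ∏ j ∈ Finset.range m, (N j : ENNReal)⁻¹ :=
      Finset.sum_le_sum fun l _ => choiceMeasure_firstTerms_le hN m l
    _ = A.card * ENNReal.ofReal (∏ j ∈ Finset.range m, (N j : ℝ)⁻¹) := by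
      rw [ENNReal.ofReal_prod_of_nonneg fun j _ => by positivity]
      simp only [Finset.sum_const, nsmul_eq_mul]
      congr 1
      refine Finset.prod_congr rfl fun j _ => ?_
      rw [ENNReal.ofReal_inv_of_pos (by exact_mod_cast hN j), ENNReal.ofReal_natCast]
    _ = ENNReal.ofReal (A.card * ∏ j ∈ Finset.range m, (N j : ℝ)⁻¹) := by
      rw [ENNReal.ofReal_mul (by positivity), ENNReal.ofReal_natCast]
    _ ≤ _ := by
      refine ENNReal.ofReal_le_ofReal ?_
      calc (A.card : ℝ) * ∏ j ∈ Finset.range m, (N j : ℝ)⁻¹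
          ≤ (∏ j ∈ Finset.range m, κ j * N j) * ∏ j ∈ Finset.range m, (N j : ℝ)⁻¹ := by
            gcongr
        _ = _ := by
          rw [← Finset.prod_mul_distrib]
          refine Finset.prod_congr rfl fun j _ => ?_
          have : (N j : ℝ) ≠ 0 := by exact_mod_cast (hN j).ne'
          field_simp

theorem FractalTree.height_of_mem_sons {T : FractalTree} {τ v : T.V} (h : v ∈ T.sons τ) :
    T.height v = T.height τ + 1 := by
  rw [T.height_eq v h.1, h.2]

theorem FractalTree.height_branch {T : FractalTree} {e : T.V → ℕ → T.V}
    (he : ∀ v i, e v i ∈ T.sons v) (ω : ℕ → ℕ) (n : ℕ) :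
    T.height (branch e T.root (firstTerms ω n)) = n := by
  induction n with
  | zero => exact T.height_root
  | succ n ih => rw [firstTerms, branch, T.height_of_mem_sons (he _ _), ih]

theorem FractalTree.exists_height_eq {T : FractalTree} (h : ∀ τ, (T.sons τ).Nonempty) (n : ℕ) :
    ∃ v, T.height v = n := by
  choose s hs using h
  exact ⟨_, T.height_branch (e := fun v _ => s v) (fun v _ => hs v) (fun _ => 0) n⟩

theorem Set.exists_nat_injOn_of_le_encard {α : Type*} {s : Set α} {N : ℕ} (hs : s.Nonempty)
    (h : (N : ℕ∞) ≤ s.encard) :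
    ∃ f : ℕ → α, (∀ i, f i ∈ s) ∧ Set.InjOn f (Set.Iio N) := by
  obtain ⟨t, hts, ht⟩ := Set.exists_subset_encard_eq h
  have : t.Finite := Set.finite_of_encard_eq_coe ht
  have hcard : this.toFinset.card = N := by
    rw [this.encard_eq_coe_toFinset_card] at ht
    exact_mod_cast ht
  obtain ⟨a, ha⟩ := hs
  let g := this.toFinset.equivFinOfCardEq hcard
  refine ⟨fun i => if hi : i < N then g.symm ⟨i, hi⟩ else a, fun i => ?_, fun i hi j hj hij => ?_⟩
  · dsimp only
    split_ifs with hi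
    · exact hts (this.mem_toFinset.1 (g.symm ⟨i, hi⟩).2)
    · exact ha
  · rw [Set.mem_Iio] at hi hj
    simpa [hi, hj] using hij

/-- A regular structure with at least `N j` sons at each vertex of height `j` carries a
measure whose values are controlled by the proportions of sons meeting a given set. -/
theorem exists_measure_fractal (T : FractalTree) (β : T.V → Set (EuclideanSpace ℝ (Fin 2)))
    (hreg : IsRegularStructure T β) (hne : ∀ v, (β v).Nonempty) (hcomp : ∀ v, IsCompact (β v))
    {N : ℕ → ℕ} (hN : ∀ j, 0 < N j)
    (hsons : ∀ v, (N (T.height v) : ℕ∞) ≤ (T.sons v).encard) :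
    ∃ μ : Measure (EuclideanSpace ℝ (Fin 2)), 1 ≤ μ (Fractal T β) ∧
      ∀ Q, IsClosed Q → ∀ (m : ℕ) (κ : ℕ → ℝ), (∀ j, 0 ≤ κ j) →
        (∀ v, T.height v < m → ∀ F : Finset T.V, (F : Set T.V) ⊆ T.sons v →
          (∀ τ ∈ F, (β τ ∩ Q).Nonempty) → F.card ≤ N (T.height v) →
          (F.card : ℝ) ≤ κ (T.height v) * N (T.height v)) →
        μ Q ≤ ENNReal.ofReal (∏ j ∈ Finset.range m, κ j) := by
  classical
  obtain ⟨hs, hnest, hdiam⟩ := hreg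
  choose e he hinj using fun v => Set.exists_nat_injOn_of_le_encard (hs v) (hsons v)
  let b : (ℕ → ℕ) → ℕ → T.V := fun ω n => branch e T.root (firstTerms ω n)
  have hbd : ∀ ω, T.IsBoundary (b ω) := fun ω n => he _ _
  have hheight : ∀ ω n, T.height (b ω n) = n := FractalTree.height_branch he
  have hinter : ∀ ω, (⋂ n, β (b ω n)).Nonempty := fun ω =>
    IsCompact.nonempty_iInter_of_sequence_nonempty_isCompact_isClosed _
      (fun n => (hbd ω n).2 ▸ hnest _ (hbd ω n).1) (fun n => hne _) (hcomp _)
      (fun n => (hcomp _).isClosed)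
  choose π hπ using hinter
  choose p hp using hne
  have hπ' : ∀ ω n, π ω ∈ β (b ω n) := fun ω n => Set.mem_iInter.1 (hπ ω) n
  have hmeas : Measurable π := by
    refine measurable_of_tendsto_metrizable (f := fun n ω => p (b ω n))
      (fun n => measurable_comp_firstTerms (fun l => p (branch e T.root l)) n) ?_
    refine tendsto_pi_nhds.2 fun ω => tendsto_iff_dist_tendsto_zero.2 ?_
    exact squeeze_zero (fun _ => dist_nonneg)
      (fun n => Metric.dist_le_diam_of_mem (hcomp _).isBounded (hp _) (hπ' ω n)) (hdiam _ (hbd ω))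
  have _ := fun j => uniformOn_Iio_isProbabilityMeasure (hN j)
  refine ⟨(choiceMeasure N).map π, ?_, fun Q hQ m κ hκ h => ?_⟩
  · refine le_trans ?_ (Measure.le_map_apply hmeas.aemeasurable _)
    have : π ⁻¹' Fractal T β = Set.univ :=
      Set.eq_univ_of_forall fun ω => ⟨b ω, hbd ω, hπ' ω⟩
    rw [this, choiceMeasure, measure_univ]
  · rw [Measure.map_apply hmeas hQ.measurableSet]
    have hsub : π ⁻¹' Q ⊆ {ω | ∀ j, branch e T.root (firstTerms ω j) ∈ {v | (β v ∩ Q).Nonempty}} :=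
      fun ω hω j => ⟨π ω, hπ' ω j, hω⟩
    refine (measure_mono hsub).trans
      (choiceMeasure_branch_mem_le e T.root hN {v | (β v ∩ Q).Nonempty} κ hκ m ?_)
    intro j hj ω F hF hFG
    have hv := hheight ω j
    have hF' : Set.InjOn (e (b ω j)) F := (hinj (b ω j)).mono fun i hi => by
      simpa [hv] using hF i hi
    have hle : F.card ≤ N j := by
      simpa using Finset.card_le_card (t := Finset.range (N j)) fun i hi => by
        simpa using hF i hi
    have := h (b ω j) (by rwa [hv]) (F.image (e (b ω j)))
      (by
        intro v hv'
        obtain ⟨i, -, rfl⟩ := Finset.mem_image.1 hv'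
        exact he _ _)
      (by
        intro v hv'
        obtain ⟨i, hi, rfl⟩ := Finset.mem_image.1 hv'
        exact hFG i hi)
      (by rwa [Finset.card_image_of_injOn hF', hv])
    rwa [Finset.card_image_of_injOn hF', hv] at this

theorem IsRectangle.isCompact {S : Set (EuclideanSpace ℝ (Fin 2))} {w l : ℝ}
    (h : IsRectangle S w l) : IsCompact S := by
  obtain ⟨a, b, rfl⟩ := h
  have := (EuclideanSpace.equiv (Fin 2) ℝ).toHomeomorph.isCompact_preimage.2
    (isCompact_Icc (a := ![a, b]) (b := ![a + w, b + l]))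
  convert this using 1
  ext x
  simp [Pi.le_def, Fin.forall_fin_two, and_and_and_comm]

theorem IsRectangle.nonempty {S : Set (EuclideanSpace ℝ (Fin 2))} {w l : ℝ}
    (h : IsRectangle S w l) (hw : 0 ≤ w) (hl : 0 ≤ l) : S.Nonempty := by
  obtain ⟨a, b, rfl⟩ := h
  exact ⟨!₂[a, b], by simp [hw, hl]⟩

theorem IsRectangle.le_of_subset {S S' : Set (EuclideanSpace ℝ (Fin 2))} {w l w' l' : ℝ}
    (h : IsRectangle S w l) (h' : IsRectangle S' w' l') (hw : 0 ≤ w) (hl : 0 ≤ l)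
    (hS : S ⊆ S') : w ≤ w' ∧ l ≤ l' := by
  obtain ⟨a, b, rfl⟩ := h
  obtain ⟨a', b', rfl⟩ := h'
  have h1 := @hS !₂[a, b] (by simp [hw, hl])
  have h2 := @hS !₂[a + w, b + l] (by simp [hw, hl])
  simp only [Set.mem_ofPred_eq, Set.mem_Icc, Matrix.cons_val_zero,
    Matrix.cons_val_one] at h1 h2
  constructor <;> linarith [h1.1.1, h1.2.1, h2.1.2, h2.2.2]

/-- The number of `δ`-separated vertical segments of length `l` lying in a vertical strip of
width about `w` and meeting a horizontal strip of height `2 ε`. -/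
theorem card_le_of_separated_segments {ι : Type*} (F : Finset ι) (x y : ι → ℝ)
    {A w δ l y₀ ε H : ℝ} (hδ : 0 < δ) (hδw : δ ≤ w) (hl : 0 < l) (hlH : l ≤ H) (hεH : ε ≤ H)
    (hε : 0 ≤ ε)
    (hx : ∀ i ∈ F, x i ∈ Set.Icc A (A + w))
    (hy : ∀ i ∈ F, y i ∈ Set.Icc (y₀ - ε - l) (y₀ + ε))
    (hsep : ∀ i ∈ F, ∀ j ∈ F, i ≠ j → ∀ s, s ∈ Set.Icc (y i) (y i + l) →
      s ∈ Set.Icc (y j) (y j + l) → δ ≤ |x i - x j|) :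
    (F.card : ℝ) ≤ 12 * (H / l) * (w / δ) := by
  classical
  set p := ⌈ε / l⌉ with hp
  set q := ⌊w / δ⌋ with hq
  have hεl : 0 ≤ ε / l := by positivity
  have hcard : F.card ≤ (Finset.Icc (-p - 1) p ×ˢ Finset.Icc 0 q).card := by
    refine Finset.card_le_card_of_injOn (fun i => (⌈(y i - y₀) / l⌉, ⌊(x i - A) / δ⌋)) ?_ ?_
    · intro i hi
      obtain ⟨hx1, hx2⟩ := hx i hi
      obtain ⟨hy1, hy2⟩ := hy i hi
      simp only [Finset.coe_product, Finset.coe_Icc, Set.mem_prod, Set.mem_Icc]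
      refine ⟨⟨?_, ?_⟩, ?_, ?_⟩
      · have h1 : ((-p - 1 : ℤ) : ℝ) ≤ (y i - y₀) / l := by
          push_cast
          rw [le_div_iff₀ hl]
          have := Int.le_ceil (ε / l)
          rw [← hp, div_le_iff₀ hl] at this
          linarith
        exact_mod_cast h1.trans (Int.le_ceil _)
      · exact Int.ceil_le_ceil (by gcongr; linarith)
      · exact Int.floor_nonneg.2 (div_nonneg (by linarith) hδ.le)
      · exact Int.floor_le_floor (by gcongr; linarith)
    · intro i hi j hj hij
      by_contra hne
      simp only [Prod.mk.injEq] at hij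
      obtain ⟨h1, h2⟩ := hij
      have key : ∀ i', y₀ + l * ⌈(y i' - y₀) / l⌉ ∈ Set.Icc (y i') (y i' + l) := by
        intro i'
        have h3 := Int.le_ceil ((y i' - y₀) / l)
        have h4 := Int.ceil_lt_add_one ((y i' - y₀) / l)
        rw [div_le_iff₀ hl] at h3
        rw [← sub_lt_iff_lt_add, lt_div_iff₀ hl] at h4
        constructor <;> linarith
      have h3 := hsep i hi j hj hne _ (key i) (h1 ▸ key j)
      have h4 := Int.abs_sub_lt_one_of_floor_eq_floor h2
      rw [← sub_div, abs_div, abs_of_pos hδ, div_lt_one hδ] at h4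
      have : x i - A - (x j - A) = x i - x j := by ring
      rw [this] at h4
      linarith
  have hp0 : 0 ≤ p := Int.ceil_nonneg hεl
  have hq0 : 0 ≤ q := Int.floor_nonneg.2 (div_nonneg (by linarith) hδ.le)
  have hprod : ((Finset.Icc (-p - 1) p ×ˢ Finset.Icc 0 q).card : ℝ) = (2 * p + 2) * (q + 1) := by
    rw [Finset.card_product, Int.card_Icc, Int.card_Icc]
    have h1 : (((p + 1 - (-p - 1)).toNat : ℤ)) = 2 * p + 2 := by
      rw [Int.toNat_of_nonneg (by lia)]; ring
    have h2 : (((q + 1 - 0).toNat : ℤ)) = q + 1 := by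
      rw [Int.toNat_of_nonneg (by lia)]; ring
    have h1' : (((p + 1 - (-p - 1)).toNat : ℝ)) = 2 * p + 2 := by exact_mod_cast h1
    have h2' : (((q + 1 - 0).toNat : ℝ)) = q + 1 := by exact_mod_cast h2
    push_cast
    rw [h1', h2']
  have hH : 1 ≤ H / l := (one_le_div hl).2 hlH
  have hw : 1 ≤ w / δ := (one_le_div hδ).2 hδw
  have hp1 : (p : ℝ) < ε / l + 1 := Int.ceil_lt_add_one _
  have hεH' : ε / l ≤ H / l := by gcongr
  have hq1 : (q : ℝ) ≤ w / δ := Int.floor_le _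
  calc (F.card : ℝ) ≤ (2 * p + 2) * (q + 1) := by rw [← hprod]; exact_mod_cast hcard
    _ ≤ (6 * (H / l)) * (2 * (w / δ) ) := by
      have : (0 : ℝ) ≤ q := by exact_mod_cast hq0
      gcongr <;> linarith
    _ = _ := by ring

theorem exists_sub_le_of_eventually_step {f g : ℕ → ℝ}
    (h : ∀ᶠ n in atTop, g (n + 1) - g n ≤ f (n + 1) - f n) :
    ∃ c, ∀ᶠ n in atTop, g n - c ≤ f n := by
  obtain ⟨N, hN⟩ := eventually_atTop.1 h
  refine ⟨g N - f N, eventually_atTop.2 ⟨N, fun n hn => ?_⟩⟩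
  induction n, hn using Nat.le_induction with
  | base => linarith
  | succ n hn ih => linarith [hN n hn]

section RatioLimit

variable {W L C : ℕ → ℝ} {r : ℝ}

theorem eventually_log_step_bounds (hW : ∀ n, 0 < W n) (hL : ∀ n, 0 < L n) (hC : ∀ n, 0 < C n)
    (hWanti : Antitone W) (hr : 0 < r)
    (hlim : Tendsto (fun n : ℕ => Real.log (L n * C n / L (n - 1)) /
      (-Real.log (W n / W (n - 1)))) atTop (nhds r)) {s t : ℝ} (hs : s < r) (ht : r < t) :
    ∀ᶠ n : ℕ in atTop,
      s * (Real.log (W n) - Real.log (W (n + 1))) ≤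
        Real.log (C (n + 1)) + Real.log (L (n + 1)) - Real.log (L n) ∧
      Real.log (C (n + 1)) + Real.log (L (n + 1)) - Real.log (L n) ≤
        t * (Real.log (W n) - Real.log (W (n + 1))) := by
  have h := (tendsto_add_atTop_iff_nat 1).2 hlim
  filter_upwards [h.eventually_const_lt (max_lt hs hr), h.eventually_lt_const ht] with n h1 h2
  rw [Nat.add_sub_cancel, Real.log_div (mul_pos (hL _) (hC _)).ne' (hL _).ne',
    Real.log_mul (hL _).ne' (hC _).ne', Real.log_div (hW _).ne' (hW _).ne'] at h1 h2
  have hw : 0 ≤ -(Real.log (W (n + 1)) - Real.log (W n)) := by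
    linarith [Real.log_le_log (hW _) (hWanti n.le_succ)]
  have hw' : 0 < -(Real.log (W (n + 1)) - Real.log (W n)) := by
    refine hw.lt_of_ne fun h0 => ?_
    rw [← h0, div_zero] at h1
    exact (le_max_right s 0).not_gt h1
  have h1' := (le_max_left s 0).trans_lt h1
  rw [lt_div_iff₀ hw'] at h1'
  rw [div_lt_iff₀ hw'] at h2
  constructor <;> linarith

theorem exists_quadratic_le_neg_log (hW : ∀ n, 0 < W n) (hL : ∀ n, 0 < L n) (hC : ∀ n, 0 < C n)
    (hWanti : Antitone W) (hWL : ∀ n, W n ≤ L n) (hr : 0 < r) {k : ℕ} (hk : 0 < k)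
    (hCk : ∀ᶠ n : ℕ in atTop, Real.exp ((n : ℝ) / k) ≤ C n)
    (hlim : Tendsto (fun n : ℕ => Real.log (L n * C n / L (n - 1)) /
      (-Real.log (W n / W (n - 1)))) atTop (nhds r)) :
    ∃ c > 0, ∃ c₁, ∀ᶠ n : ℕ in atTop, c * (n : ℝ) ^ 2 - c₁ ≤ -Real.log (W n) := by
  have hk' : (0 : ℝ) < k := by exact_mod_cast hk
  obtain ⟨c₁, hc₁⟩ := exists_sub_le_of_eventually_step
    (g := fun n : ℕ => (n : ℝ) ^ 2 / (2 * k))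
    (f := fun n => (r + 1) * (-Real.log (W n)) - Real.log (L n)) (by
      filter_upwards [(tendsto_add_atTop_nat 1).eventually hCk,
        eventually_log_step_bounds hW hL hC hWanti hr hlim (s := 0) (t := r + 1) hr (by linarith)]
        with n h1 h2
      have h3 := (Real.le_log_iff_exp_le (hC _)).2 h1
      have h4 : ((n + 1 : ℕ) : ℝ) ^ 2 / (2 * k) - (n : ℝ) ^ 2 / (2 * k) ≤ ((n + 1 : ℕ) : ℝ) / k := by
        rw [← sub_div, div_le_div_iff₀ (by positivity) hk']
        push_cast
        nlinarith
      linarith [h2.2])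
  refine ⟨1 / (2 * k * (r + 2)), by positivity, c₁ / (r + 2), ?_⟩
  filter_upwards [hc₁] with n hn
  have h1 := Real.log_le_log (hW n) (hWL n)
  have h2 : 1 / (2 * k * (r + 2)) * (n : ℝ) ^ 2 - c₁ / (r + 2) =
      ((n : ℝ) ^ 2 / (2 * k) - c₁) / (r + 2) := by
    field_simp
  rw [h2, div_le_iff₀ (by linarith)]
  linarith

theorem exists_le_log_prod_add_log (hW : ∀ n, 0 < W n) (hL : ∀ n, 0 < L n) (hC : ∀ n, 0 < C n)
    (hWanti : Antitone W) (hr : 0 < r)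
    (hlim : Tendsto (fun n : ℕ => Real.log (L n * C n / L (n - 1)) /
      (-Real.log (W n / W (n - 1)))) atTop (nhds r)) {s : ℝ} (hs : s < r) :
    ∃ c, ∀ᶠ n : ℕ in atTop, s * (-Real.log (W n)) - c ≤
      Real.log (∏ i ∈ Finset.range n, C (i + 1)) + Real.log (L n) := by
  refine exists_sub_le_of_eventually_step ?_
  filter_upwards [eventually_log_step_bounds hW hL hC hWanti hr hlim hs (lt_add_one r)] with n h
  rw [Finset.prod_range_succ, Real.log_mul (Finset.prod_pos fun i _ => hC _).ne' (hC _).ne']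
  linarith [h.1]

theorem eventually_mul_log_le_quadratic {k : ℕ} (hk : 0 < k) {c : ℝ} (hc : 0 < c) (c₁ D : ℝ) :
    ∀ᶠ n : ℕ in atTop, D + (k * (n + 1) : ℝ) * (D + k * Real.log (k * (n + 1))) ≤
      c * ((n : ℝ) - 1) ^ 2 - c₁ := by
  have hk' : (0 : ℝ) < k := by exact_mod_cast hk
  have hδ : 0 < c / (32 * k ^ 3) := by positivity
  have ht : Tendsto (fun n : ℕ => (k * (n + 1) : ℝ)) atTop atTop :=
    (tendsto_natCast_atTop_atTop.atTop_add tendsto_const_nhds).const_mul_atTop hk'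
  filter_upwards [ht.eventually (Real.isLittleO_log_id_atTop.bound hδ), eventually_ge_atTop 2,
    tendsto_natCast_atTop_atTop.eventually_ge_atTop
      (8 * (|D| + |c₁| + 2 * k * |D|) / c)] with n h1 h2 h3
  have hn : (2 : ℝ) ≤ n := by exact_mod_cast h2
  set t : ℝ := k * (n + 1) with ht'
  have ht0 : 0 < t := by positivity
  have ht2 : t ≤ 2 * k * n := by nlinarith
  have hlog : Real.log t ≤ c / (32 * k ^ 3) * t := by
    have := (le_abs_self _).trans h1
    simpa [abs_of_pos ht0] using this
  have e1 : t * (k * Real.log t) ≤ c / 8 * n ^ 2 := by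
    calc t * (k * Real.log t) ≤ t * (k * (c / (32 * k ^ 3) * t)) := by gcongr
      _ = k * (c / (32 * k ^ 3)) * t ^ 2 := by ring
      _ ≤ k * (c / (32 * k ^ 3)) * (2 * k * n) ^ 2 := by gcongr
      _ = _ := by field_simp; ring
  have e2 : t * D ≤ 2 * k * |D| * n := by
    calc t * D ≤ t * |D| := by gcongr; exact le_abs_self D
      _ ≤ 2 * k * n * |D| := by gcongr
      _ = _ := by ring
  have e3 : (|D| + |c₁| + 2 * k * |D|) * n ≤ c / 8 * n ^ 2 := by
    rw [div_le_iff₀ hc] at h3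
    nlinarith
  have e4 : D + c₁ ≤ (|D| + |c₁|) * n := by
    nlinarith [le_abs_self D, le_abs_self c₁, abs_nonneg D, abs_nonneg c₁]
  have e5 : c / 4 * n ^ 2 ≤ c * ((n : ℝ) - 1) ^ 2 := by
    have : (0 : ℝ) ≤ c * ((n - 2) * (3 * n - 2)) :=
      mul_nonneg hc.le (mul_nonneg (by linarith) (by linarith))
    linarith
  linarith

theorem eventually_cover_bound_le_rpow {ρ : ℕ → ℝ} (hW : ∀ n, 0 < W n) (hL : ∀ n, 0 < L n)
    (hρ : ∀ n, 0 < ρ n) (hC : ∀ n, 0 < C n)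
    (hWanti : Antitone W) (hWL : ∀ n, W n ≤ L n) (hr : 0 < r) {k : ℕ} (hk : 0 < k)
    (hCk : ∀ᶠ n : ℕ in atTop, Real.exp ((n : ℝ) / k) ≤ C n)
    (hρk : ∀ᶠ n : ℕ in atTop, Real.exp (-((n : ℝ) * k)) ≤ ρ n)
    (hlim : Tendsto (fun n : ℕ => Real.log (L n * C n / L (n - 1)) /
      (-Real.log (W n / W (n - 1)))) atTop (nhds r)) {d : ℝ} (hd : 1 ≤ d) (hdr : d < 1 + r) :
    ∀ᶠ n : ℕ in atTop, ∀ ε, ρ (n + 1) * W n ≤ ε → ε ≤ W (n - 1) →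
      (∏ i ∈ Finset.range n, C (i + 1))⁻¹ * (12 * (k * (n + 1) : ℝ) ^ k) ^ (k * (n + 1)) *
        (ε / ρ (n + 1) / L n) ≤ ε ^ d := by
  set η := (1 + r - d) / 2 with hη
  have hη0 : 0 < η := by linarith
  have hs0 : 0 ≤ r - η := by linarith
  have hk' : (0 : ℝ) < k := by exact_mod_cast hk
  obtain ⟨c, hc, c₁, h1⟩ := exists_quadratic_le_neg_log hW hL hC hWanti hWL hr hk hCk hlim
  obtain ⟨c₂, h2⟩ := exists_le_log_prod_add_log hW hL hC hWanti hr hlim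
    (show r - η < r by linarith)
  have h3 := eventually_mul_log_le_quadratic hk (mul_pos hη0 hc) (η * c₁)
    (max c₂ (r - η + 1 + Real.log 12))
  filter_upwards [(tendsto_sub_atTop_nat 1).eventually h1, h2, h3, eventually_ge_atTop 1,
    (tendsto_add_atTop_nat 1).eventually hρk] with n h1 h2 h3 hn hρn ε hε1 hε2
  have hε : 0 < ε := (mul_pos (hρ _) (hW _)).trans_le hε1
  set t : ℝ := k * (n + 1) with ht
  have ht0 : 0 < t := by positivity
  set P := ∏ i ∈ Finset.range n, C (i + 1) with hP
  have hP0 : 0 < P := Finset.prod_pos fun i _ => hC _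
  have hB0 : 0 < 12 * t ^ k := by positivity
  have hlogρ : -t ≤ Real.log (ρ (n + 1)) := by
    rw [Real.le_log_iff_exp_le (hρ _)]
    convert hρn using 2
    rw [ht]; push_cast; ring
  have hlogW : Real.log (ρ (n + 1)) + Real.log (W n) ≤ Real.log ε := by
    rw [← Real.log_mul (hρ _).ne' (hW _).ne']
    exact Real.log_le_log (mul_pos (hρ _) (hW _)) hε1
  have hlogε : Real.log ε ≤ Real.log (W (n - 1)) := Real.log_le_log hε hε2
  rw [Nat.cast_sub hn, Nat.cast_one] at h1
  have hx : c * ((n : ℝ) - 1) ^ 2 - c₁ ≤ -Real.log ε := h1.trans (by linarith)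
  rw [← Real.log_le_log_iff (by have := hρ (n + 1); have := hL n; positivity)
    (Real.rpow_pos_of_pos hε _), Real.log_rpow hε, Real.log_mul (by positivity)
    (by have := hρ (n + 1); have := hL n; positivity), Real.log_mul (by positivity) (by positivity),
    Real.log_inv, Real.log_pow, Real.log_div (div_pos hε (hρ _)).ne' (hL _).ne',
    Real.log_div hε.ne' (hρ _).ne', Real.log_mul (by norm_num) (by positivity), Real.log_pow]
  have hcast : ((k * (n + 1) : ℕ) : ℝ) = t := by rw [ht]; push_cast; ring
  rw [hcast]
  have h4 : (r - η) * (-Real.log ε - t) ≤ (r - η) * (-Real.log (W n)) :=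
    mul_le_mul_of_nonneg_left (by linarith) hs0
  have h5 : t * (r - η + 1 + Real.log 12) ≤ t * max c₂ (r - η + 1 + Real.log 12) :=
    mul_le_mul_of_nonneg_left (le_max_right _ _) ht0.le
  have h6 := le_max_left c₂ (r - η + 1 + Real.log 12)
  have h7 := mul_le_mul_of_nonneg_left hx hη0.le
  have h8 : d = 1 + r - 2 * η := by rw [hη]; ring
  rw [h8]
  linarith

end RatioLimit

section SonCount

variable {T : FractalTree} {β : T.V → Set (EuclideanSpace ℝ (Fin 2))} {W L ρ : ℕ → ℝ}

theorem card_sons_le_one (hsep : ∀ τn τ κ : T.V, τ ∈ T.sons τn → κ ∈ T.sons τn → τ ≠ κ →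
      ∀ x ∈ β τ, ∀ y ∈ β κ, ρ (T.height τn + 1) * W (T.height τn) ≤ dist x y)
    {Q : Set (EuclideanSpace ℝ (Fin 2))} {ε : ℝ} (hQ : ∀ x ∈ Q, ∀ y ∈ Q, dist x y ≤ ε) {v : T.V}
    (hε : ε < ρ (T.height v + 1) * W (T.height v)) {F : Finset T.V}
    (hF : (F : Set T.V) ⊆ T.sons v) (hFQ : ∀ τ ∈ F, (β τ ∩ Q).Nonempty) : F.card ≤ 1 := by
  refine Finset.card_le_one.2 fun τ hτ κ hκ => ?_
  by_contra hne
  obtain ⟨x, hx, hxQ⟩ := hFQ τ hτ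
  obtain ⟨y, hy, hyQ⟩ := hFQ κ hκ
  linarith [hsep v τ κ (hF hτ) (hF hκ) hne x hx y hy, hQ x hxQ y hyQ]

theorem card_sons_le (hnest : ∀ v : T.V, v ≠ T.root → β v ⊆ β (T.parent v))
    (hWpos : ∀ n, 0 < W n) (hLpos : ∀ n, 0 < L n) (hρpos : ∀ n, 0 < ρ n)
    (hrect : ∀ τ : T.V, IsRectangle (β τ) (W (T.height τ)) (L (T.height τ)))
    (hρ1 : ∀ n : ℕ, 1 ≤ n → ρ n ≤ 1)
    (hsep : ∀ τn τ κ : T.V, τ ∈ T.sons τn → κ ∈ T.sons τn → τ ≠ κ →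
      ∀ x ∈ β τ, ∀ y ∈ β κ, ρ (T.height τn + 1) * W (T.height τn) ≤ dist x y)
    {Q : Set (EuclideanSpace ℝ (Fin 2))} {ε : ℝ} (hQ : ∀ x ∈ Q, ∀ y ∈ Q, dist x y ≤ ε) {v : T.V}
    {F : Finset T.V} (hF : (F : Set T.V) ⊆ T.sons v) (hFQ : ∀ τ ∈ F, (β τ ∩ Q).Nonempty)
    {H : ℝ} (hεH : ε ≤ H) (hLH : L (T.height v + 1) ≤ H) :
    (F.card : ℝ) ≤ 12 * H / (L (T.height v + 1) * ρ (T.height v + 1)) := by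
  set j := T.height v with hj
  rcases F.eq_empty_or_nonempty with rfl | ⟨τ₀, hτ₀⟩
  · have h1 := (hLpos (j + 1)).trans_le hLH
    have h2 := hLpos (j + 1)
    have h3 := hρpos (j + 1)
    simp only [Finset.card_empty, Nat.cast_zero]
    positivity
  obtain ⟨q, -, hq⟩ := hFQ τ₀ hτ₀
  have hε : 0 ≤ ε := by simpa using hQ q hq q hq
  choose a b hab using hrect
  have hheight : ∀ τ ∈ F, T.height τ = j + 1 := fun τ hτ => T.height_of_mem_sons (hF hτ)
  have hmem : ∀ τ ∈ F, ∀ s ∈ Set.Icc (b τ) (b τ + L (j + 1)), !₂[a τ, s] ∈ β τ := by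
    intro τ hτ s hs
    rw [hab τ, hheight τ hτ]
    simpa [(hWpos (j + 1)).le] using hs
  have key := card_le_of_separated_segments F a b (A := a v) (w := W j)
    (δ := ρ (j + 1) * W j) (l := L (j + 1)) (y₀ := q 1) (ε := ε) (H := H)
    (mul_pos (hρpos _) (hWpos _)) (mul_le_of_le_one_left (hWpos _).le (hρ1 _ (by lia)))
    (hLpos _) hLH hεH hε ?_ ?_ ?_
  · refine key.trans_eq ?_
    have h1 := (hLpos (j + 1)).ne'
    have h2 := (hρpos (j + 1)).ne'
    have h3 := (hWpos j).ne'
    field_simp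
  · intro τ hτ
    have h1 := hmem τ hτ (b τ) ⟨le_rfl, by linarith [hLpos (j + 1)]⟩
    have h2 := hnest τ (hF hτ).1 h1
    rw [(hF hτ).2, hab v] at h2
    simpa using h2.1
  · intro τ hτ
    obtain ⟨x, hx, hxQ⟩ := hFQ τ hτ
    rw [hab τ, hheight τ hτ] at hx
    obtain ⟨-, hx1, hx2⟩ := hx
    have h1 := (EuclideanSpace.dist_eq x q).symm.le.trans (hQ x hxQ q hq)
    have h2 : |x 1 - q 1| ≤ ε := by
      refine le_trans ?_ h1
      rw [← Real.dist_eq]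
      refine Real.le_sqrt_of_sq_le ?_
      rw [Fin.sum_univ_two]
      linarith [sq_nonneg (dist (x 0) (q 0))]
    rw [abs_le] at h2
    constructor <;> linarith [h2.1, h2.2]
  · intro τ hτ κ hκ hne s hsτ hsκ
    have h1 := hsep v τ κ (hF hτ) (hF hκ) hne _ (hmem τ hτ s hsτ) _ (hmem κ hκ s hsκ)
    rw [EuclideanSpace.dist_eq, Fin.sum_univ_two] at h1
    simpa [Real.sqrt_sq_eq_abs, Real.dist_eq] using h1

end SonCount

/-- A version of the mass distribution principle for subsets of a metric space. -/
theorem le_dimH_of_measure_le_rpow {X : Type*} [MetricSpace X] [MeasurableSpace X] [BorelSpace X]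
    {S : Set X} (μ : Measure X) (hμ : μ S ≠ 0) {d : ℝ} (hd : 0 < d) {ε₀ : ℝ} (hε₀ : 0 < ε₀)
    (h : ∀ ε, 0 < ε → ε < ε₀ → ∀ Q, IsClosed Q → (∀ x ∈ Q, ∀ y ∈ Q, dist x y ≤ ε) →
      μ Q ≤ ENNReal.ofReal (ε ^ d)) : ENNReal.ofReal d ≤ dimH S := by
  refine le_dimH_of_hausdorffMeasure_ne_zero (d := d.toNNReal) fun h0 => hμ ?_
  rw [Real.coe_toNNReal _ hd.le] at h0
  refine le_antisymm (le_trans ?_ h0.le) zero_le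
  refine Measure.le_hausdorffMeasure d μ (ENNReal.ofReal (ε₀ / 2)) (by simpa) (fun s hs => ?_) S
  have hs' : Metric.ediam (closure s) ≤ ENNReal.ofReal (ε₀ / 2) := by rwa [Metric.ediam_closure]
  have hfin : Metric.ediam (closure s) ≠ ⊤ := ne_top_of_le_ne_top ENNReal.ofReal_ne_top hs'
  set D := (Metric.ediam (closure s)).toReal with hD
  have hDε : D ≤ ε₀ / 2 := ENNReal.toReal_le_of_le_ofReal (by positivity) hs'
  have hD' : Metric.ediam s = ENNReal.ofReal D := by
    rw [hD, ENNReal.ofReal_toReal hfin, Metric.ediam_closure]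
  have hdist : ∀ x ∈ closure s, ∀ y ∈ closure s, dist x y ≤ D := fun x hx y hy => by
    rw [dist_edist]
    exact ENNReal.toReal_mono hfin (Metric.edist_le_ediam_of_mem hx hy)
  have hD0 : 0 ≤ D := ENNReal.toReal_nonneg
  rw [hD', ENNReal.ofReal_rpow_of_nonneg hD0 hd.le]
  have hlim : Tendsto (fun ε : ℝ => ENNReal.ofReal (ε ^ d)) (nhdsWithin D (Set.Ioi D))
      (nhds (ENNReal.ofReal (D ^ d))) :=
    ((ENNReal.continuous_ofReal.comp (Real.continuous_rpow_const hd.le)).tendsto D).mono_left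
      nhdsWithin_le_nhds
  refine ge_of_tendsto hlim ?_
  filter_upwards [Ioo_mem_nhdsGT (show D < ε₀ by linarith)] with ε hε
  exact (measure_mono subset_closure).trans
    (h ε (hD0.trans_lt hε.1) hε.2 _ isClosed_closure fun x hx y hy => (hdist x hx y hy).trans hε.1.le)

theorem prod_Ico_mul_div {A : ℝ} {b : ℕ → ℝ} (hb : ∀ j, b j ≠ 0) {n m : ℕ} (hnm : n ≤ m) :
    ∏ j ∈ Finset.Ico n m, A * (b (j + 1) / b j) = A ^ (m - n) * (b m / b n) := by
  induction m, hnm using Nat.le_induction with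
  | base => simp [hb]
  | succ m hm ih =>
    rw [Finset.prod_Ico_succ_top hm, ih, Nat.succ_sub hm, pow_succ]
    have := hb m
    have := hb n
    field_simp

theorem lt_of_ratio_le {W L : ℕ → ℝ} (hW : ∀ n, 0 < W n) (hL : ∀ n, 0 < L n) (hLanti : Antitone L)
    {k n₀ : ℕ} (hk : 0 < k)
    (h : ∀ n, n₀ ≤ n → L (k * n) / L (k * n - 1) ≤ W n / W (n - 1))
    (h₀ : L (k * n₀ - 1) < W (n₀ - 1)) {n : ℕ} (hn : n₀ ≤ n) : L (k * n - 1) < W (n - 1) := by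
  induction n, hn using Nat.le_induction with
  | base => exact h₀
  | succ n hn ih =>
    have h1 := h n hn
    rw [div_le_div_iff₀ (hL _) (hW _)] at h1
    have h2 : W n * L (k * n - 1) < W n * W (n - 1) := mul_lt_mul_of_pos_left ih (hW n)
    refine (hLanti (show k * n ≤ k * (n + 1) - 1 by rw [mul_add]; lia)).trans_lt ?_
    exact lt_of_mul_lt_mul_right (h1.trans_lt h2) (hW _).le

/-- A bound for the proportion of the sons of a vertex of height `j` that meet a set of small
diameter: one son out of `N j` below the height `n` at which separation is lost, and the ratio of
the heights of the rectangles, truncated from below at `h`, from there on. -/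
noncomputable def sonProportion (N : ℕ → ℕ) (L : ℕ → ℝ) (A h : ℝ) (n j : ℕ) : ℝ :=
  if j < n then (N j : ℝ)⁻¹ else A * (max h (L (j + 1)) / max h (L j))

theorem prod_sonProportion_le {N : ℕ → ℕ} {L C : ℕ → ℝ} (hC : ∀ n, 0 < C n)
    (hNC : ∀ j, C (j + 1) ≤ N j) (hL : ∀ n, 0 < L n) {A h : ℝ} (hA : 1 ≤ A) (hh : 0 < h)
    {n m : ℕ} (hnm : n ≤ m) (hLm : L m ≤ h) :
    ∏ j ∈ Finset.range m, sonProportion N L A h n j ≤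
      (∏ i ∈ Finset.range n, C (i + 1))⁻¹ * A ^ (m + 1) * (h / L n) := by
  have h1 : ∏ j ∈ Finset.range n, sonProportion N L A h n j ≤
      (∏ i ∈ Finset.range n, C (i + 1))⁻¹ := by
    rw [← Finset.prod_inv_distrib]
    refine Finset.prod_le_prod (fun j hj => ?_) fun j hj => ?_
    all_goals rw [sonProportion, if_pos (Finset.mem_range.1 hj)]
    · positivity
    · exact inv_anti₀ (hC _) (hNC j)
  have h2 : ∏ j ∈ Finset.Ico n m, sonProportion N L A h n j ≤ A ^ (m + 1) * (h / L n) := by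
    have : ∏ j ∈ Finset.Ico n m, sonProportion N L A h n j =
        ∏ j ∈ Finset.Ico n m, A * (max h (L (j + 1)) / max h (L j)) :=
      Finset.prod_congr rfl fun j hj => by
        rw [sonProportion, if_neg (Finset.mem_Ico.1 hj).1.not_gt]
    rw [this, prod_Ico_mul_div (b := fun j => max h (L j)) (fun j => (lt_max_of_lt_left hh).ne') hnm,
      max_eq_left hLm]
    have := hL n
    gcongr
    · lia
    · exact le_max_right _ _
  rw [← Finset.prod_range_mul_prod_Ico _ hnm, mul_assoc]
  refine mul_le_mul h1 h2 (Finset.prod_nonneg fun j hj => ?_)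
    (inv_nonneg.2 (Finset.prod_nonneg fun i _ => (hC _).le))
  rw [sonProportion, if_neg (Finset.mem_Ico.1 hj).1.not_gt]
  have := hL (j + 1)
  positivity

/-- Corollary of the lower bound theorem for self-affine structures, with local
assumptions: if `log(Lₙ Cₙ / L_{n-1}) / (-log(Wₙ/W_{n-1})) → r > 0`, then the
Hausdorff dimension of the fractal is at least `1 + r`. -/
theorem dimH_fractal_lower_bound_local
    (T : FractalTree) (β : T.V → Set (EuclideanSpace ℝ (Fin 2)))
    (W L ρ C : ℕ → ℝ)
    (hreg : IsRegularStructure T β)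
    (hWpos : ∀ n, 0 < W n) (hLpos : ∀ n, 0 < L n)
    (hρpos : ∀ n, 0 < ρ n) (hCpos : ∀ n, 0 < C n)
    -- (1) every vertex of height `n` carries a rectangle of size `Wₙ × Lₙ`, `Wₙ ≤ Lₙ`
    (hrect : ∀ τ : T.V, IsRectangle (β τ) (W (T.height τ)) (L (T.height τ)))
    (hWL : ∀ n, W n ≤ L n)
    -- (2) `C₀ = 1` and every vertex of height `n-1` has at least `Cₙ` sons
    (hC0 : C 0 = 1)
    (hsons : ∀ n : ℕ, 1 ≤ n → ∀ τ : T.V, T.height τ = n - 1 →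
      ENNReal.ofReal (C n) ≤ ((T.sons τ).encard : ENNReal))
    -- (3) `ρₙ ≤ 1` and distinct sons of a vertex of height `n` are `ρ_{n+1} Wₙ`-separated
    (hρ1 : ∀ n : ℕ, 1 ≤ n → ρ n ≤ 1)
    (hsep : ∀ τn τ κ : T.V, τ ∈ T.sons τn → κ ∈ T.sons τn → τ ≠ κ →
      ∀ x ∈ β τ, ∀ y ∈ β κ, ρ (T.height τn + 1) * W (T.height τn) ≤ dist x y)
    -- additional assumptions, valid for all `n ≥ n₀`
    (hk : ∃ k n₀ : ℕ, 0 < k ∧ 0 < n₀ ∧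
      (∀ n : ℕ, n₀ ≤ n →
        Real.exp ((n : ℝ) / (k : ℝ)) ≤ C n ∧ C n ≤ Real.exp ((k : ℝ) * n) ∧
        Real.exp (-((n : ℝ) * k)) ≤ ρ n ∧
        ((n : ℝ) ^ (k : ℕ))⁻¹ ≤ ρ n * C n * L n / L (n - 1) ∧
        L (k * n) / L (k * n - 1) ≤ W n / W (n - 1)) ∧
      L (k * n₀ - 1) < W (n₀ - 1))
    (r : ℝ) (hr : 0 < r)
    (hlim : Tendsto (fun n : ℕ =>
        Real.log (L n * C n / L (n - 1)) / (-Real.log (W n / W (n - 1))))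
      atTop (nhds r)) :
    ENNReal.ofReal (1 + r) ≤ dimH (Fractal T β) := by

  obtain ⟨k, n₀, hk0, hn₀, hk, hkbase⟩ := hk
  have hnest := hreg.2.1
  have hanti : ∀ n, W (n + 1) ≤ W n ∧ L (n + 1) ≤ L n := by
    intro n
    obtain ⟨v, hv⟩ := T.exists_height_eq hreg.1 (n + 1)
    have hvr : v ≠ T.root := by
      rintro rfl
      rw [T.height_root] at hv
      lia
    have hp : T.height (T.parent v) = n := by
      have := T.height_eq v hvr
      lia
    have h1 := hrect v
    have h2 := hrect (T.parent v)
    rw [hv] at h1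
    rw [hp] at h2
    exact h1.le_of_subset h2 (hWpos _).le (hLpos _).le (hnest v hvr)
  have hWanti : Antitone W := antitone_nat_of_succ_le fun n => (hanti n).1
  have hLanti : Antitone L := antitone_nat_of_succ_le fun n => (hanti n).2
  set N : ℕ → ℕ := fun j => ⌈C (j + 1)⌉₊ with hNdef
  have hN : ∀ j, 0 < N j := fun j => Nat.ceil_pos.2 (hCpos _)
  have hNC : ∀ j, C (j + 1) ≤ N j := fun j => Nat.le_ceil _
  have hNsons : ∀ v, (N (T.height v) : ℕ∞) ≤ (T.sons v).encard := by
    intro v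
    have h := hsons (T.height v + 1) (by lia) v (by lia)
    cases hs : (T.sons v).encard with
    | top => exact le_top
    | coe a =>
      rw [hs, ENat.toENNReal_coe, ← ENNReal.ofReal_natCast,
        ENNReal.ofReal_le_ofReal_iff (Nat.cast_nonneg _)] at h
      exact_mod_cast Nat.ceil_le.2 h
  obtain ⟨μ, hμ1, hμ⟩ := exists_measure_fractal T β hreg
    (fun v => (hrect v).nonempty (hWpos _).le (hLpos _).le) (fun v => (hrect v).isCompact) hN hNsons
  have hCk : ∀ᶠ n : ℕ in atTop, Real.exp ((n : ℝ) / k) ≤ C n :=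
    eventually_atTop.2 ⟨n₀, fun n hn => (hk n hn).1⟩
  have hρk : ∀ᶠ n : ℕ in atTop, Real.exp (-((n : ℝ) * k)) ≤ ρ n :=
    eventually_atTop.2 ⟨n₀, fun n hn => (hk n hn).2.2.1⟩
  have hLW : ∀ n, n₀ ≤ n → L (k * n - 1) < W (n - 1) := fun n hn =>
    lt_of_ratio_le hWpos hLpos hLanti hk0 (fun n hn => (hk n hn).2.2.2.2) hkbase hn
  have hWzero : Tendsto W atTop (nhds 0) := by
    obtain ⟨c, hc, c₁, h⟩ :=
      exists_quadratic_le_neg_log hWpos hLpos hCpos hWanti hWL hr hk0 hCk hlim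
    have h1 : Tendsto (fun n : ℕ => c * (n : ℝ) ^ 2 - c₁) atTop atTop :=
      tendsto_atTop_add_const_right _ _
        (((tendsto_pow_atTop two_ne_zero).comp tendsto_natCast_atTop_atTop).const_mul_atTop hc)
    have h2 := Real.tendsto_exp_atBot.comp
      (tendsto_neg_atTop_atBot.comp (tendsto_atTop_mono' _ h h1))
    refine h2.congr fun n => ?_
    simp [Real.exp_log (hWpos n)]
  have main : ∀ d : ℝ, 1 ≤ d → d < 1 + r → ENNReal.ofReal d ≤ dimH (Fractal T β) := by
    intro d hd hdr
    obtain ⟨n₁, hn₁⟩ := eventually_atTop.1 (eventually_cover_bound_le_rpow hWpos hLpos hρpos hCpos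
      hWanti hWL hr hk0 hCk hρk hlim hd hdr)
    obtain ⟨ε₀, hε₀, hε₀'⟩ : ∃ ε₀ > 0, ∀ j ∈ Finset.range (max n₀ n₁ + 1),
        ε₀ < ρ (j + 1) * W j := by
      have : ∀ᶠ ε in nhdsWithin (0 : ℝ) (Set.Ioi 0),
          ∀ j ∈ Finset.range (max n₀ n₁ + 1), ε < ρ (j + 1) * W j :=
        (Filter.eventually_all_finset _).2 fun j _ =>
          (eventually_lt_nhds (mul_pos (hρpos _) (hWpos _))).filter_mono nhdsWithin_le_nhds
      obtain ⟨ε, h1, h2⟩ := (this.and self_mem_nhdsWithin).exists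
      exact ⟨ε, h2, h1⟩
    refine le_dimH_of_measure_le_rpow μ (zero_lt_one.trans_le hμ1).ne' (by linarith) hε₀ ?_
    intro ε hε hεlt Q hQ hQε
    have hex : ∃ n, ρ (n + 1) * W n ≤ ε := by
      obtain ⟨n, hn⟩ := (hWzero.eventually_lt_const hε).exists
      exact ⟨n, (mul_le_of_le_one_left (hWpos n).le (hρ1 _ (by lia))).trans hn.le⟩
    classical
    obtain ⟨n, hn, hmin⟩ : ∃ n, ρ (n + 1) * W n ≤ ε ∧ ∀ j < n, ε < ρ (j + 1) * W j :=
      ⟨Nat.find hex, Nat.find_spec hex, fun j hj => not_le.1 (Nat.find_min hex hj)⟩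
    have hnlarge : max n₀ n₁ < n := by
      by_contra! hle
      linarith [hε₀' n (Finset.mem_range.2 (by lia))]
    have hn0 : n₀ < n := (le_max_left _ _).trans_lt hnlarge
    have hn1 : n₁ < n := (le_max_right _ _).trans_lt hnlarge
    have hεW : ε ≤ W (n - 1) := by
      have h1 := hmin (n - 1) (by lia)
      exact h1.le.trans (mul_le_of_le_one_left (hWpos _).le (hρ1 _ (by lia)))
    set h := ε / ρ (n + 1) with hh
    have hh0 : 0 < h := div_pos hε (hρpos _)
    have hεh : ε ≤ h := by
      rw [hh, le_div_iff₀ (hρpos _)]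
      exact mul_le_of_le_one_right hε.le (hρ1 _ (by lia))
    have hWh : W n ≤ h := by
      rw [hh, le_div_iff₀ (hρpos _), mul_comm]
      exact hn
    set A : ℝ := 12 * (k * (n + 1) : ℝ) ^ k with hAdef
    have hk1 : (1 : ℝ) ≤ k := by exact_mod_cast hk0
    have hkn : (1 : ℝ) ≤ k * (n + 1) := by nlinarith [(Nat.cast_nonneg n : (0 : ℝ) ≤ n)]
    have hA : 1 ≤ A := by linarith [one_le_pow₀ hkn (n := k)]
    have hm1 : k * (n + 1) - 1 + 1 = k * (n + 1) := Nat.sub_add_cancel (Nat.mul_pos hk0 n.succ_pos)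
    have hnm : n ≤ k * (n + 1) - 1 := by
      have := Nat.le_mul_of_pos_left (n + 1) hk0
      lia
    set m := k * (n + 1) - 1 with hm
    have hLm : L m ≤ h := (hLW (n + 1) (by lia)).le.trans hWh
    have hmax : ∀ j, 0 < max h (L j) := fun j => lt_max_of_lt_left hh0
    refine (hμ Q hQ m (sonProportion N L A h n) (fun j => ?_) ?_).trans
      (ENNReal.ofReal_le_ofReal ((prod_sonProportion_le hCpos hNC hLpos hA hh0 hnm hLm).trans ?_))
    · rw [sonProportion]
      have := (hmax j).le
      have := (hmax (j + 1)).le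
      split_ifs <;> positivity
    · intro v hvm F hF hFQ hFN
      set j := T.height v with hj
      have hNj : (0 : ℝ) < N j := by exact_mod_cast hN j
      rw [sonProportion]
      split_ifs with hjn
      · rw [inv_mul_cancel₀ hNj.ne']
        exact_mod_cast card_sons_le_one hsep hQε (hmin j hjn) hF hFQ
      rcases le_or_gt (L j) h with hLh | hLh
      · rw [max_eq_left hLh, max_eq_left ((hanti j).2.trans hLh), div_self hh0.ne', mul_one]
        calc (F.card : ℝ) ≤ N j := by exact_mod_cast hFN
          _ ≤ A * N j := le_mul_of_one_le_left hNj.le hA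
      · rw [max_eq_right hLh.le]
        set H := max h (L (j + 1)) with hH
        have hH0 : 0 < H := hmax _
        have h1 := card_sons_le hnest hWpos hLpos hρpos hrect hρ1 hsep hQε hF hFQ
          (hεh.trans (le_max_left h (L (j + 1)))) (le_max_right h (L (j + 1)))
        have h2 := (hk (j + 1) (by lia)).2.2.2.1
        rw [Nat.add_sub_cancel, inv_le_iff_one_le_mul₀ (by positivity), div_mul_eq_mul_div,
          le_div_iff₀ (hLpos j), one_mul] at h2
        have h3 : ((j + 1 : ℕ) : ℝ) ≤ k * (n + 1) := by
          have : j + 1 ≤ k * (n + 1) := by lia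
          exact_mod_cast this
        have hρ0 := hρpos (j + 1)
        have hL1 := hLpos (j + 1)
        have hC1 := hCpos (j + 1)
        refine h1.trans ?_
        rw [← hj, ← hH, div_le_iff₀ (mul_pos hL1 hρ0)]
        calc 12 * H = 12 * H / L j * L j := by field_simp [(hLpos j).ne']
          _ ≤ 12 * H / L j *
              (ρ (j + 1) * C (j + 1) * L (j + 1) * ((j + 1 : ℕ) : ℝ) ^ k) := by
            have := hLpos j
            gcongr
          _ ≤ 12 * H / L j *
              (ρ (j + 1) * N j * L (j + 1) * (k * (n + 1) : ℝ) ^ k) := by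
            have := hLpos j
            gcongr
            exact hNC j
          _ = A * (H / L j) * N j * (L (j + 1) * ρ (j + 1)) := by
            rw [hAdef]; ring
    · rw [hm1]
      exact hn₁ n hn1.le ε hn hεW
  refine le_of_forall_lt fun c hc => ?_
  obtain ⟨c', hc1, hc2⟩ := exists_between hc
  have hc2' : c'.toReal < 1 + r := (ENNReal.lt_ofReal_iff_toReal_lt hc2.ne_top).1 hc2
  refine hc1.trans_le (le_trans ?_ (main (max c'.toReal 1) (le_max_right _ _)
    (max_lt hc2' (by linarith))))
  rw [← ENNReal.ofReal_toReal hc2.ne_top]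
  exact ENNReal.ofReal_le_ofReal (by simp)
end

section
/- Let (Q,σ,β) be an admissible fractal relation on ℝ² such that for every τ ∈ Q the set β(τ) is a closed axis-parallel rectangle of width W(τ) and height L(τ) with W(τ) ≤ L(τ). Suppose s is a positive real number such that for all τ ∈ Q one has ∑_{κ ∈ σ(τ)} L(κ)·W(κ)^{s−1} ≤ L(τ)·W(τ)^{s−1}. Then the Hausdorff dimension of ℱ(Q,σ,β) is at most s. -/
open MeasureTheory Filter

/-- A subset of the plane whose coordinates range over two intervals of lengths `p` and `q` has
diameter at most `p + q`. -/
theorem ediam_le_of_coord_mem_Icc {S : Set (EuclideanSpace ℝ (Fin 2))} {a b p q : ℝ}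
    (hS : ∀ x ∈ S, x 0 ∈ Set.Icc a (a + p) ∧ x 1 ∈ Set.Icc b (b + q)) :
    Metric.ediam S ≤ ENNReal.ofReal (p + q) := by
  refine Metric.ediam_le fun x hx y hy => ?_
  rw [edist_dist]
  refine ENNReal.ofReal_le_ofReal ?_
  obtain ⟨⟨hx1, hx2⟩, hx3, hx4⟩ := hS x hx
  obtain ⟨⟨hy1, hy2⟩, hy3, hy4⟩ := hS y hy
  have h0 : |x 0 - y 0| ≤ p := abs_sub_le_iff.2 ⟨by linarith, by linarith⟩
  have h1 : |x 1 - y 1| ≤ q := abs_sub_le_iff.2 ⟨by linarith, by linarith⟩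
  rw [EuclideanSpace.dist_eq, Fin.sum_univ_two, Real.dist_eq, Real.dist_eq]
  refine Real.sqrt_le_iff.2 ⟨?_, ?_⟩
  · linarith [abs_nonneg (x 0 - y 0), abs_nonneg (x 1 - y 1)]
  · nlinarith [abs_nonneg (x 0 - y 0), abs_nonneg (x 1 - y 1)]

theorem IsRectangle.isBounded {S : Set (EuclideanSpace ℝ (Fin 2))} {w l : ℝ}
    (h : IsRectangle S w l) : Bornology.IsBounded S := by
  obtain ⟨a, b, rfl⟩ := h
  exact Metric.isBounded_iff_ediam_ne_top.2
    (ne_top_of_le_ne_top ENNReal.ofReal_ne_top (ediam_le_of_coord_mem_Icc fun _ hx => hx))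

/-- Cutting a rectangle into squares of side `w` bounds its `s`-dimensional Hausdorff premeasure
at any scale not smaller than its diameter. -/
theorem IsRectangle.pre_le {S : Set (EuclideanSpace ℝ (Fin 2))} {w l s : ℝ} {r : ENNReal}
    (h : IsRectangle S w l) (hw : 0 < w) (hwl : w ≤ l) (hs : 0 < s) (hr : Metric.ediam S ≤ r) :
    OuterMeasure.mkMetric'.pre (fun A => Metric.ediam A ^ s) r S ≤
      ENNReal.ofReal (2 * 2 ^ s) * ENNReal.ofReal (l * w ^ (s - 1)) := by
  obtain ⟨a, b, hSab⟩ := h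
  set N : ℕ := ⌊l / w⌋₊ + 1
  let T : Fin N → Set (EuclideanSpace ℝ (Fin 2)) := fun i =>
    S ∩ {x | x 1 ∈ Set.Icc (b + i * w) (b + i * w + w)}
  have hcover : S ⊆ ⋃ i, T i := by
    intro x hx
    have hx' := hx
    rw [hSab] at hx'
    obtain ⟨-, hx1, hx2⟩ := hx'
    have ht : 0 ≤ (x 1 - b) / w := div_nonneg (by linarith) hw.le
    have hi : ⌊(x 1 - b) / w⌋₊ < N :=
      Nat.lt_succ_of_le (Nat.floor_le_floor (by gcongr; linarith))
    have h1 := (le_div_iff₀ hw).1 (Nat.floor_le ht)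
    have h2 := (div_lt_iff₀ hw).1 (Nat.lt_floor_add_one ((x 1 - b) / w))
    refine Set.mem_iUnion.2 ⟨⟨_, hi⟩, hx, ?_, ?_⟩
    · dsimp only
      linarith
    · dsimp only
      linarith
  have hT : ∀ i, OuterMeasure.mkMetric'.pre (fun A => Metric.ediam A ^ s) r (T i) ≤
      ENNReal.ofReal ((w + w) ^ s) := by
    intro i
    refine (OuterMeasure.mkMetric'.pre_le
      ((Metric.ediam_mono Set.inter_subset_left).trans hr)).trans ?_
    rw [← ENNReal.ofReal_rpow_of_pos (by linarith)]
    refine ENNReal.rpow_le_rpow (ediam_le_of_coord_mem_Icc (a := a) (b := b + i * w) ?_) hs.le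
    rintro x ⟨hx, hx1⟩
    rw [hSab] at hx
    exact ⟨hx.1, hx1⟩
  have hN : (N : ℝ) ≤ 2 * (l / w) := by
    have h1 : 1 ≤ l / w := (one_le_div hw).2 hwl
    have h2 := Nat.floor_le (zero_le_one.trans h1)
    simp only [N]
    push_cast
    linarith
  calc OuterMeasure.mkMetric'.pre (fun A => Metric.ediam A ^ s) r S
      ≤ ∑' i, OuterMeasure.mkMetric'.pre (fun A => Metric.ediam A ^ s) r (T i) :=
        (measure_mono hcover).trans (measure_iUnion_le _)
    _ ≤ ∑' _ : Fin N, ENNReal.ofReal ((w + w) ^ s) := ENNReal.tsum_le_tsum hT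
    _ = ENNReal.ofReal (N * (w + w) ^ s) := by
        rw [tsum_fintype, Finset.sum_const, Finset.card_univ, Fintype.card_fin, nsmul_eq_mul,
          ENNReal.ofReal_mul (Nat.cast_nonneg _), ENNReal.ofReal_natCast]
    _ ≤ ENNReal.ofReal (2 * (l / w) * (w + w) ^ s) := by gcongr
    _ = ENNReal.ofReal (2 * 2 ^ s) * ENNReal.ofReal (l * w ^ (s - 1)) := by
        rw [← ENNReal.ofReal_mul (by positivity), ← two_mul w,
          Real.mul_rpow zero_le_two hw.le, Real.rpow_sub_one hw.ne']
        congr 1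
        ring

/-- The part of the fractal of a relation `σ` reached by sequences starting at `τ`. -/
def fractalFrom {Q X : Type*} (σ : Q → Q → Prop) (β : Q → Set X) (τ : Q) : Set X :=
  {y | ∃ f : ℕ → Q, f 0 = τ ∧ (∀ i, σ (f i) (f (i + 1))) ∧ ∀ i, y ∈ β (f i)}

theorem fractalFrom_subset {Q X : Type*} (σ : Q → Q → Prop) (β : Q → Set X) (τ : Q) :
    fractalFrom σ β τ ⊆ β τ := by
  rintro y ⟨f, rfl, -, hy⟩
  exact hy 0

theorem fractalFrom_subset_iUnion {Q X : Type*} (σ : Q → Q → Prop) (β : Q → Set X) (τ : Q) :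
    fractalFrom σ β τ ⊆ ⋃ κ : {κ // σ τ κ}, fractalFrom σ β κ.1 := by
  rintro y ⟨f, rfl, hf, hy⟩
  exact Set.mem_iUnion.2
    ⟨⟨f 1, hf 0⟩, fun i => f (i + 1), rfl, fun i => hf (i + 1), fun i => hy (i + 1)⟩

/-- If diameters tend to zero along every `σ`-chain, then `σ` is well-founded (downwards) on the
pieces of diameter greater than `r`. -/
theorem wellFounded_of_tendsto_diam {Q X : Type*} [PseudoMetricSpace X] {σ : Q → Q → Prop}
    {β : Q → Set X} (hb : ∀ τ, Bornology.IsBounded (β τ))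
    (hlim : ∀ τ : ℕ → Q, (∀ i, σ (τ i) (τ (i + 1))) →
      Tendsto (fun i => Metric.diam (β (τ i))) atTop (nhds 0))
    {r : ENNReal} (hr : 0 < r) :
    WellFounded fun κ τ => σ τ κ ∧ r < Metric.ediam (β τ) := by
  rw [wellFounded_iff_isEmpty_descending_chain]
  refine ⟨fun ⟨f, hf⟩ => ?_⟩
  have h := ENNReal.tendsto_ofReal (hlim f fun i => (hf i).1)
  rw [ENNReal.ofReal_zero] at h
  obtain ⟨i, hi⟩ := (h.eventually_lt_const hr).exists
  rw [Metric.diam, ENNReal.ofReal_toReal (hb (f i)).ediam_ne_top] at hi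
  exact hi.not_gt (hf i).2

/-- A weight `c` that bounds an outer measure on small pieces and does not increase when passing
from a piece to its successors bounds the outer measure of the fractal. -/
theorem outerMeasure_fractalFrom_le {Q X : Type*} [Countable Q] [PseudoMetricSpace X]
    {σ : Q → Q → Prop} {β : Q → Set X} (hb : ∀ τ, Bornology.IsBounded (β τ))
    (hlim : ∀ τ : ℕ → Q, (∀ i, σ (τ i) (τ (i + 1))) →
      Tendsto (fun i => Metric.diam (β (τ i))) atTop (nhds 0))
    {r : ENNReal} (hr : 0 < r) (μ : OuterMeasure X) (c : Q → ENNReal)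
    (hμ : ∀ τ, Metric.ediam (β τ) ≤ r → μ (β τ) ≤ c τ)
    (hc : ∀ τ, ∑' κ : {κ // σ τ κ}, c κ.1 ≤ c τ) (τ : Q) :
    μ (fractalFrom σ β τ) ≤ c τ := by
  induction τ using (wellFounded_of_tendsto_diam hb hlim hr).induction with
  | _ τ ih =>
    rcases le_or_gt (Metric.ediam (β τ)) r with h | h
    · exact (measure_mono (fractalFrom_subset σ β τ)).trans (hμ τ h)
    · calc μ (fractalFrom σ β τ)
          ≤ ∑' κ : {κ // σ τ κ}, μ (fractalFrom σ β κ.1) :=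
            (measure_mono (fractalFrom_subset_iUnion σ β τ)).trans (measure_iUnion_le _)
        _ ≤ ∑' κ : {κ // σ τ κ}, c κ.1 := ENNReal.tsum_le_tsum fun κ => ih κ.1 ⟨κ.2, h⟩
        _ ≤ c τ := hc τ

/-- Upper bound theorem for admissible fractal relations on `ℝ²` whose pieces are
axis-parallel rectangles: if `∑_{κ ∈ σ(τ)} L(κ)·W(κ)^{s-1} ≤ L(τ)·W(τ)^{s-1}` for
all `τ`, then the Hausdorff dimension of the associated fractal is at most `s`. -/
theorem dimH_fractal_relation_upper_bound
    (Q : Type) [Countable Q] (σ : Q → Q → Prop)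
    (β : Q → Set (EuclideanSpace ℝ (Fin 2))) (W L : Q → ℝ)
    (hWpos : ∀ τ, 0 < W τ) (hWL : ∀ τ, W τ ≤ L τ)
    (hrect : ∀ τ, IsRectangle (β τ) (W τ) (L τ))
    -- admissibility
    (hadm₁ : ∀ τ κ, σ τ κ → Metric.diam (β κ) < Metric.diam (β τ))
    (hadm₂ : ∀ τ : ℕ → Q, (∀ i, σ (τ i) (τ (i + 1))) →
      Tendsto (fun i => Metric.diam (β (τ i))) atTop (nhds 0))
    (s : ℝ) (hs : 0 < s)
    (hsum : ∀ τ : Q, ∑' κ : {κ : Q // σ τ κ},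
        ENNReal.ofReal (L κ.1 * W κ.1 ^ (s - 1)) ≤
      ENNReal.ofReal (L τ * W τ ^ (s - 1))) :
    dimH {y : EuclideanSpace ℝ (Fin 2) | ∃ τ : ℕ → Q,
        (∀ i, σ (τ i) (τ (i + 1))) ∧ {y} = ⋂ i, β (τ i)} ≤
      ENNReal.ofReal s := by
  have hsub : {y : EuclideanSpace ℝ (Fin 2) | ∃ τ : ℕ → Q,
      (∀ i, σ (τ i) (τ (i + 1))) ∧ {y} = ⋂ i, β (τ i)} ⊆ ⋃ τ, fractalFrom σ β τ := by
    rintro y ⟨f, hf, hy⟩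
    exact Set.mem_iUnion.2
      ⟨f 0, f, rfl, hf, Set.mem_iInter.1 (hy ▸ Set.mem_singleton y)⟩
  refine (dimH_mono hsub).trans ?_
  rw [dimH_iUnion]
  refine iSup_le fun τ => dimH_le_of_hausdorffMeasure_ne_top (d := s.toNNReal) ?_
  rw [Real.coe_toNNReal s hs.le, Measure.hausdorffMeasure, ← OuterMeasure.coe_mkMetric]
  refine ne_top_of_le_ne_top (b := ENNReal.ofReal (2 * 2 ^ s) *
    ENNReal.ofReal (L τ * W τ ^ (s - 1)))
    (ENNReal.mul_ne_top ENNReal.ofReal_ne_top ENNReal.ofReal_ne_top) ?_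
  refine le_of_tendsto' (OuterMeasure.mkMetric'.tendsto_pre_nat _ _) fun n => ?_
  refine outerMeasure_fractalFrom_le (fun τ => (hrect τ).isBounded) hadm₂
    (ENNReal.inv_pos.2 (ENNReal.natCast_ne_top n)) _
    (fun τ => ENNReal.ofReal (2 * 2 ^ s) * ENNReal.ofReal (L τ * W τ ^ (s - 1)))
    (fun τ h => (hrect τ).pre_le (hWpos τ) (hWL τ) hs h) (fun τ => ?_) τ
  rw [ENNReal.tsum_mul_left]
  gcongr
  exact hsum τ
end

section
/- Fix a weight w=(w₁,w₂) with w₁ ≥ w₂ > 0 and w₁+w₂ = 1. Let u ∈ Q with |u| > 1 be a w-best approximate of x ∈ ℝ². Then A(x, v) < 2^{1/w₂} · A(û, v) for all v ∈ Q with |v| ≤ |u|/2. -/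
open Filter

/-- The `w`-weighted quasi-norm `‖(y₁,y₂)‖_w = max(|y₁|^{1/w₁}, |y₂|^{1/w₂})`. -/
noncomputable def wnorm (w₁ w₂ : ℝ) (y : ℝ × ℝ) : ℝ :=
  max (|y.1| ^ (1 / w₁)) (|y.2| ^ (1 / w₂))

/-- `A(x, v) = ‖q·x − p‖_w` for `v = (p₁, p₂, q)`. -/
noncomputable def Afun (w₁ w₂ : ℝ) (x : ℝ × ℝ) (v : ℤ × ℤ × ℤ) : ℝ :=
  wnorm w₁ w₂ ((v.2.2 : ℝ) * x.1 - (v.1 : ℝ), (v.2.2 : ℝ) * x.2 - (v.2.1 : ℝ))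

/-- `Q` is the set of triples `(p₁, p₂, q) ∈ ℤ² × ℕ` with `gcd(p₁, p₂, q) = 1`. -/
def Qset : Set (ℤ × ℤ × ℤ) :=
  {v | 0 < v.2.2 ∧ Int.gcd (Int.gcd v.1 v.2.1) v.2.2 = 1}

/-- `û = p/q ∈ ℚ² ⊆ ℝ²` for `u = (p, q)`. -/
noncomputable def uhat (u : ℤ × ℤ × ℤ) : ℝ × ℝ :=
  ((u.1 : ℝ) / (u.2.2 : ℝ), (u.2.1 : ℝ) / (u.2.2 : ℝ))

/-- `(p, q) ∈ ℤ² × ℕ` is a `w`-best approximate of `x`: its weighted error beats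
every vector of strictly smaller denominator, and is minimal among vectors with the
same denominator. -/
def IsBest (w₁ w₂ : ℝ) (x : ℝ × ℝ) (u : ℤ × ℤ × ℤ) : Prop :=
  0 < u.2.2 ∧
  (∀ v : ℤ × ℤ × ℤ, 0 < v.2.2 → v.2.2 < u.2.2 →
    Afun w₁ w₂ x u < Afun w₁ w₂ x v) ∧
  (∀ p : ℤ × ℤ, Afun w₁ w₂ x u ≤ Afun w₁ w₂ x (p.1, p.2, u.2.2))

lemma abs_rpow_lt_of_dominant {s t q r x p p' : ℝ} (hs : 0 < s) (hst : s ≤ t) (hq : 0 < q)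
    (hr : 0 < r) (hrq : r ≤ q / 2) (h : |q * x - p| ^ s < |r * x - p'| ^ s) :
    |r * x - p'| ^ s < (2 : ℝ) ^ t * |r * (p / q) - p'| ^ s := by
  have hlt : |q * x - p| < |r * x - p'| :=
    (Real.rpow_lt_rpow_iff (abs_nonneg _) (abs_nonneg _) hs).1 h
  have hdecomp : r * x - p' = (r * (p / q) - p') + r / q * (q * x - p) := by
    field_simp
    ring
  have hratio : r / q ≤ 1 / 2 := by
    rw [div_le_iff₀ hq]
    linarith
  have htri : |r * x - p'| ≤ |r * (p / q) - p'| + r / q * |q * x - p| := by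
    calc |r * x - p'| = |(r * (p / q) - p') + r / q * (q * x - p)| := by rw [← hdecomp]
      _ ≤ _ := abs_add_le _ _
      _ = _ := by rw [abs_mul, abs_of_pos (div_pos hr hq)]
  have hhalf : |r * x - p'| < 2 * |r * (p / q) - p'| := by
    have := mul_le_mul_of_nonneg_right hratio (abs_nonneg (q * x - p))
    linarith
  calc |r * x - p'| ^ s < (2 * |r * (p / q) - p'|) ^ s :=
        Real.rpow_lt_rpow (abs_nonneg _) hhalf hs
    _ = (2 : ℝ) ^ s * |r * (p / q) - p'| ^ s := Real.mul_rpow zero_le_two (abs_nonneg _)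
    _ ≤ (2 : ℝ) ^ t * |r * (p / q) - p'| ^ s := by
        gcongr
        exact one_le_two

/-- If `u ∈ Q` with `|u| > 1` is a `w`-best approximate of `x`, then
`A(x, v) < 2^{1/w₂}·A(û, v)` for every `v ∈ Q` with `|v| ≤ |u|/2`. -/
theorem Afun_lt_of_isBest (w₁ w₂ : ℝ) (hw₂ : 0 < w₂) (hw : w₂ ≤ w₁)
    (hsum : w₁ + w₂ = 1) (x : ℝ × ℝ) (u : ℤ × ℤ × ℤ) (hu : u ∈ Qset)
    (hu1 : 1 < u.2.2) (hbest : IsBest w₁ w₂ x u)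
    (v : ℤ × ℤ × ℤ) (hv : v ∈ Qset) (hvle : (v.2.2 : ℝ) ≤ (u.2.2 : ℝ) / 2) :
    Afun w₁ w₂ x v < (2 : ℝ) ^ (1 / w₂) * Afun w₁ w₂ (uhat u) v := by
  have hq : (0 : ℝ) < u.2.2 := by exact_mod_cast hbest.1
  have hr : (0 : ℝ) < v.2.2 := by exact_mod_cast hv.1
  have hlt := hbest.2.1 v hv.1 (by
    have : (v.2.2 : ℝ) < u.2.2 := by linarith
    exact_mod_cast this)
  have hw₁ : 0 < w₁ := hw₂.trans_le hw
  have hinv : 1 / w₁ ≤ 1 / w₂ := one_div_le_one_div_of_le hw₂ hw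
  have htwo : (0 : ℝ) ≤ 2 ^ (1 / w₂) := by positivity
  simp only [Afun, wnorm, uhat] at hlt ⊢
  rcases le_total (|(v.2.2 : ℝ) * x.1 - v.1| ^ (1 / w₁))
    (|(v.2.2 : ℝ) * x.2 - v.2.1| ^ (1 / w₂)) with hmax | hmax
  · rw [max_eq_right hmax] at hlt ⊢
    exact (abs_rpow_lt_of_dominant (one_div_pos.2 hw₂) le_rfl hq hr hvle
      ((le_max_right _ _).trans_lt hlt)).trans_le
      (mul_le_mul_of_nonneg_left (le_max_right _ _) htwo)
  · rw [max_eq_left hmax] at hlt ⊢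
    exact (abs_rpow_lt_of_dominant (one_div_pos.2 hw₁) hinv hq hr hvle
      ((le_max_left _ _).trans_lt hlt)).trans_le
      (mul_le_mul_of_nonneg_left (le_max_left _ _) htwo)
end
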